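/- arXiv:2204.04556 — 5 statements merged into one kernel-verified Lean document; each statement's English description precedes it below -/
import Mathlib

section
/- V(A) = closure of V(A) = V(E_A). That is: the union over all faces F of P of the preimages under the coordinate projections p_F : ℂ^A → ℂ^F of the discriminant loci ∇_F is a Zariski-closed subset of ℂ^A, and it coincides with the zero locus of the principal A-determinant E_A, i.e. with the union over those faces F for which the closure of ∇_F is a hypersurface in ℂ^F of the preimages p_F^{-1}(closure of ∇_F). -/
/-!
Setting: `d > n` positive integers, `k = d - n`, `A = {a_1, …, a_d} ⊂ ℤ^k` spanning `ℝ^k`,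
with each `a_i = (a_i', 1)`.  `P ⊂ ℝ^{k-1}` is the convex hull of the `a_i'`; a face `F` of `P`
is identified with `{i : a_i' ∈ F}`, equivalently `F` is cut out by an integral linear functional
`λ` with `⟨λ, a_i⟩ = 0` for `i ∈ F` and `⟨λ, a_i⟩ > 0` for `i ∉ F`.

STATEMENT 0: `V(A) = closure(V(A)) = V(E_A)`: the union over all faces `F` of `P` of the
preimages of the discriminant loci `∇_F` is Zariski closed and coincides with the zero locus of
the principal `A`-determinant, i.e. with the union, over those faces `F` for which the Zariski
closure of `∇_F` is a hypersurface in `ℂ^F`, of the preimages of those closures.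
-/

open MvPolynomial

noncomputable section

/-- The monomial value `u ^ a = u₁^{a₁} ⋯ u_k^{a_k}` for `u` in the torus `(ℂ*)^k`. -/
def torusMonomial {k : ℕ} (a : Fin k → ℤ) (u : Fin k → ℂˣ) : ℂ :=
  ((∏ j, u j ^ a j : ℂˣ) : ℂ)

/-- `F ⊆ {1,…,d}` is (the index set of) a nonempty face of `P = conv(a_1', …, a_d')`:
there is an integral linear functional vanishing on the `a_i`, `i ∈ F`, and strictly positive
on the `a_i`, `i ∉ F`. -/
def IsFaceOf {d k : ℕ} (A : Fin d → Fin k → ℤ) (F : Finset (Fin d)) : Prop :=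
  F.Nonempty ∧ ∃ lam : Fin k → ℤ,
    (∀ i ∈ F, ∑ j, lam j * A i j = 0) ∧ ∀ i ∉ F, 0 < ∑ j, lam j * A i j

/-- The discriminant locus `∇_F ⊆ ℂ^F` of `f^F = ∑_{i ∈ F} α_i x^{a_i}`: the set of
coefficient vectors `α` such that all the partial derivatives `∂ f^F/∂ x_l` (equivalently all
the `x_l ∂ f^F/∂ x_l = ∑_{i ∈ F} α_i (a_i)_l x^{a_i}`) vanish simultaneously at some point `u`
of the torus `(ℂ*)^k`. -/
def nabla {d k : ℕ} (A : Fin d → Fin k → ℤ) (F : Finset (Fin d)) : Set (F → ℂ) :=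
  {α | ∃ u : Fin k → ℂˣ, ∀ l : Fin k,
    ∑ i : F, α i * (A i l : ℂ) * torusMonomial (A i) u = 0}

/-- The coordinate projection `p_F : ℂ^A → ℂ^F`. -/
def pProj {d : ℕ} (F : Finset (Fin d)) : (Fin d → ℂ) → (F → ℂ) := fun α i => α i

/-- `V(A) = ⋃_F p_F⁻¹(∇_F)`, the union over all faces `F` of `P`. -/
def VA {d k : ℕ} (A : Fin d → Fin k → ℤ) : Set (Fin d → ℂ) :=
  ⋃ F ∈ {F : Finset (Fin d) | IsFaceOf A F}, pProj F ⁻¹' nabla A F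

/-- The Zariski closure of a subset of affine space `ℂ^σ`: the common zero locus of all
polynomials vanishing on the set. -/
def zClosure {σ : Type*} (s : Set (σ → ℂ)) : Set (σ → ℂ) :=
  {x | ∀ p : MvPolynomial σ ℂ, (∀ y ∈ s, eval y p = 0) → eval x p = 0}

/-- A subset of `ℂ^σ` is a hypersurface if it is the zero locus of a single nontrivial
polynomial equation. -/
def IsHypersurface {σ : Type*} (s : Set (σ → ℂ)) : Prop :=
  ∃ Δ : MvPolynomial σ ℂ, Δ ≠ 0 ∧ ¬ IsUnit Δ ∧ s = {x | eval x Δ = 0}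

/-- The zero locus `V(E_A)` of the principal `A`-determinant `E_A = ∏_F Δ_F^{m_F}`: the union,
over the faces `F` of `P` whose discriminant closure is a hypersurface in `ℂ^F`, of the
preimages under `p_F` of those hypersurfaces `closure(∇_F)`. -/
def VEA {d k : ℕ} (A : Fin d → Fin k → ℤ) : Set (Fin d → ℂ) :=
  ⋃ F ∈ {F : Finset (Fin d) | IsFaceOf A F ∧ IsHypersurface (zClosure (nabla A F))},
    pProj F ⁻¹' zClosure (nabla A F)

namespace ADiscriminant

section Laurent

variable {k : ℕ}

theorem torusMonomial_zero (u : Fin k → ℂˣ) : torusMonomial 0 u = 1 := by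
  simp [torusMonomial]

theorem torusMonomial_add (a b : Fin k → ℤ) (u : Fin k → ℂˣ) :
    torusMonomial (a + b) u = torusMonomial a u * torusMonomial b u := by
  simp [torusMonomial, zpow_add, Finset.prod_mul_distrib]

theorem torusMonomial_ne_zero (a : Fin k → ℤ) (u : Fin k → ℂˣ) : torusMonomial a u ≠ 0 :=
  Units.ne_zero _

theorem torusMonomial_mul (a : Fin k → ℤ) (u v : Fin k → ℂˣ) :
    torusMonomial a (u * v) = torusMonomial a u * torusMonomial a v := by
  simp [torusMonomial, mul_zpow, Finset.prod_mul_distrib]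

/-- Evaluation of Laurent monomials at a point of the torus, as a function of the exponent. -/
def torusChar (u : Fin k → ℂˣ) : Multiplicative (Fin k → ℤ) →* ℂ where
  toFun a := torusMonomial a.toAdd u
  map_one' := torusMonomial_zero u
  map_mul' a b := torusMonomial_add a.toAdd b.toAdd u

/-- Evaluation of Laurent monomials with a given exponent, as a function on the torus. -/
def monomialChar (a : Fin k → ℤ) : (Fin k → ℂˣ) →* ℂ where
  toFun u := torusMonomial a u
  map_one' := by simp [torusMonomial]
  map_mul' u v := torusMonomial_mul a u v

theorem monomialChar_injective :
    Function.Injective (monomialChar : (Fin k → ℤ) → ((Fin k → ℂˣ) →* ℂ)) := by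
  intro a b h
  funext j
  have h2 : (2 : ℂ) ≠ 0 := two_ne_zero
  have := DFunLike.congr_fun h (Function.update (1 : Fin k → ℂˣ) j (Units.mk0 2 h2))
  simp only [monomialChar, MonoidHom.coe_mk, OneHom.coe_mk, torusMonomial] at this
  rw [Finset.prod_eq_single j, Finset.prod_eq_single j] at this
  · simp only [Function.update_self, Units.val_zpow_eq_zpow_val, Units.val_mk0] at this
    have h3 := congrArg norm this
    rw [norm_zpow, norm_zpow] at h3
    exact zpow_right_injective₀ (a := ‖(2 : ℂ)‖) (by simp) (by simp) h3
  all_goals simp +contextual [Function.update_of_ne]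

/-- Laurent polynomials in `k` variables over the polynomial ring `ℂ[σ]`. -/
abbrev LaurentRing (σ : Type) (k : ℕ) := AddMonoidAlgebra (MvPolynomial σ ℂ) (Fin k → ℤ)

variable {σ : Type}

/-- Evaluation of a Laurent polynomial at a point of the parameter space and of the torus. -/
def laurentEval (c : σ → ℂ) (u : Fin k → ℂˣ) : LaurentRing σ k →+* ℂ :=
  AddMonoidAlgebra.liftNCRingHom (eval c) (torusChar u) fun _ _ => Commute.all _ _

theorem laurentEval_single (c : σ → ℂ) (u : Fin k → ℂˣ) (a : Fin k → ℤ) (r : MvPolynomial σ ℂ) :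
    laurentEval c u (AddMonoidAlgebra.single a r) = eval c r * torusMonomial a u := by
  simp [laurentEval, torusChar]

theorem laurentEval_algebraMap (c : σ → ℂ) (u : Fin k → ℂˣ) (r : MvPolynomial σ ℂ) :
    laurentEval c u (algebraMap _ _ r) = eval c r := by
  rw [AddMonoidAlgebra.coe_algebraMap]
  simp [laurentEval_single, torusMonomial_zero]

theorem eq_zero_of_laurentEval_eq_zero (z : LaurentRing σ k)
    (h : ∀ c u, laurentEval c u z = 0) : z = 0 := by
  have key : ∀ a, z.coeff a = 0 := by
    intro a
    apply MvPolynomial.funext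
    intro c
    have hli := (linearIndependent_monoidHom (Fin k → ℂˣ) ℂ).comp monomialChar
      monomialChar_injective
    rw [map_zero]
    by_contra hne
    have ha : a ∈ z.coeff.support := by
      rw [Finsupp.mem_support_iff]; rintro h0; simp [h0] at hne
    refine hne (linearIndependent_iff'.1 hli z.coeff.support (fun b => eval c (z.coeff b)) ?_ a ha)
    funext u
    have := h c u
    conv_lhs at this => rw [← AddMonoidAlgebra.sum_coeff_single z]
    simp only [Finsupp.sum, map_sum, laurentEval_single] at this
    simpa [monomialChar] using this
  ext a
  simp [key]

end Laurent

section Nabla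

variable {d k : ℕ}

theorem nabla_irreducible (A : Fin d → Fin k → ℤ) (F : Finset (Fin d)) {g h : MvPolynomial F ℂ}
    (hgh : ∀ y ∈ nabla A F, eval y (g * h) = 0) :
    (∀ y ∈ nabla A F, eval y g = 0) ∨ (∀ y ∈ nabla A F, eval y h = 0) := by
  classical
  let L : (F → ℂ) →ₗ[ℂ] (Fin k → ℂ) :=
    Matrix.mulVecLin (Matrix.of fun (l : Fin k) (i : F) => (A i l : ℂ))
  obtain ⟨n, f, hf⟩ := Module.Finite.exists_fin' ℂ (LinearMap.ker L)
  have hfsum (c : Fin n → ℂ) (i : F) :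
      (f c : F → ℂ) i = ∑ l, c l * (f (Pi.single l 1) : F → ℂ) i := by
    conv_lhs => rw [LinearMap.pi_apply_eq_sum_univ f c]
    have hs (l : Fin n) : (fun j => if l = j then (1 : ℂ) else 0) = Pi.single l 1 := by
      funext j; simp [Pi.single_apply, eq_comm]
    simp [Finset.sum_apply, hs]
  let Θ : MvPolynomial F ℂ →ₐ[ℂ] LaurentRing (Fin n) k := aeval fun i : F =>
    AddMonoidAlgebra.single (-A i) (∑ l, C ((f (Pi.single l 1) : F → ℂ) i) * X l)
  have hΘ (c : Fin n → ℂ) (u : Fin k → ℂˣ) (p : MvPolynomial F ℂ) :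
      laurentEval c u (Θ p) = eval (fun i => (f c : F → ℂ) i * torusMonomial (-A i) u) p := by
    have : (laurentEval c u).comp (Θ : MvPolynomial F ℂ →+* LaurentRing (Fin n) k) =
        eval (fun i => (f c : F → ℂ) i * torusMonomial (-A i) u) := by
      apply MvPolynomial.ringHom_ext
      · intro r
        have : Θ (C r) = algebraMap (MvPolynomial (Fin n) ℂ) _ (C r) := Θ.commutes r
        rw [RingHom.comp_apply, RingHom.coe_coe, this, laurentEval_algebraMap]
        simp
      · intro i
        rw [RingHom.comp_apply, RingHom.coe_coe, aeval_X, laurentEval_single, eval_X, hfsum c i]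
        simp [mul_comm]
    exact RingHom.congr_fun this p
  have hinv (u : Fin k → ℂˣ) (i : F) : torusMonomial (-A i) u * torusMonomial (A i) u = 1 := by
    rw [← torusMonomial_add, neg_add_cancel, torusMonomial_zero]
  have hmem (c : Fin n → ℂ) (u : Fin k → ℂˣ) :
      (fun i : F => (f c : F → ℂ) i * torusMonomial (-A i) u) ∈ nabla A F := by
    refine ⟨u, fun l => ?_⟩
    have h0 := congrFun (LinearMap.mem_ker.1 (f c).2) l
    simp only [L, Matrix.mulVecLin_apply, Matrix.mulVec, dotProduct, Matrix.of_apply,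
      Pi.zero_apply] at h0
    rw [← h0]
    refine Finset.sum_congr rfl fun i _ => ?_
    linear_combination (f c : F → ℂ) i * (A i l) * hinv u i
  have hsurj (y : F → ℂ) (hy : y ∈ nabla A F) :
      ∃ c u, y = fun i : F => (f c : F → ℂ) i * torusMonomial (-A i) u := by
    obtain ⟨u, hu⟩ := hy
    obtain ⟨c, hc⟩ := hf ⟨fun i => y i * torusMonomial (A i) u, by
      rw [LinearMap.mem_ker]
      funext l
      rw [Pi.zero_apply, ← hu l]
      simp only [L, Matrix.mulVecLin_apply, Matrix.mulVec, dotProduct, Matrix.of_apply]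
      exact Finset.sum_congr rfl fun i _ => by ring⟩
    refine ⟨c, u, funext fun i => ?_⟩
    rw [hc]
    linear_combination -y i * hinv u i
  have hzero : Θ g * Θ h = 0 := by
    rw [← map_mul]
    exact eq_zero_of_laurentEval_eq_zero _ fun c u => (hΘ c u _).trans (hgh _ (hmem c u))
  refine (mul_eq_zero.1 hzero).imp ?_ ?_ <;>
  · intro h0 y hy
    obtain ⟨c, u, rfl⟩ := hsurj y hy
    rw [← hΘ, h0, map_zero]

end Nabla

section Hypersurface

/-- If a polynomial vanishes on the zero locus of a prime polynomial `q`, it is divisible by `q`. -/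
theorem prime_dvd_of_eval_eq_zero {σ : Type*} [Finite σ] {q g : MvPolynomial σ ℂ} (hq : Prime q)
    (h : ∀ x, eval x q = 0 → eval x g = 0) : q ∣ g := by
  have hprime : (Ideal.span {q}).IsPrime := (Ideal.span_singleton_prime hq.ne_zero).2 hq
  rw [← Ideal.mem_span_singleton, ← hprime.radical,
    ← vanishingIdeal_zeroLocus_eq_radical (K := ℂ), mem_vanishingIdeal_iff]
  intro x hx
  rw [mem_zeroLocus_iff] at hx
  exact h x (hx q (Ideal.mem_span_singleton_self q))

theorem mem_vanishingIdeal_iff_eval {σ : Type*} {V : Set (σ → ℂ)} {p : MvPolynomial σ ℂ} :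
    p ∈ vanishingIdeal ℂ V ↔ ∀ x ∈ V, eval x p = 0 := by
  rw [mem_vanishingIdeal_iff]
  rfl

variable {d k : ℕ}

/-- Specialise the variables outside `F` to the values `c`. -/
def specialize (F : Finset (Fin d)) (c : Fin d → ℂ) :
    MvPolynomial (Fin d) ℂ →ₐ[ℂ] MvPolynomial F ℂ :=
  aeval fun i => if h : i ∈ F then X ⟨i, h⟩ else C (c i)

/-- Extend a point of `ℂ^F` by the values `c` outside `F`. -/
def extendBy (F : Finset (Fin d)) (c : Fin d → ℂ) (γ : F → ℂ) : Fin d → ℂ :=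
  fun i => if h : i ∈ F then γ ⟨i, h⟩ else c i

theorem eval_specialize (F : Finset (Fin d)) (c : Fin d → ℂ) (γ : F → ℂ)
    (p : MvPolynomial (Fin d) ℂ) : eval γ (specialize F c p) = eval (extendBy F c γ) p := by
  have : (eval γ).comp (specialize F c : _ →+* MvPolynomial F ℂ) = eval (extendBy F c γ) := by
    apply MvPolynomial.ringHom_ext
    · intro r
      simp [specialize]
    · intro i
      by_cases h : i ∈ F <;> simp [specialize, extendBy, h]
  exact RingHom.congr_fun this p

theorem pProj_extendBy (F : Finset (Fin d)) (c : Fin d → ℂ) (γ : F → ℂ) :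
    pProj F (extendBy F c γ) = γ := by
  funext i
  simp [pProj, extendBy]

theorem extendBy_pProj (F : Finset (Fin d)) (c : Fin d → ℂ) : extendBy F c (pProj F c) = c := by
  funext i
  simp [pProj, extendBy]

theorem eval_rename_pProj (F : Finset (Fin d)) (α : Fin d → ℂ) (h : MvPolynomial F ℂ) :
    eval α (rename (↑) h) = eval (pProj F α) h := by
  rw [eval_rename]
  rfl

theorem specialize_rename (F : Finset (Fin d)) (c : Fin d → ℂ) (h : MvPolynomial F ℂ) :
    specialize F c (rename (↑) h) = h := by
  apply MvPolynomial.funext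
  intro γ
  rw [eval_specialize, eval_rename_pProj, pProj_extendBy]

theorem mem_VA {A : Fin d → Fin k → ℤ} {α : Fin d → ℂ} :
    α ∈ VA A ↔ ∃ F, IsFaceOf A F ∧ pProj F α ∈ nabla A F := by
  simp [VA]

theorem mem_VEA {A : Fin d → Fin k → ℤ} {α : Fin d → ℂ} :
    α ∈ VEA A ↔ ∃ F, (IsFaceOf A F ∧ IsHypersurface (zClosure (nabla A F))) ∧
      pProj F α ∈ zClosure (nabla A F) := by
  simp [VEA]

theorem VEA_subset_zClosure_VA (A : Fin d → Fin k → ℤ) : VEA A ⊆ zClosure (VA A) := by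
  intro α hα
  obtain ⟨F, ⟨hF, -⟩, hαF⟩ := mem_VEA.1 hα
  intro p hp
  rw [← extendBy_pProj F α, ← eval_specialize]
  refine hαF _ fun y hy => ?_
  rw [eval_specialize]
  exact hp _ (mem_VA.2 ⟨F, hF, by rwa [pProj_extendBy]⟩)

theorem vanishingIdeal_nabla_isPrime (A : Fin d → Fin k → ℤ) {F : Finset (Fin d)}
    (hF : (nabla A F).Nonempty) : (vanishingIdeal ℂ (nabla A F)).IsPrime := by
  refine ⟨?_, ?_⟩
  · obtain ⟨y, hy⟩ := hF
    rw [Ideal.ne_top_iff_one, mem_vanishingIdeal_iff_eval]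
    intro h
    simpa using h y hy
  · intro g h hgh
    simp only [mem_vanishingIdeal_iff_eval] at hgh ⊢
    exact nabla_irreducible A F hgh

theorem VA_subset_VEA {A : Fin d → Fin k → ℤ} {E : MvPolynomial (Fin d) ℂ} (hE : E ≠ 0)
    (hVA : VA A = {x | eval x E = 0}) : VA A ⊆ VEA A := by
  classical
  intro α hα
  have hEα : eval α E = 0 := by rwa [hVA] at hα
  obtain ⟨f, hfp, hfE⟩ := UniqueFactorizationMonoid.exists_prime_factors E hE
  obtain ⟨q, hq, hqα, hqE⟩ : ∃ q, Prime q ∧ eval α q = 0 ∧ q ∣ E := by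
    have h0 : eval α f.prod = 0 := by
      obtain ⟨w, hw⟩ := hfE.symm
      rw [← hw, map_mul, hEα, zero_mul]
    rw [map_multiset_prod, Multiset.prod_eq_zero_iff, Multiset.mem_map] at h0
    obtain ⟨q, hqf, hq0⟩ := h0
    exact ⟨q, hfp q hqf, hq0, (Multiset.dvd_prod hqf).trans hfE.dvd⟩
  obtain ⟨F, hF, hqF⟩ : ∃ F, IsFaceOf A F ∧ ∀ g : MvPolynomial (Fin d) ℂ,
      (∀ x, pProj F x ∈ nabla A F → eval x g = 0) → q ∣ g := by
    by_contra! hcon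
    choose! g hg hgq using hcon
    have hdvd : q ∣ ∏ F with IsFaceOf A F, g F := by
      refine prime_dvd_of_eval_eq_zero hq fun x hx => ?_
      have hxVA : x ∈ VA A := by
        rw [hVA]
        obtain ⟨r, rfl⟩ := hqE
        simp [hx]
      obtain ⟨F, hF, hxF⟩ := mem_VA.1 hxVA
      rw [map_prod]
      exact Finset.prod_eq_zero (by simpa using hF) (hg F hF x hxF)
    obtain ⟨F, hF, hdvd⟩ := (hq.dvd_finsetProd_iff _).1 hdvd
    exact hgq F (by simpa using hF) hdvd
  have hqF' (h : MvPolynomial F ℂ) (hh : ∀ y ∈ nabla A F, eval y h = 0) :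
      specialize F α q ∣ h := by
    rw [← specialize_rename F α h]
    refine map_dvd _ (hqF _ fun x hx => ?_)
    rw [eval_rename_pProj]
    exact hh _ hx
  have hqα' : eval (pProj F α) (specialize F α q) = 0 := by
    rw [eval_specialize, extendBy_pProj, hqα]
  have hqunit : ¬ IsUnit (specialize F α q) := fun hu => by
    have := hu.map (eval (pProj F α))
    simp [hqα'] at this
  have hne : (nabla A F).Nonempty := by
    by_contra hemp
    rw [Set.not_nonempty_iff_eq_empty] at hemp
    exact hqunit (isUnit_of_dvd_one (hqF' 1 (by simp [hemp])))
  have hIprime := vanishingIdeal_nabla_isPrime A hne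
  obtain ⟨c, hc⟩ : ∃ c, eval c E ≠ 0 := by
    by_contra! hcon
    exact hE (MvPolynomial.funext fun x => by simp [hcon])
  have hEc : specialize F c E ≠ 0 := fun h0 => hc (by
    rw [← extendBy_pProj F c, ← eval_specialize, h0, map_zero])
  have hEI : specialize F c E ∈ vanishingIdeal ℂ (nabla A F) := by
    rw [mem_vanishingIdeal_iff_eval]
    intro y hy
    rw [eval_specialize]
    have : extendBy F c y ∈ VA A := mem_VA.2 ⟨F, hF, by rwa [pProj_extendBy]⟩
    rwa [hVA] at this
  obtain ⟨f', hfp', hfE'⟩ := UniqueFactorizationMonoid.exists_prime_factors _ hEc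
  have hprod : f'.prod ∈ vanishingIdeal ℂ (nabla A F) := by
    obtain ⟨w, hw⟩ := hfE'.symm
    rw [← hw]
    exact Ideal.mul_mem_right _ _ hEI
  obtain ⟨Δ, hΔf, hΔI⟩ := (hIprime.multiset_prod_mem_iff_exists_mem f').1 hprod
  have hΔ : Prime Δ := hfp' Δ hΔf
  rw [mem_vanishingIdeal_iff_eval] at hΔI
  have hassoc : Associated (specialize F α q) Δ := by
    obtain ⟨r, hr⟩ := hqF' Δ hΔI
    rcases hΔ.irreducible.isUnit_or_isUnit hr with h | h
    · exact absurd h hqunit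
    · exact ⟨h.unit, hr.symm⟩
  have hcl : zClosure (nabla A F) = {x | eval x Δ = 0} := by
    ext x
    refine ⟨fun hx => hx Δ hΔI, fun hx h hh => ?_⟩
    obtain ⟨r, rfl⟩ := hassoc.symm.dvd.trans (hqF' h hh)
    have hx0 : eval x Δ = 0 := hx
    rw [map_mul, hx0, zero_mul]
  refine mem_VEA.2 ⟨F, ⟨hF, Δ, hΔ.ne_zero, hΔ.not_isUnit, hcl⟩, ?_⟩
  rw [hcl]
  obtain ⟨r, hr⟩ := hassoc.dvd
  simp [hr, hqα']

theorem VA_eq_of_hypersurface {A : Fin d → Fin k → ℤ} {E : MvPolynomial (Fin d) ℂ} (hE : E ≠ 0)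
    (hVA : VA A = {x | eval x E = 0}) : VA A = zClosure (VA A) ∧ VA A = VEA A := by
  have hclosed : zClosure (VA A) ⊆ VA A := by
    intro x hx
    rw [hVA]
    exact hx E fun y hy => by rwa [hVA] at hy
  exact ⟨Set.Subset.antisymm (fun x hx p hp => hp x hx) hclosed,
    Set.Subset.antisymm (VA_subset_VEA hE hVA) ((VEA_subset_zClosure_VA A).trans hclosed)⟩

end Hypersurface

section Generic

variable {d k : ℕ}

theorem exists_int_multiples {ι : Type*} [Finite ι] (q : ι → ℚ) :
    ∃ N : ℤ, N ≠ 0 ∧ ∃ m : ι → ℤ, ∀ i, (m i : ℚ) = N * q i := by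
  obtain ⟨b, hb⟩ := IsLocalization.exist_integer_multiples_of_finite (nonZeroDivisors ℤ) q
  choose m hm using hb
  refine ⟨b, nonZeroDivisors.ne_zero b.2, m, fun i => ?_⟩
  have := hm i
  simpa [Algebra.smul_def] using this

/-- Either a row of an integer matrix is separated from other given rows by an integral functional,
or it takes part in an integral linear relation with them. -/
theorem exists_functional_or_relation (A : Fin d → Fin k → ℤ) (M : Finset (Fin d)) (i : Fin d) :
    (∃ φ : Fin k → ℤ, ∑ l, φ l * A i l ≠ 0 ∧ ∀ j ∈ M, j ≠ i → ∑ l, φ l * A j l = 0) ∨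
    (∃ c : Fin d → ℤ, c i ≠ 0 ∧ (∀ j, j ≠ i → j ∉ M → c j = 0) ∧ ∀ l, ∑ j, c j * A j l = 0) := by
  classical
  let a : Fin d → Fin k → ℚ := fun j l => A j l
  by_cases h : a i ∈ Submodule.span ℚ (a '' (M.erase i : Finset (Fin d)))
  · right
    obtain ⟨q', hq⟩ := (Submodule.mem_span_image_finset_iff_exists_fun ℚ).1 h
    let q : Fin d → ℚ := fun j => if hj : j ∈ M.erase i then q' ⟨j, hj⟩ else 0
    replace hq : ∑ j ∈ M.erase i, q j • a j = a i := by
      rw [← hq, ← Finset.sum_coe_sort]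
      refine Finset.sum_congr rfl fun j _ => ?_
      simp only [q, dif_pos j.2]
    obtain ⟨N, hN, m, hm⟩ := exists_int_multiples q
    refine ⟨fun j => if j = i then -N else if j ∈ M then m j else 0, by simpa using hN,
      fun j hj hjM => by simp [hj, hjM], fun l => ?_⟩
    have hql := congrFun hq l
    rw [Finset.sum_apply] at hql
    simp only [Pi.smul_apply, smul_eq_mul, a] at hql
    rw [← Finset.add_sum_erase _ _ (Finset.mem_univ i)]
    have h1 : ∑ j ∈ Finset.univ.erase i,
        (if j = i then -N else if j ∈ M then m j else 0) * A j l =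
        ∑ j ∈ M.erase i, m j * A j l := by
      rw [← Finset.sum_subset (Finset.erase_subset_erase i (Finset.subset_univ M))]
      · refine Finset.sum_congr rfl fun j hj => ?_
        rw [Finset.mem_erase] at hj
        simp [hj.1, hj.2]
      · intro j hj hj'
        simp only [Finset.mem_erase, Finset.mem_univ, and_true] at hj hj'
        simp [hj, show j ∉ M from fun hM => hj' ⟨hj, hM⟩]
    beta_reduce
    rw [h1, if_pos rfl]
    have h2 : (∑ j ∈ M.erase i, m j * A j l : ℚ) = N * A i l := by
      rw [← hql, Finset.mul_sum]
      exact Finset.sum_congr rfl fun j _ => by rw [hm, mul_assoc]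
    have h3 : ∑ j ∈ M.erase i, m j * A j l = N * A i l := by exact_mod_cast h2
    rw [h3]
    ring
  · left
    obtain ⟨f, hf, hfs⟩ := Submodule.exists_le_ker_of_notMem h
    obtain ⟨N, hN, m, hm⟩ := exists_int_multiples fun l => f (Pi.single l 1)
    have key (j : Fin d) : ((∑ l, m l * A j l : ℤ) : ℚ) = N * f (a j) := by
      have : f (a j) = ∑ l, a j l * f (Pi.single l 1) := by
        conv_lhs => rw [← Finset.univ_sum_single (a j), map_sum]
        refine Finset.sum_congr rfl fun l _ => ?_
        rw [← smul_eq_mul, ← map_smul, ← Pi.single_smul, smul_eq_mul, mul_one]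
      rw [this, Finset.mul_sum]
      push_cast
      refine Finset.sum_congr rfl fun l _ => ?_
      rw [hm]
      simp only [a]
      ring
    refine ⟨m, fun h0 => ?_, fun j hj hji => ?_⟩
    · have := key i
      rw [h0] at this
      have hN' : (N : ℚ) ≠ 0 := by exact_mod_cast hN
      simp [hf, hN'] at this
    · have hz : f (a j) = 0 :=
        hfs (Submodule.subset_span ⟨j, by simp [hj, hji], rfl⟩)
      have := key j
      rw [hz, mul_zero] at this
      exact_mod_cast this

theorem exists_int_sum_mul_ne_zero {ι : Type*} (T : Finset ι) (c : ι → Fin d → ℤ)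
    (hc : ∀ t ∈ T, c t ≠ 0) : ∃ w : Fin d → ℤ, ∀ t ∈ T, ∑ j, w j * c t j ≠ 0 := by
  classical
  by_contra! hcon
  let P : MvPolynomial (Fin d) ℤ := ∏ t ∈ T, ∑ j, X j * C (c t j)
  have hP : P = 0 := by
    apply MvPolynomial.funext
    intro w
    obtain ⟨t, ht, h0⟩ := hcon w
    rw [map_zero, map_prod]
    exact Finset.prod_eq_zero ht (by simpa using h0)
  obtain ⟨t, ht, h0⟩ := Finset.prod_eq_zero_iff.1 hP
  refine hc t ht (funext fun j => ?_)
  have := congrArg (eval (Pi.single j 1)) h0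
  simpa [Pi.single_apply] using this

theorem exists_valuation_lt_one (p : ℕ) (hp : p.Prime) :
    ∃ V : ValuationSubring ℂ, V.valuation p < 1 ∧ ∀ n : ℤ, V.valuation n ≤ 1 := by
  let I : Ideal (Int.castRingHom ℂ).range := Ideal.span {((p : ℤ) : (Int.castRingHom ℂ).range)}
  have hI : I ≠ ⊤ := by
    rw [Ne, Ideal.span_singleton_eq_top, isUnit_iff_exists_inv]
    rintro ⟨⟨_, n, rfl⟩, h⟩
    have h2 := congrArg (Subtype.val) h
    have h1 : ((p : ℤ) * n : ℂ) = 1 := by simpa using h2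
    have h3 : (p : ℤ) * n = 1 := by exact_mod_cast h1
    have := Int.isUnit_iff.1 (IsUnit.of_mul_eq_one _ h3)
    have := hp.two_le
    omega
  obtain ⟨V, hV, hIV⟩ := Ideal.image_subset_nonunits_valuationSubring I hI
  refine ⟨V, ?_, fun n => (V.valuation_le_one_iff _).2 (hV ⟨n, rfl⟩)⟩
  rw [← ValuationSubring.mem_nonunits_iff]
  exact hIV ⟨_, Ideal.mem_span_singleton_self _, by simp⟩

theorem prod_zpow_eq_zpow_sum {G ι : Type*} [CommGroupWithZero G] {x : G} (hx : x ≠ 0)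
    (s : Finset ι) (c : ι → ℤ) : ∏ i ∈ s, x ^ c i = x ^ ∑ i ∈ s, c i := by
  classical
  induction s using Finset.induction_on with
  | empty => simp
  | insert i s hi ih => rw [Finset.prod_insert hi, Finset.sum_insert hi, ih, zpow_add₀ hx]

theorem torusMonomial_sum_zsmul (A : Fin d → Fin k → ℤ) (c : Fin d → ℤ) (u : Fin k → ℂˣ) :
    ∏ i, torusMonomial (A i) u ^ c i = torusMonomial (fun l => ∑ i, c i * A i l) u := by
  simp only [torusMonomial, Units.val_zpow_eq_zpow_val, Units.coe_prod]
  simp_rw [← Finset.prod_zpow, ← zpow_mul]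
  rw [Finset.prod_comm]
  refine Finset.prod_congr rfl fun l _ => ?_
  rw [← prod_zpow_eq_zpow_sum (u l).ne_zero]
  exact Finset.prod_congr rfl fun i _ => by rw [mul_comm]

theorem exists_notMem_VA (A : Fin d → Fin k → ℤ) (l₀ : Fin k) (hlast : ∀ i, A i l₀ = 1) :
    ∃ α, α ∉ VA A := by
  classical
  let S : Finset (Finset (Fin d) × Fin d) := Finset.univ
  let Q : Finset (Fin d) × Fin d → (Fin k → ℤ) → Prop := fun t φ =>
    ∑ l, φ l * A t.2 l ≠ 0 ∧ ∀ j ∈ t.1, j ≠ t.2 → ∑ l, φ l * A j l = 0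
  let Q' : Finset (Fin d) × Fin d → (Fin d → ℤ) → Prop := fun t c =>
    c t.2 ≠ 0 ∧ (∀ j, j ≠ t.2 → j ∉ t.1 → c j = 0) ∧ ∀ l, ∑ j, c j * A j l = 0
  have hQ (t) : (∃ φ, Q t φ) ∨ ∃ c, Q' t c := exists_functional_or_relation A t.1 t.2
  have hφ (t) : ∃ φ, (∃ φ, Q t φ) → Q t φ := by
    by_cases h : ∃ φ, Q t φ
    · exact ⟨h.choose, fun _ => h.choose_spec⟩
    · exact ⟨0, fun h' => absurd h' h⟩
  have hc (t) : ∃ c, (∃ c, Q' t c) → Q' t c := by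
    by_cases h : ∃ c, Q' t c
    · exact ⟨h.choose, fun _ => h.choose_spec⟩
    · exact ⟨0, fun h' => absurd h' h⟩
  choose φ hφ using hφ
  choose c hc using hc
  obtain ⟨w, hw⟩ := exists_int_sum_mul_ne_zero {t | ∃ c, Q' t c} c fun t ht h0 => by
    have := (hc t (by simpa using ht)).1
    simp [h0] at this
  let D : Finset (Fin d) × Fin d → ℤ := fun t => ∑ l, φ t l * A t.2 l
  obtain ⟨p, hpge, hp⟩ := Nat.exists_infinite_primes (∑ t, (D t).natAbs + 1)
  have hpD (t) (ht : D t ≠ 0) : IsCoprime (D t) p := by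
    rw [Int.isCoprime_iff_gcd_eq_one, Int.gcd_comm, Int.gcd_eq_natAbs, Int.natAbs_natCast]
    refine (Nat.Prime.coprime_iff_not_dvd hp).2 fun hdvd => ?_
    have h1 := Nat.le_of_dvd (Int.natAbs_pos.2 ht) hdvd
    have h2 := Finset.single_le_sum (f := fun t => (D t).natAbs) (fun _ _ => Nat.zero_le _)
      (Finset.mem_univ t)
    omega
  obtain ⟨V, hVp, hVn⟩ := exists_valuation_lt_one p hp
  have hp0 : (p : ℂ) ≠ 0 := by exact_mod_cast hp.ne_zero
  refine ⟨fun i => (p : ℂ) ^ w i, fun hmem => ?_⟩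
  obtain ⟨F, ⟨hFne, -⟩, u, hu⟩ := mem_VA.1 hmem
  let β : Fin d → ℂ := fun i => (p : ℂ) ^ w i * torusMonomial (A i) u
  have hβ0 (i) : β i ≠ 0 := mul_ne_zero (zpow_ne_zero _ hp0) (torusMonomial_ne_zero _ _)
  have hu' (l) : ∑ i ∈ F, β i * A i l = 0 := by
    rw [← hu l, ← Finset.sum_coe_sort F]
    refine Finset.sum_congr rfl fun i _ => ?_
    simp only [β, pProj]
    ring
  obtain ⟨i, hiF, hi⟩ := Finset.exists_max_image F (fun i => V.valuation (β i)) hFne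
  let M : Finset (Fin d) := F.filter fun j => V.valuation (β j) = V.valuation (β i)
  have hvi : V.valuation (β i) ≠ 0 := (Valuation.ne_zero_iff _).2 (hβ0 i)
  rcases hQ (M, i) with h | h
  · obtain ⟨hD, hker⟩ := hφ _ h
    have hsum : ∑ j ∈ F, β j * ((∑ l, φ (M, i) l * A j l : ℤ) : ℂ) = 0 := by
      have : ∑ l, (φ (M, i) l : ℂ) * ∑ j ∈ F, β j * A j l = 0 := by simp [hu']
      rw [← this]
      simp_rw [Finset.mul_sum]
      rw [Finset.sum_comm]
      refine Finset.sum_congr rfl fun j _ => ?_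
      push_cast
      rw [Finset.mul_sum]
      exact Finset.sum_congr rfl fun l _ => by ring
    rw [← Finset.add_sum_erase _ _ hiF] at hsum
    have hlt : V.valuation (∑ j ∈ F.erase i, β j * ((∑ l, φ (M, i) l * A j l : ℤ) : ℂ)) <
        V.valuation (β i) := by
      refine Valuation.map_sum_lt _ hvi fun j hj => ?_
      rw [Finset.mem_erase] at hj
      by_cases hjM : j ∈ M
      · rw [hker j hjM hj.1]
        simpa [zero_lt_iff] using hβ0 i
      · have hlt : V.valuation (β j) < V.valuation (β i) :=
          lt_of_le_of_ne (hi j hj.2) fun h => hjM (Finset.mem_filter.2 ⟨hj.2, h⟩)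
        rw [map_mul]
        exact (mul_le_of_le_one_right' (hVn _)).trans_lt hlt
    rw [← neg_eq_iff_add_eq_zero] at hsum
    rw [← hsum, Valuation.map_neg, map_mul] at hlt
    have hvD : V.valuation (D (M, i) : ℂ) < 1 := by
      by_contra! hge
      exact absurd hlt (not_lt.2 (le_mul_of_one_le_right' hge))
    obtain ⟨a, b, hab⟩ := hpD (M, i) hD
    have hab' : (a : ℂ) * D (M, i) + b * p = 1 := by exact_mod_cast hab
    have h1 : V.valuation ((a : ℂ) * D (M, i) + b * p) < 1 := by
      refine Valuation.map_add_lt _ ?_ ?_ <;> rw [map_mul]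
      · exact (mul_le_of_le_one_left' (hVn _)).trans_lt hvD
      · exact (mul_le_of_le_one_left' (hVn _)).trans_lt hVp
    rw [hab', map_one] at h1
    exact lt_irrefl _ h1
  · obtain ⟨hci, hcM, hrel⟩ := hc _ h
    have hw0 := hw (M, i) (by simpa using h)
    have hprod : ∏ j, β j ^ c (M, i) j = (p : ℂ) ^ (∑ j, w j * c (M, i) j) := by
      simp only [β, mul_zpow, Finset.prod_mul_distrib, ← zpow_mul]
      rw [torusMonomial_sum_zsmul]
      simp only [hrel]
      rw [show (fun _ : Fin k => (0 : ℤ)) = 0 from rfl, torusMonomial_zero, mul_one,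
        prod_zpow_eq_zpow_sum hp0]
    have hval := congrArg V.valuation hprod
    have hsum0 : ∑ j, c (M, i) j = 0 := by
      have := hrel l₀
      simpa [hlast] using this
    have hleft : ∏ j, V.valuation (β j) ^ c (M, i) j = 1 := by
      have : ∀ j, V.valuation (β j) ^ c (M, i) j = V.valuation (β i) ^ c (M, i) j := by
        intro j
        by_cases hji : j = i
        · rw [hji]
        by_cases hjM : j ∈ M
        · rw [(Finset.mem_filter.1 hjM).2]
        · rw [hcM j hji hjM, zpow_zero, zpow_zero]
      simp_rw [this]
      rw [prod_zpow_eq_zpow_sum hvi, hsum0, zpow_zero]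
    rw [map_prod, map_zpow₀] at hval
    simp_rw [map_zpow₀] at hval
    rw [hleft] at hval
    have hvp0 : 0 < V.valuation (p : ℂ) := zero_lt_iff.2 ((Valuation.ne_zero_iff _).2 hp0)
    exact hw0 ((zpow_eq_one_iff_right₀ hvp0.le hVp.ne).1 hval.symm)

end Generic

section ToricPoints

/-- Gordan's alternative over `ℚ`. -/
theorem exists_forall_pos_or_relation {ι : Type*} (s : Finset ι) :
    ∀ (V : Type) [AddCommGroup V] [Module ℚ V] (v : ι → V),
      (∃ f : V →ₗ[ℚ] ℚ, ∀ i ∈ s, 0 < f (v i)) ∨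
      ∃ c : ι → ℚ, (∀ i ∈ s, 0 ≤ c i) ∧ (∃ i ∈ s, 0 < c i) ∧ ∑ i ∈ s, c i • v i = 0 := by
  classical
  induction s using Finset.induction_on with
  | empty => exact fun V _ _ v => Or.inl ⟨0, by simp⟩
  | insert i s hi ih =>
    intro V _ _ v
    have hne (j) (hj : j ∈ s) : j ≠ i := fun h => hi (h ▸ hj)
    have extend (c : ι → ℚ) (t : ℚ) (ht : 0 ≤ t) (hc : ∀ j ∈ s, 0 ≤ c j)
        (hpos : 0 < t ∨ ∃ j ∈ s, 0 < c j) (hsum : t • v i + ∑ j ∈ s, c j • v j = 0) :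
        ∃ c : ι → ℚ, (∀ j ∈ insert i s, 0 ≤ c j) ∧ (∃ j ∈ insert i s, 0 < c j) ∧
          ∑ j ∈ insert i s, c j • v j = 0 := by
      refine ⟨Function.update c i t, ?_, ?_, ?_⟩
      · intro j hj
        rcases Finset.mem_insert.1 hj with rfl | hj
        · simpa using ht
        · simpa [Function.update_of_ne (hne j hj)] using hc j hj
      · rcases hpos with h | ⟨j, hj, h⟩
        · exact ⟨i, by simp, by simpa using h⟩
        · exact ⟨j, by simp [hj], by simpa [Function.update_of_ne (hne j hj)] using h⟩
      · rw [Finset.sum_insert hi, Function.update_self, ← hsum]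
        congr 1
        exact Finset.sum_congr rfl fun j hj => by rw [Function.update_of_ne (hne j hj)]
    rcases ih V v with ⟨f, hf⟩ | ⟨c, hc, hpos, hsum⟩
    swap
    · exact Or.inr (extend c 0 le_rfl hc (Or.inr hpos) (by simpa using hsum))
    by_cases hvi : v i = 0
    · exact Or.inr (extend 0 1 zero_le_one (by simp) (by simp) (by simp [hvi]))
    rcases ih (V ⧸ Submodule.span ℚ {v i}) (fun j => Submodule.Quotient.mk (v j)) with
      ⟨g, hg⟩ | ⟨c, hc, ⟨j₀, hj₀, hcj₀⟩, hsum⟩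
    · left
      obtain ⟨μ, hμ⟩ := Module.Projective.exists_dual_ne_zero ℚ hvi
      obtain ⟨B, hB⟩ := Finset.exists_le (s.image fun j =>
        -(μ (v i))⁻¹ * μ (v j) / g (Submodule.Quotient.mk (v j)))
      refine ⟨(B + 1) • g.comp (Submodule.mkQ _) + (μ (v i))⁻¹ • μ, fun j hj => ?_⟩
      rcases Finset.mem_insert.1 hj with rfl | hj
      · have : (Submodule.Quotient.mk (v j) : V ⧸ Submodule.span ℚ {v j}) = 0 :=
          (Submodule.Quotient.mk_eq_zero _).2 (Submodule.mem_span_singleton_self _)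
        simp [this, hμ]
      · have h1 := hB _ (Finset.mem_image_of_mem _ hj)
        have h2 := hg j hj
        rw [div_le_iff₀ h2] at h1
        simp only [LinearMap.add_apply, LinearMap.smul_apply, LinearMap.comp_apply,
          Submodule.mkQ_apply, smul_eq_mul]
        linarith
    · have hmem : ∑ j ∈ s, c j • v j ∈ Submodule.span ℚ {v i} := by
        rw [← Submodule.Quotient.mk_eq_zero, ← Submodule.mkQ_apply, map_sum]
        simpa using hsum
      obtain ⟨t, ht⟩ := Submodule.mem_span_singleton.1 hmem
      rcases le_or_gt t 0 with h0 | h0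
      · exact Or.inr (extend c (-t) (by linarith) hc (Or.inr ⟨j₀, hj₀, hcj₀⟩) (by simp [← ht]))
      · refine Or.inl ⟨f, fun j hj => ?_⟩
        rcases Finset.mem_insert.1 hj with rfl | hj
        · have h1 := congrArg f ht
          simp only [map_smul, map_sum, smul_eq_mul] at h1
          have h2 : 0 < ∑ l ∈ s, c l * f (v l) :=
            Finset.sum_pos' (fun l hl => mul_nonneg (hc l hl) (hf l hl).le)
              ⟨j₀, hj₀, mul_pos hcj₀ (hf j₀ hj₀)⟩
          rw [← h1] at h2
          exact pos_of_mul_pos_right h2 h0.le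
        · exact hf j hj

variable {d k : ℕ}

/-- A point satisfies the binomial equations of the affine toric variety parametrised by `A`. -/
def SatisfiesBinomials (A : Fin d → Fin k → ℤ) (ξ : Fin d → ℂ) : Prop :=
  ∀ p q : Fin d → ℕ, (∀ l, ∑ i, (p i : ℤ) * A i l = ∑ i, (q i : ℤ) * A i l) →
    ∏ i, ξ i ^ p i = ∏ i, ξ i ^ q i

theorem SatisfiesBinomials.prod_zpow {A : Fin d → Fin k → ℤ} {ξ : Fin d → ℂ}
    (h : SatisfiesBinomials A ξ) (m : Fin d → ℤ) (hm : ∀ l, ∑ i, m i * A i l = 0) :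
    ∏ i, ξ i ^ (m i).toNat = ∏ i, ξ i ^ (-m i).toNat := by
  refine h _ _ fun l => ?_
  rw [← sub_eq_zero, ← Finset.sum_sub_distrib, ← hm l]
  refine Finset.sum_congr rfl fun i _ => ?_
  rw [← sub_mul, Int.toNat_sub_toNat_neg]

theorem SatisfiesBinomials.isFaceOf {A : Fin d → Fin k → ℤ} {ξ : Fin d → ℂ}
    (h : SatisfiesBinomials A ξ) (F : Finset (Fin d)) (hF : ∀ i, i ∈ F ↔ ξ i ≠ 0)
    (hne : F.Nonempty) : IsFaceOf A F := by
  classical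
  refine ⟨hne, ?_⟩
  let a : Fin d → Fin k → ℚ := fun j l => A j l
  let W : Submodule ℚ (Fin k → ℚ) := Submodule.span ℚ (a '' F)
  rcases exists_forall_pos_or_relation Fᶜ _ (fun j => (Submodule.Quotient.mk (a j) : _ ⧸ W)) with
    ⟨f, hf⟩ | ⟨c, hc, ⟨i₀, hi₀, hci₀⟩, hsum⟩
  · let g := f.comp W.mkQ
    obtain ⟨N, hN, m, hm⟩ := exists_int_multiples fun l => g (Pi.single l 1)
    have key (j : Fin d) : ((∑ l, N * m l * A j l : ℤ) : ℚ) = (N : ℚ) ^ 2 * g (a j) := by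
      have : g (a j) = ∑ l, a j l * g (Pi.single l 1) := by
        conv_lhs => rw [← Finset.univ_sum_single (a j), map_sum]
        refine Finset.sum_congr rfl fun l _ => ?_
        rw [← smul_eq_mul, ← map_smul, ← Pi.single_smul, smul_eq_mul, mul_one]
      rw [this, Finset.mul_sum]
      push_cast
      refine Finset.sum_congr rfl fun l _ => ?_
      rw [hm]
      simp only [a]
      ring
    refine ⟨fun l => N * m l, fun i hi => ?_, fun i hi => ?_⟩
    · have h0 : W.mkQ (a i) = 0 := by
        rw [Submodule.mkQ_apply, Submodule.Quotient.mk_eq_zero]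
        exact Submodule.subset_span ⟨i, hi, rfl⟩
      have := key i
      rw [LinearMap.comp_apply, h0, map_zero, mul_zero] at this
      exact_mod_cast this
    · have h1 : 0 < g (a i) := hf i (by simpa using hi)
      have h2 : (0 : ℚ) < (N : ℚ) ^ 2 * g (a i) := by positivity
      rw [← key] at h2
      exact_mod_cast h2
  · exfalso
    have hmem : ∑ j ∈ Fᶜ, c j • a j ∈ W := by
      rw [← Submodule.Quotient.mk_eq_zero, ← Submodule.mkQ_apply, map_sum]
      simpa using hsum
    obtain ⟨b, hb⟩ := (Submodule.mem_span_image_finset_iff_exists_fun ℚ).1 hmem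
    let e : Fin d → ℚ := fun j => if hj : j ∈ F then -b ⟨j, hj⟩ else c j
    have he : ∑ j, e j • a j = 0 := by
      rw [← Finset.sum_add_sum_compl F]
      have h1 : ∑ j ∈ F, e j • a j = -∑ j : F, b j • a j := by
        rw [← Finset.sum_coe_sort F, ← Finset.sum_neg_distrib]
        refine Finset.sum_congr rfl fun j _ => ?_
        simp only [e, dif_pos j.2, neg_smul]
      have h2 : ∑ j ∈ Fᶜ, e j • a j = ∑ j ∈ Fᶜ, c j • a j := by
        refine Finset.sum_congr rfl fun j hj => ?_
        simp only [e, dif_neg (Finset.mem_compl.1 hj)]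
      rw [h1, h2, hb, neg_add_cancel]
    obtain ⟨N, hN, m, hm⟩ := exists_int_multiples e
    have hm' (j) : ((N * m j : ℤ) : ℚ) = (N : ℚ) ^ 2 * e j := by
      push_cast
      rw [hm]
      ring
    have hrel (l) : ∑ j, (N * m j) * A j l = 0 := by
      have h1 := congrFun he l
      rw [Finset.sum_apply] at h1
      have h2 : ((∑ j, (N * m j) * A j l : ℤ) : ℚ) = (N : ℚ) ^ 2 * ∑ j, (e j • a j) l := by
        rw [Finset.mul_sum, Int.cast_sum]
        refine Finset.sum_congr rfl fun j _ => ?_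
        rw [Int.cast_mul, hm']
        simp only [Pi.smul_apply, smul_eq_mul, a]
        ring
      rw [h1, Pi.zero_apply, mul_zero] at h2
      exact_mod_cast h2
    have hprod := h.prod_zpow _ hrel
    have hsq : (0 : ℚ) < (N : ℚ) ^ 2 := by positivity
    have hi₀F : i₀ ∉ F := by simpa using hi₀
    have hleft : ∏ i, ξ i ^ (N * m i).toNat = 0 := by
      refine Finset.prod_eq_zero (Finset.mem_univ i₀) ?_
      have h1 : (0 : ℚ) < ((N * m i₀ : ℤ) : ℚ) := by
        rw [hm']
        simp only [e, dif_neg hi₀F]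
        positivity
      have h2 : 0 < N * m i₀ := by exact_mod_cast h1
      rw [not_not.1 fun h0 => hi₀F ((hF i₀).2 h0), zero_pow (by omega)]
    rw [hleft] at hprod
    obtain ⟨i, -, hi⟩ := Finset.prod_eq_zero_iff.1 hprod.symm
    have hiF : i ∉ F := fun hiF => (hF i).1 hiF (eq_zero_of_pow_eq_zero hi)
    have h1 : (0 : ℚ) ≤ ((N * m i : ℤ) : ℚ) := by
      rw [hm']
      simp only [e, dif_neg hiF]
      exact mul_nonneg hsq.le (hc i (by simpa using hiF))
    have h2 : 0 ≤ N * m i := by exact_mod_cast h1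
    rw [show (-(N * m i)).toNat = 0 by omega, pow_zero] at hi
    exact one_ne_zero hi

theorem baer_additive_units : Module.Baer ℤ (Additive ℂˣ) := by
  have hsurj : ∀ {n : ℕ}, n ≠ 0 → Function.Surjective fun x : Additive ℂˣ => n • x := by
    intro n hn x
    obtain ⟨z, hz⟩ := IsAlgClosed.exists_pow_nat_eq ((x.toMul : ℂˣ) : ℂ) (Nat.pos_of_ne_zero hn)
    have hz0 : z ≠ 0 := by
      rintro rfl
      rw [zero_pow hn] at hz
      exact x.toMul.ne_zero hz.symm
    exact ⟨Additive.ofMul (Units.mk0 z hz0),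
      Additive.toMul.injective (Units.ext (by simpa using hz))⟩
  let _ : DivisibleBy (Additive ℂˣ) ℕ := divisibleByOfSMulRightSurj _ _ hsurj
  let _ : DivisibleBy (Additive ℂˣ) ℤ := AddGroup.divisibleByIntOfDivisibleByNat _
  exact Module.Baer.of_divisible _

/-- A character on a subgroup of the lattice extends to the lattice. -/
theorem exists_torusMonomial_eq {ι : Type} [Fintype ι] (B : ι → Fin k → ℤ) (z : ι → ℂˣ)
    (h : ∀ c : ι → ℤ, (∀ l, ∑ i, c i * B i l = 0) → ∏ i, z i ^ c i = 1) :
    ∃ u : Fin k → ℂˣ, ∀ i, (z i : ℂ) = torusMonomial (B i) u := by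
  classical
  let φ : (ι → ℤ) →+ (Fin k → ℤ) :=
    { toFun := fun c l => ∑ i, c i * B i l
      map_zero' := by funext; simp
      map_add' := fun a b => by funext; simp [add_mul, Finset.sum_add_distrib] }
  let θ : (ι → ℤ) →+ Additive ℂˣ :=
    { toFun := fun c => ∑ i, c i • Additive.ofMul (z i)
      map_zero' := by simp
      map_add' := fun a b => by simp only [Pi.add_apply, add_zsmul, Finset.sum_add_distrib] }
  have hker : φ.ker ≤ θ.ker := by
    intro c hc
    rw [AddMonoidHom.mem_ker] at hc ⊢
    have := h c fun l => congrFun hc l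
    apply Additive.toMul.injective
    simpa [θ] using this
  obtain ⟨χ, hχ⟩ := baer_additive_units.extension_property_addMonoidHom
    (QuotientAddGroup.kerLift φ) (QuotientAddGroup.kerLift_injective φ)
    (QuotientAddGroup.lift φ.ker θ hker)
  refine ⟨fun l => (χ (Pi.single l 1)).toMul, fun i => ?_⟩
  have h1 := DFunLike.congr_fun hχ (QuotientAddGroup.mk (Pi.single i 1))
  have h2 : φ (Pi.single i 1) = B i := by
    funext l
    simp [φ, Pi.single_apply]
  have h3 : θ (Pi.single i 1) = Additive.ofMul (z i) := by
    simp [θ, Pi.single_apply]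
  rw [AddMonoidHom.comp_apply, QuotientAddGroup.kerLift_mk, h2] at h1
  have h4 : QuotientAddGroup.lift φ.ker θ hker (QuotientAddGroup.mk (Pi.single i 1)) =
    θ (Pi.single i 1) := rfl
  rw [h4, h3] at h1
  have h5 : χ (B i) = ∑ l, B i l • χ (Pi.single l 1) := by
    conv_lhs => rw [← Finset.univ_sum_single (B i), map_sum]
    refine Finset.sum_congr rfl fun l _ => ?_
    rw [← map_zsmul, ← Pi.single_smul, smul_eq_mul, mul_one]
  rw [h5] at h1
  have h6 := congrArg (fun z : Additive ℂˣ => ((z.toMul : ℂˣ) : ℂ)) h1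
  simpa [torusMonomial] using h6.symm

theorem SatisfiesBinomials.exists_torus {A : Fin d → Fin k → ℤ} {ξ : Fin d → ℂ}
    (h : SatisfiesBinomials A ξ) :
    ∃ u : Fin k → ℂˣ, ∀ i, ξ i ≠ 0 → ξ i = torusMonomial (A i) u := by
  classical
  obtain ⟨u, hu⟩ := exists_torusMonomial_eq (ι := {i : Fin d // ξ i ≠ 0}) (fun i => A i)
    (fun i => Units.mk0 (ξ i) i.2) fun c hc => by
      let m : Fin d → ℤ := fun i => if hi : ξ i ≠ 0 then c ⟨i, hi⟩ else 0
      have hsub (i : {i : Fin d // ξ i ≠ 0}) : m i = c i := by simp only [m, dif_pos i.2]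
      have hm0 (i) (hi : ¬ ξ i ≠ 0) : m i = 0 := by simp only [m, dif_neg hi]
      have hm (l) : ∑ i, m i * A i l = 0 := by
        rw [← Fintype.sum_subtype_add_sum_subtype (fun i => ξ i ≠ 0), ← hc l]
        simp only [hsub]
        rw [add_eq_left]
        exact Finset.sum_eq_zero fun i _ => by rw [hm0 i i.2, zero_mul]
      have hp := h.prod_zpow m hm
      rw [← Fintype.prod_subtype_mul_prod_subtype (fun i => ξ i ≠ 0),
        ← Fintype.prod_subtype_mul_prod_subtype (fun i => ξ i ≠ 0)
          (fun i => ξ i ^ (-m i).toNat)] at hp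
      have h1 : ∏ i : {i // ¬ ξ i ≠ 0}, ξ i ^ (m i).toNat = 1 :=
        Finset.prod_eq_one fun i _ => by rw [hm0 i i.2, Int.toNat_zero, pow_zero]
      have h2 : ∏ i : {i // ¬ ξ i ≠ 0}, ξ i ^ (-m i).toNat = 1 :=
        Finset.prod_eq_one fun i _ => by rw [hm0 i i.2, neg_zero, Int.toNat_zero, pow_zero]
      rw [h1, h2, mul_one, mul_one] at hp
      simp only [hsub] at hp
      apply Units.ext
      rw [Units.coe_prod, Units.val_one]
      have hz (i : {i // ξ i ≠ 0}) : ((Units.mk0 (ξ i) i.2 ^ c i : ℂˣ) : ℂ) =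
          ξ i ^ (c i).toNat / ξ i ^ (-c i).toNat := by
        rw [Units.val_zpow_eq_zpow_val, Units.val_mk0, ← zpow_natCast, ← zpow_natCast,
          ← zpow_sub₀ i.2, Int.toNat_sub_toNat_neg]
      simp_rw [hz]
      rw [Finset.prod_div_distrib, hp, div_self]
      exact Finset.prod_ne_zero_iff.2 fun i _ => pow_ne_zero _ i.2
  exact ⟨u, fun i hi => hu ⟨i, hi⟩⟩

end ToricPoints

section Elimination

variable {d k : ℕ}

/-- The Laurent monomial attached to the `i`-th exponent vector. -/
def mono (A : Fin d → Fin k → ℤ) (i : Fin d) : LaurentRing (Fin d) k :=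
  AddMonoidAlgebra.single (A i) 1

/-- The `j`-th logarithmic derivative of the universal Laurent polynomial with exponents `A`. -/
def logDeriv (A : Fin d → Fin k → ℤ) (j : Fin k) : LaurentRing (Fin d) k :=
  ∑ i, (C (A i j : ℂ) * X i : MvPolynomial (Fin d) ℂ) • mono A i

theorem laurentEval_smul {σ : Type} (c : σ → ℂ) (u : Fin k → ℂˣ) (r : MvPolynomial σ ℂ)
    (z : LaurentRing σ k) : laurentEval c u (r • z) = eval c r * laurentEval c u z := by
  rw [Algebra.smul_def, map_mul, laurentEval_algebraMap]

theorem laurentEval_mono (A : Fin d → Fin k → ℤ) (i : Fin d) (c : Fin d → ℂ) (u : Fin k → ℂˣ) :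
    laurentEval c u (mono A i) = torusMonomial (A i) u := by
  simp [mono, laurentEval_single]

theorem laurentEval_logDeriv (A : Fin d → Fin k → ℤ) (j : Fin k) (c : Fin d → ℂ)
    (u : Fin k → ℂˣ) :
    laurentEval c u (logDeriv A j) = ∑ i, c i * (A i j : ℂ) * torusMonomial (A i) u := by
  simp only [logDeriv, map_sum, laurentEval_smul, laurentEval_mono, map_mul, eval_C, eval_X]
  exact Finset.sum_congr rfl fun i _ => by ring

theorem mono_ne_zero (A : Fin d → Fin k → ℤ) (i : Fin d) : mono A i ≠ 0 := fun h =>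
  torusMonomial_ne_zero (A i) 1 (by rw [← laurentEval_mono A i 0 1, h, map_zero])

/-- The parametrisation of the cone over the toric variety of `A`. -/
def coneMap (A : Fin d → Fin k → ℤ) :
    MvPolynomial (Fin d) ℂ →ₐ[ℂ] Polynomial (LaurentRing (Fin d) k) :=
  aeval fun i => Polynomial.C (mono A i) * Polynomial.X

theorem coneMap_monomial (A : Fin d → Fin k → ℤ) (p : Fin d → ℕ) :
    coneMap A (∏ i, X i ^ p i) =
      Polynomial.C (AddMonoidAlgebra.single (∑ i, p i • A i) 1) * Polynomial.X ^ ∑ i, p i := by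
  have h1 (i) : coneMap A (X i ^ p i) =
      Polynomial.C (AddMonoidAlgebra.single (p i • A i) 1) * Polynomial.X ^ p i := by
    rw [map_pow, coneMap, aeval_X, mono, (Polynomial.commute_X _).symm.mul_pow, ← map_pow,
      AddMonoidAlgebra.single_pow, one_pow]
  have h2 : ∏ i, (AddMonoidAlgebra.single (p i • A i) 1 : LaurentRing (Fin d) k) =
      AddMonoidAlgebra.single (∑ i, p i • A i) 1 := by
    rw [AddMonoidAlgebra.prod_single, Finset.prod_const_one]
  rw [map_prod, Finset.prod_congr rfl fun i _ => h1 i, Finset.prod_mul_distrib,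
    Finset.prod_pow_eq_pow_sum, ← map_prod, h2]

/-- The linear forms cutting out the critical points on the cone for given coefficients. -/
def critForm (A : Fin d → Fin k → ℤ) (α : Fin d → ℂ) (j : Fin k) : MvPolynomial (Fin d) ℂ :=
  ∑ i, C (α i * A i j) * X i

/-- The ideal of critical points on the cone. -/
def critIdeal (A : Fin d → Fin k → ℤ) (α : Fin d → ℂ) : Ideal (MvPolynomial (Fin d) ℂ) :=
  RingHom.ker (coneMap A) ⊔ Ideal.span (Set.range (critForm A α))

theorem eq_zero_of_mem_zeroLocus {A : Fin d → Fin k → ℤ} {α : Fin d → ℂ} {l₀ : Fin k}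
    (hlast : ∀ i, A i l₀ = 1) (hα : α ∉ VA A) {ξ : Fin d → ℂ}
    (hξ : ∀ p ∈ critIdeal A α, eval ξ p = 0) : ξ = 0 := by
  classical
  by_contra hne
  refine hα (mem_VA.2 ?_)
  have hbin : SatisfiesBinomials A ξ := by
    intro p q hpq
    have hmem : (∏ i, X i ^ p i - ∏ i, X i ^ q i : MvPolynomial (Fin d) ℂ) ∈ critIdeal A α := by
      refine Ideal.mem_sup_left ?_
      have h1 : ∑ i, p i = ∑ i, q i := by
        have := hpq l₀
        simp only [hlast, mul_one] at this
        exact_mod_cast this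
      have h2 : ∑ i, p i • A i = ∑ i, q i • A i := by
        funext l
        simpa using hpq l
      rw [RingHom.mem_ker, map_sub, coneMap_monomial, coneMap_monomial, h1, h2, sub_self]
    simpa [sub_eq_zero] using hξ _ hmem
  obtain ⟨u, hu⟩ := hbin.exists_torus
  obtain ⟨i₀, hi₀⟩ := Function.ne_iff.1 hne
  refine ⟨Finset.univ.filter fun i => ξ i ≠ 0,
    hbin.isFaceOf _ (fun i => by simp) ⟨i₀, by simpa using hi₀⟩, u, fun l => ?_⟩
  have h := hξ _ (Ideal.mem_sup_right (Ideal.subset_span ⟨l, rfl⟩))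
  simp only [critForm, map_sum, map_mul, eval_C, eval_X] at h
  refine (Finset.sum_coe_sort (Finset.univ.filter fun i => ξ i ≠ 0)
    (fun i => α i * (A i l : ℂ) * torusMonomial (A i) u)).trans ?_
  rw [Finset.sum_filter]
  refine Eq.trans ?_ h
  refine Finset.sum_congr rfl fun i _ => ?_
  split_ifs with hi
  · rw [hu i hi]
  · rw [not_not.1 hi, mul_zero]

theorem exists_pow_le_critIdeal {A : Fin d → Fin k → ℤ} {α : Fin d → ℂ} {l₀ : Fin k}
    (hlast : ∀ i, A i l₀ = 1) (hα : α ∉ VA A) :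
    ∃ n, Ideal.span (Set.range (X : Fin d → MvPolynomial (Fin d) ℂ)) ^ n ≤ critIdeal A α := by
  refine Ideal.exists_pow_le_of_le_radical_of_fg ?_ ⟨Finset.univ.image X, by simp⟩
  rw [← vanishingIdeal_zeroLocus_eq_radical (K := ℂ), Ideal.span_le]
  rintro _ ⟨i, rfl⟩
  rw [SetLike.mem_coe, mem_vanishingIdeal_iff]
  intro ξ hξ
  rw [mem_zeroLocus_iff] at hξ
  rw [eq_zero_of_mem_zeroLocus hlast hα hξ]
  simp

/-- The span of the Laurent monomials attached to `A`. -/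
def monoSpan (A : Fin d → Fin k → ℤ) :
    Submodule (MvPolynomial (Fin d) ℂ) (LaurentRing (Fin d) k) :=
  Submodule.span _ (Set.range (mono A))

theorem coeff_coneMap_mem (A : Fin d → Fin k → ℤ) (h : MvPolynomial (Fin d) ℂ) :
    ∀ n, (coneMap A h).coeff n ∈ monoSpan A ^ n := by
  induction h using MvPolynomial.induction_on with
  | C c =>
    intro n
    rw [coneMap, aeval_C, Polynomial.algebraMap_apply, Polynomial.coeff_C]
    split_ifs with hn
    · rw [hn, pow_zero, Submodule.mem_one]
      exact ⟨C c, (IsScalarTower.algebraMap_apply _ _ _ _).symm⟩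
    · exact zero_mem _
  | add p q hp hq =>
    intro n
    rw [map_add, Polynomial.coeff_add]
    exact add_mem (hp n) (hq n)
  | mul_X p i hp =>
    intro n
    rw [map_mul, coneMap, aeval_X, ← mul_assoc]
    cases n with
    | zero => simp
    | succ n =>
      rw [Polynomial.coeff_mul_X, Polynomial.coeff_mul_C, pow_succ]
      exact Submodule.mul_mem_mul (hp n) (Submodule.subset_span ⟨i, rfl⟩)

/-- The span of the logarithmic derivatives. -/
def logDerivSpan (A : Fin d → Fin k → ℤ) :
    Submodule (MvPolynomial (Fin d) ℂ) (LaurentRing (Fin d) k) :=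
  Submodule.span _ (Set.range (logDeriv A))

theorem coeff_succ_coneMap_mem {A : Fin d → Fin k → ℤ} {α : Fin d → ℂ}
    {h : MvPolynomial (Fin d) ℂ} (hh : h ∈ critIdeal A α) (n : ℕ) :
    (coneMap A h).coeff (n + 1) ∈ logDerivSpan A * monoSpan A ^ n ⊔
      RingHom.ker (eval α) • monoSpan A ^ (n + 1) := by
  obtain ⟨g, hg, h', hh', rfl⟩ := Submodule.mem_sup.1 hh
  rw [map_add, (RingHom.mem_ker).1 hg, zero_add]
  obtain ⟨c, rfl⟩ := Ideal.mem_span_range_iff_exists_fun.1 hh'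
  rw [map_sum, Polynomial.finsetSum_coeff]
  refine sum_mem fun j _ => ?_
  have h1 : coneMap A (critForm A α j) =
      Polynomial.C (logDeriv A j - ∑ i, (C (A i j : ℂ) * (X i - C (α i)) :
        MvPolynomial (Fin d) ℂ) • mono A i) * Polynomial.X := by
    rw [logDeriv, ← Finset.sum_sub_distrib, critForm, map_sum, map_sum, Finset.sum_mul]
    refine Finset.sum_congr rfl fun i _ => ?_
    rw [← sub_smul, map_mul, coneMap, aeval_X, aeval_C, Polynomial.algebraMap_apply,
      ← mul_assoc, ← map_mul, IsScalarTower.algebraMap_apply ℂ (MvPolynomial (Fin d) ℂ),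
      ← Algebra.smul_def, MvPolynomial.algebraMap_eq]
    congr 4
    rw [C_mul]
    ring
  rw [map_mul, h1, ← mul_assoc, Polynomial.coeff_mul_X, Polynomial.coeff_mul_C, mul_sub, mul_comm]
  refine sub_mem (Submodule.mem_sup_left (Submodule.mul_mem_mul
    (Submodule.subset_span ⟨j, rfl⟩) (coeff_coneMap_mem A _ _))) (Submodule.mem_sup_right ?_)
  rw [Finset.mul_sum]
  refine sum_mem fun i _ => ?_
  rw [mul_smul_comm]
  refine Submodule.smul_mem_smul ?_ ?_
  · simp
  · rw [pow_succ]
    exact Submodule.mul_mem_mul (coeff_coneMap_mem A _ _) (Submodule.subset_span ⟨i, rfl⟩)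

theorem monoSpan_pow_le {A : Fin d → Fin k → ℤ} {α : Fin d → ℂ} {n : ℕ}
    (hn : Ideal.span (Set.range (X : Fin d → MvPolynomial (Fin d) ℂ)) ^ (n + 1) ≤ critIdeal A α) :
    monoSpan A ^ (n + 1) ≤ logDerivSpan A * monoSpan A ^ n ⊔
      RingHom.ker (eval α) • monoSpan A ^ (n + 1) := by
  nth_rw 1 [monoSpan]
  rw [Submodule.span_pow, Submodule.span_le]
  intro z hz
  obtain ⟨f, rfl⟩ := Set.mem_pow.1 hz
  choose g hg using fun t => (f t).2
  have h1 : (List.ofFn fun t => (f t : LaurentRing (Fin d) k)).prod =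
      (coneMap A (∏ t, X (g t))).coeff (n + 1) := by
    rw [List.prod_ofFn, map_prod]
    simp only [coneMap, aeval_X, Finset.prod_mul_distrib, Finset.prod_const, Finset.card_univ,
      Fintype.card_fin]
    rw [← map_prod, Polynomial.coeff_C_mul, Polynomial.coeff_X_pow_self, mul_one]
    exact Finset.prod_congr rfl fun t _ => (hg t).symm
  rw [h1]
  refine coeff_succ_coneMap_mem (hn ?_) n
  have := Ideal.prod_mem_prod (s := Finset.univ)
    (I := fun _ => Ideal.span (Set.range (X : Fin d → MvPolynomial (Fin d) ℂ)))
    fun t _ => Ideal.subset_span ⟨g t, rfl⟩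
  simpa using this

/-- The map sending the `j`-th variable to the `j`-th logarithmic derivative. -/
def logDerivMap (A : Fin d → Fin k → ℤ) :
    MvPolynomial (Fin k) (MvPolynomial (Fin d) ℂ) →ₐ[MvPolynomial (Fin d) ℂ]
      LaurentRing (Fin d) k :=
  aeval (logDeriv A)

theorem exists_isIntegralElem {A : Fin d → Fin k → ℤ} {α : Fin d → ℂ} {l₀ : Fin k}
    (hlast : ∀ i, A i l₀ = 1) (hα : α ∉ VA A) :
    ∃ f : MvPolynomial (Fin d) ℂ, eval α f ≠ 0 ∧
      ∀ i, (logDerivMap A).toRingHom.IsIntegralElem (f • mono A i) := by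
  obtain ⟨n, hn⟩ := exists_pow_le_critIdeal hlast hα
  have hfg : (monoSpan A).FG := ⟨Finset.univ.image (mono A), by simp [monoSpan]⟩
  obtain ⟨f, hf, hfP⟩ := Submodule.exists_sub_one_mem_and_smul_le_of_fg_of_le_sup
    (hfg.pow (n + 1)) le_rfl (monoSpan_pow_le ((Ideal.pow_le_pow_right n.le_succ).trans hn))
  refine ⟨f, fun h0 => ?_, fun i => ?_⟩
  · rw [RingHom.mem_ker, map_sub, h0, map_one, zero_sub, neg_eq_zero] at hf
    exact one_ne_zero hf
  let _ : Algebra (MvPolynomial (Fin k) (MvPolynomial (Fin d) ℂ)) (LaurentRing (Fin d) k) :=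
    (logDerivMap A).toRingHom.toAlgebra
  have htower : IsScalarTower (MvPolynomial (Fin d) ℂ)
      (MvPolynomial (Fin k) (MvPolynomial (Fin d) ℂ)) (LaurentRing (Fin d) k) :=
    IsScalarTower.of_algebraMap_eq fun r => ((logDerivMap A).commutes r).symm
  obtain ⟨s, hs⟩ := hfg.pow n
  let W : Submodule (MvPolynomial (Fin k) (MvPolynomial (Fin d) ℂ)) (LaurentRing (Fin d) k) :=
    Submodule.span _ (s : Set (LaurentRing (Fin d) k))
  have hW : ((monoSpan A ^ n : Submodule _ _) : Set (LaurentRing (Fin d) k)) ⊆ W := by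
    rw [← hs]
    exact Submodule.span_subset_span _ _ _
  have hmi : mono A i ∈ monoSpan A := Submodule.subset_span ⟨i, rfl⟩
  refine isIntegral_of_smul_mem_submodule W ?_ ⟨s, rfl⟩ _ fun w hw => ?_
  · intro h0
    have h1 := hW (Submodule.pow_mem_pow _ hmi n)
    rw [h0] at h1
    exact pow_ne_zero n (mono_ne_zero A i) ((Submodule.mem_bot _).1 h1)
  · refine Submodule.span_induction ?_ ?_ ?_ ?_ hw
    · intro x hx
      have hx' : x ∈ monoSpan A ^ n := by
        rw [← hs]
        exact Submodule.subset_span hx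
      have h0 : mono A i * x ∈ monoSpan A ^ (n + 1) := by
        rw [pow_succ']
        exact Submodule.mul_mem_mul hmi hx'
      rw [smul_eq_mul, smul_mul_assoc]
      have hle : logDerivSpan A * monoSpan A ^ n ≤ W.restrictScalars (MvPolynomial (Fin d) ℂ) :=
        Submodule.mul_le.2 ?_
      · exact hle (hfP (Submodule.smul_mem_pointwise_smul _ f _ h0))
      intro a ha b hb
      have hbW : b ∈ W := hW hb
      refine Submodule.span_induction ?_ ?_ ?_ ?_ ha
      · rintro _ ⟨j, rfl⟩
        have : logDeriv A j * b = (X j : MvPolynomial (Fin k) (MvPolynomial (Fin d) ℂ)) • b := by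
          rw [Algebra.smul_def]
          congr 1
          exact (aeval_X (logDeriv A) j).symm
        rw [this]
        exact W.smul_mem _ hbW
      · rw [zero_mul]
        exact zero_mem _
      · intro a₁ a₂ _ _ h₁ h₂
        rw [add_mul]
        exact add_mem h₁ h₂
      · intro r a _ h₁
        rw [smul_mul_assoc]
        exact Submodule.smul_mem _ _ h₁
    · rw [smul_zero]
      exact zero_mem _
    · intro x y _ _ hx hy
      rw [smul_add]
      exact add_mem hx hy
    · intro b x _ hx
      rw [smul_comm]
      exact W.smul_mem _ hx

end Elimination

section Jacobian

theorem derivation_aeval {ι R S : Type*} [Fintype ι] [CommRing R] [CommRing S] [Algebra R S]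
    (D : Derivation R S S) (v : ι → S) (P : MvPolynomial ι R) :
    D (aeval v P) = ∑ j, D (v j) * aeval v (pderiv j P) := by
  classical
  induction P using MvPolynomial.induction_on with
  | C r => simp
  | add p q hp hq => simp only [map_add, hp, hq, mul_add, Finset.sum_add_distrib]
  | mul_X p i hp =>
    rw [map_mul, aeval_X, D.leibniz, hp]
    simp only [pderiv_mul, pderiv_X, map_add, map_mul, aeval_X, mul_add, Finset.sum_add_distrib,
      smul_eq_mul]
    rw [add_comm]
    congr 1
    · rw [Finset.mul_sum]
      exact Finset.sum_congr rfl fun j _ => by ring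
    · rw [Finset.sum_eq_single i]
      · simp [mul_comm]
      · intro j _ hj
        simp [hj.symm]
      · simp

/-- The Jacobian criterion for algebraic independence, in characteristic zero. -/
theorem algebraicIndependent_of_det_ne_zero {ι R S : Type*} [Fintype ι] [DecidableEq ι]
    [CommRing R] [IsDomain R] [CharZero R] [CommRing S] [IsDomain S] [Algebra R S]
    (hRS : Function.Injective (algebraMap R S)) (v : ι → S) (D : ι → Derivation R S S)
    (hdet : (Matrix.of fun l j => D l (v j)).det ≠ 0) : AlgebraicIndependent R v := by
  rw [algebraicIndependent_iff]
  have key : ∀ n (P : MvPolynomial ι R), (∀ m, n ≤ m.degree → coeff m P = 0) →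
      aeval v P = 0 → P = 0 := by
    intro n
    induction n with
    | zero => exact fun P hP _ => MvPolynomial.ext _ _ fun m => by simp [hP m (Nat.zero_le _)]
    | succ n ih =>
      intro P hP hP0
      have h1 : (fun j => aeval v (pderiv j P)) = 0 := by
        refine Matrix.eq_zero_of_mulVec_eq_zero hdet (funext fun l => ?_)
        have := derivation_aeval (D l) v P
        rw [hP0, map_zero] at this
        exact this.symm
      have h2 (j) : pderiv j P = 0 := by
        refine ih _ (fun m hm => ?_) (congrFun h1 j)
        rw [coeff_pderiv, hP, zero_mul]
        simpa using hm
      have h3 : P = C (coeff 0 P) := by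
        ext m
        rw [coeff_C]
        split_ifs with hm
        · rw [hm]
        · obtain ⟨j, hj⟩ := Finsupp.ne_iff.1 (Ne.symm hm)
          have h4 := congrArg (coeff (m - Finsupp.single j 1)) (h2 j)
          rw [coeff_pderiv, coeff_zero, tsub_add_cancel_of_le] at h4
          · refine (mul_eq_zero.1 h4).resolve_right ?_
            exact Nat.cast_add_one_ne_zero _
          · rw [Finsupp.single_le_iff]
            exact Nat.one_le_iff_ne_zero.2 hj
      rw [h3, aeval_C] at hP0
      rw [h3, (map_eq_zero_iff _ hRS).1 hP0, C_0]
  intro P hP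
  refine key (P.totalDegree + 1) P (fun m hm => ?_) hP
  refine coeff_eq_zero_of_totalDegree_lt ?_
  rw [Finsupp.degree_apply] at hm
  exact hm

variable {d k : ℕ}

/-- The logarithmic derivation with respect to the `l`-th torus coordinate, as a linear map. -/
def torusDerivationLinear (σ : Type) (l : Fin k) :
    LaurentRing σ k →ₗ[MvPolynomial σ ℂ] LaurentRing σ k :=
  (Finsupp.linearCombination (MvPolynomial σ ℂ) fun a : Fin k → ℤ =>
      (AddMonoidAlgebra.single a (a l : MvPolynomial σ ℂ) : LaurentRing σ k)) ∘ₗ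
    (AddMonoidAlgebra.coeffLinearEquiv (MvPolynomial σ ℂ)).toLinearMap

theorem torusDerivationLinear_single {σ : Type} (l : Fin k) (a : Fin k → ℤ)
    (r : MvPolynomial σ ℂ) :
    torusDerivationLinear σ l (AddMonoidAlgebra.single a r) =
      AddMonoidAlgebra.single a (r * (a l : MvPolynomial σ ℂ)) := by
  simp [torusDerivationLinear]

theorem torusDerivationLinear_mul {σ : Type} (l : Fin k) (x y : LaurentRing σ k) :
    torusDerivationLinear σ l (x * y) =
      x • torusDerivationLinear σ l y + y • torusDerivationLinear σ l x := by
  induction x using AddMonoidAlgebra.induction_linear with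
  | zero => simp
  | add x₁ x₂ h₁ h₂ =>
    rw [add_mul, map_add, h₁, h₂, map_add, add_smul, smul_add]
    abel
  | single a r =>
    induction y using AddMonoidAlgebra.induction_linear with
    | zero => simp
    | add y₁ y₂ h₁ h₂ =>
      rw [mul_add, map_add, h₁, h₂, map_add, add_smul, smul_add]
      abel
    | single b s =>
      rw [AddMonoidAlgebra.single_mul_single, torusDerivationLinear_single,
        torusDerivationLinear_single, torusDerivationLinear_single, smul_eq_mul, smul_eq_mul,
        AddMonoidAlgebra.single_mul_single, AddMonoidAlgebra.single_mul_single, add_comm b a,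
        ← AddMonoidAlgebra.single_add]
      congr 1
      rw [Pi.add_apply, Int.cast_add]
      ring

/-- The logarithmic derivation with respect to the `l`-th torus coordinate. -/
def torusDerivation (σ : Type) (l : Fin k) :
    Derivation (MvPolynomial σ ℂ) (LaurentRing σ k) (LaurentRing σ k) :=
  Derivation.mk' (torusDerivationLinear σ l) (torusDerivationLinear_mul l)

theorem torusDerivation_single {σ : Type} (l : Fin k) (a : Fin k → ℤ) (r : MvPolynomial σ ℂ) :
    torusDerivation σ l (AddMonoidAlgebra.single a r) =
      (a l : MvPolynomial σ ℂ) • AddMonoidAlgebra.single a r := by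
  rw [torusDerivation, Derivation.coe_mk', torusDerivationLinear_single,
    AddMonoidAlgebra.smul_single, smul_eq_mul, mul_comm]

theorem algebraicIndependent_logDeriv {A : Fin d → Fin k → ℤ}
    (hspan : Submodule.span ℝ (Set.range fun i => fun j => (A i j : ℝ)) = ⊤) :
    AlgebraicIndependent (MvPolynomial (Fin d) ℂ) (logDeriv A) := by
  refine algebraicIndependent_of_det_ne_zero ?_ _ (torusDerivation (Fin d)) fun hdet => ?_
  · intro r s hrs
    rw [AddMonoidAlgebra.coe_algebraMap] at hrs
    simpa using congrArg (fun z => z.coeff 0) hrs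
  let M : Matrix (Fin d) (Fin k) ℝ := Matrix.of fun i j => (A i j : ℝ)
  have h1 := congrArg (laurentEval (fun _ => 1) 1) hdet
  rw [RingHom.map_det, map_zero] at h1
  have h2 : (laurentEval (fun _ => 1) 1).mapMatrix
      (Matrix.of fun l j => torusDerivation (Fin d) l (logDeriv A j)) =
      Complex.ofRealHom.mapMatrix (M.transpose * M) := by
    ext l j
    simp only [RingHom.mapMatrix_apply, Matrix.map_apply, Matrix.of_apply, logDeriv, map_sum,
      Derivation.map_smul, mono, torusDerivation_single,
      laurentEval_smul, laurentEval_single, Matrix.mul_apply,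
      Matrix.transpose_apply, M, map_mul, eval_X, map_intCast, map_one]
    refine Finset.sum_congr rfl fun i _ => ?_
    simp [torusMonomial]
    ring
  rw [h2, ← RingHom.map_det] at h1
  have h3 : (M.transpose * M).det = 0 := by simpa using h1
  obtain ⟨v, hv, hMv⟩ := Matrix.exists_mulVec_eq_zero_iff.2 h3
  refine hv ?_
  rw [← Matrix.conjTranspose_eq_transpose_of_trivial,
    Matrix.conjTranspose_mul_self_mulVec_eq_zero] at hMv
  have h5 : (⊤ : Submodule ℝ (Fin k → ℝ)) ≤ LinearMap.ker (dotProductBilin ℝ ℝ v) := by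
    rw [← hspan, Submodule.span_le]
    rintro _ ⟨i, rfl⟩
    rw [SetLike.mem_coe, LinearMap.mem_ker]
    exact (dotProduct_comm _ _).trans (congrFun hMv i)
  exact dotProduct_self_eq_zero.1 (h5 (Submodule.mem_top (x := v)))

end Jacobian

section Equation

theorem map_dvd_map_of_eval₂_eq_zero {B S K L : Type*} [CommRing B] [IsDomain B] [CommRing S]
    [Field K] [Algebra B K] [IsFractionRing B K] [Field L] [Algebra S L] [IsFractionRing S L]
    {φ : B →+* S} (hφ : Function.Injective φ) {s : S} {g h : Polynomial B}
    (hirr : Irreducible (g.map (algebraMap B K))) (hg : g.eval₂ φ s = 0) (hh : h.eval₂ φ s = 0) :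
    g.map (algebraMap B K) ∣ h.map (algebraMap B K) := by
  by_contra hndvd
  obtain ⟨a, b, hab⟩ := hirr.coprime_iff_not_dvd.2 hndvd
  obtain ⟨ψ, hψ⟩ : ∃ ψ : K →+* L, ψ.comp (algebraMap B K) = (algebraMap S L).comp φ :=
    ⟨IsFractionRing.lift (g := (algebraMap S L).comp φ) ((IsFractionRing.injective S L).comp hφ),
      RingHom.ext fun x => IsFractionRing.lift_algebraMap
        (g := (algebraMap S L).comp φ) ((IsFractionRing.injective S L).comp hφ) x⟩
  have hmap (p : Polynomial B) (hp : p.eval₂ φ s = 0) :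
      (p.map (algebraMap B K)).eval₂ ψ (algebraMap S L s) = 0 := by
    rw [Polynomial.eval₂_map, hψ, ← Polynomial.hom_eval₂, hp, map_zero]
  have := congrArg (Polynomial.eval₂ ψ (algebraMap S L s)) hab
  rw [Polynomial.eval₂_add, Polynomial.eval₂_mul, Polynomial.eval₂_mul, hmap g hg, hmap h hh,
    mul_zero, mul_zero, add_zero, Polynomial.eval₂_one] at this
  exact zero_ne_one this

/-- An element of a domain algebraic over a unique factorization domain is annihilated by a
polynomial dividing every other annihilating polynomial. -/
theorem exists_eval₂_eq_zero_dvd {B S : Type*} [CommRing B] [IsDomain B]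
    [UniqueFactorizationMonoid B] [CommRing S] [IsDomain S] {φ : B →+* S}
    (hφ : Function.Injective φ) {s : S} {h₀ : Polynomial B} (h₀0 : h₀ ≠ 0)
    (h₀s : h₀.eval₂ φ s = 0) :
    ∃ g : Polynomial B, g.eval₂ φ s = 0 ∧ ∀ h : Polynomial B, h.eval₂ φ s = 0 → g ∣ h := by
  classical
  let 𝔮 : Ideal (Polynomial B) := RingHom.ker (Polynomial.eval₂RingHom φ s)
  have hmem (p : Polynomial B) : p ∈ 𝔮 ↔ p.eval₂ φ s = 0 := RingHom.mem_ker
  have h𝔮 : 𝔮.IsPrime := RingHom.ker_isPrime _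
  obtain ⟨g, hg𝔮, hg⟩ := h𝔮.exists_mem_prime_of_ne_bot
    (fun hbot => h₀0 (by simpa [hbot] using (hmem h₀).2 h₀s))
  have hgs := (hmem g).1 hg𝔮
  have hdeg : g.natDegree ≠ 0 := by
    intro h0
    rw [Polynomial.eq_C_of_natDegree_eq_zero h0, Polynomial.eval₂_C, map_eq_zero_iff φ hφ] at hgs
    exact hg.ne_zero (by rw [Polynomial.eq_C_of_natDegree_eq_zero h0, hgs, map_zero])
  have hprim : g.IsPrimitive := hg.irreducible.isPrimitive hdeg
  refine ⟨g, hgs, fun h hs => hprim.dvd_of_fraction_map_dvd_fraction_map (K := FractionRing B) ?_⟩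
  exact map_dvd_map_of_eval₂_eq_zero (L := FractionRing S) hφ
    ((hprim.irreducible_iff_irreducible_map_fraction_map (K := FractionRing B)).1 hg.irreducible)
    hgs hs

theorem exists_leadingCoeff_dvd_pow {B S : Type*} [CommRing B] [IsDomain B] [CommRing S]
    {φ : B →+* S} {s : S} {g : Polynomial B}
    (hg : ∀ h : Polynomial B, h.eval₂ φ s = 0 → g ∣ h) {f : B} (hf : f ≠ 0)
    (hint : φ.IsIntegralElem (φ f * s)) : ∃ n, g.leadingCoeff ∣ f ^ n := by
  obtain ⟨h, hmonic, hh⟩ := hint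
  have h1 : (h.comp (Polynomial.C f * Polynomial.X)).eval₂ φ s = 0 := by
    rw [Polynomial.eval₂_comp, Polynomial.eval₂_mul, Polynomial.eval₂_C, Polynomial.eval₂_X, hh]
  obtain ⟨q, hq⟩ := hg _ h1
  refine ⟨h.natDegree, q.leadingCoeff, ?_⟩
  rw [← Polynomial.leadingCoeff_mul, ← hq, Polynomial.leadingCoeff_comp, hmonic.leadingCoeff]
  · simp
  · rw [Polynomial.natDegree_C_mul_X f hf]
    exact one_ne_zero

theorem exists_C_eq_of_dvd_C {σ R : Type*} [CommRing R] [IsDomain R] {p : MvPolynomial σ R}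
    {r : R} (hr : r ≠ 0) (h : p ∣ C r) : ∃ a, p = C a ∧ a ∣ r := by
  obtain ⟨q, hq⟩ := h
  have hpq : p * q ≠ 0 := by
    rw [← hq]
    exact (C_ne_zero).2 hr
  have hdeg := totalDegree_mul_of_isDomain (left_ne_zero_of_mul hpq) (right_ne_zero_of_mul hpq)
  rw [← hq, totalDegree_C] at hdeg
  have hp := totalDegree_eq_zero_iff_eq_C.1 (show p.totalDegree = 0 by omega)
  have hq' := totalDegree_eq_zero_iff_eq_C.1 (show q.totalDegree = 0 by omega)
  refine ⟨_, hp, coeff 0 q, ?_⟩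
  rw [hp, hq', ← C_mul] at hq
  simpa using C_injective σ R hq

theorem eq_zero_of_forall_ne_zero_eval_eq_zero {K : Type*} [Field K] [Infinite K]
    {p : Polynomial K} (h : ∀ x, x ≠ 0 → p.eval x = 0) : p = 0 := by
  have h1 : Polynomial.X * p = 0 := Polynomial.funext fun x => by
    rcases eq_or_ne x 0 with rfl | hx
    · simp
    · simp [h x hx]
  exact (mul_eq_zero.1 h1).resolve_left Polynomial.X_ne_zero

variable {d k : ℕ}

theorem exists_annihilator {A : Fin d → Fin k → ℤ} {l₀ : Fin k} (hlast : ∀ i, A i l₀ = 1)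
    (hspan : Submodule.span ℝ (Set.range fun i => fun j => (A i j : ℝ)) = ⊤) (i : Fin d) :
    ∃ (e : MvPolynomial (Fin d) ℂ) (g : Polynomial (MvPolynomial (Fin k) (MvPolynomial (Fin d) ℂ))),
      g.eval₂ (logDerivMap A).toRingHom (mono A i) = 0 ∧ g.leadingCoeff = C e ∧ e ≠ 0 ∧
      ∀ α ∉ VA A, eval α e ≠ 0 := by
  have hinj : Function.Injective (logDerivMap A).toRingHom := algebraicIndependent_logDeriv hspan
  have hC (f : MvPolynomial (Fin d) ℂ) :
      f • mono A i = (logDerivMap A).toRingHom (C f) * mono A i := by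
    rw [Algebra.smul_def]
    congr 1
    exact ((logDerivMap A).commutes f).symm
  have hint {α} (hα : α ∉ VA A) : ∃ f, eval α f ≠ 0 ∧
      (logDerivMap A).toRingHom.IsIntegralElem ((logDerivMap A).toRingHom (C f) * mono A i) := by
    obtain ⟨f, hf, h⟩ := exists_isIntegralElem hlast hα
    exact ⟨f, hf, hC f ▸ h i⟩
  have hC0 {α : Fin d → ℂ} {f} (hf : eval α f ≠ 0) :
      (C f : MvPolynomial (Fin k) (MvPolynomial (Fin d) ℂ)) ≠ 0 := by
    rw [C_ne_zero]
    rintro rfl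
    exact hf (map_zero _)
  obtain ⟨α₀, hα₀⟩ := exists_notMem_VA A l₀ hlast
  obtain ⟨f₀, hf₀, h₀, hmonic, hh₀⟩ := hint hα₀
  obtain ⟨g, hg, hdvd⟩ := exists_eval₂_eq_zero_dvd hinj (s := mono A i)
    (h₀ := h₀.comp (Polynomial.C (C f₀) * Polynomial.X))
    (by
      rw [← Polynomial.leadingCoeff_ne_zero, Polynomial.leadingCoeff_comp, hmonic.leadingCoeff]
      · simpa using fun h => absurd h (C_ne_zero.1 (hC0 hf₀))
      · rw [Polynomial.natDegree_C_mul_X _ (hC0 hf₀)]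
        exact one_ne_zero)
    (by
      rw [Polynomial.eval₂_comp, Polynomial.eval₂_mul, Polynomial.eval₂_C, Polynomial.eval₂_X,
        hh₀])
  have key {α} (hα : α ∉ VA A) : ∃ e, g.leadingCoeff = C e ∧ eval α e ≠ 0 := by
    obtain ⟨f, hf, h⟩ := hint hα
    obtain ⟨n, hn⟩ := exists_leadingCoeff_dvd_pow hdvd (hC0 hf) h
    rw [← C_pow] at hn
    have hfn : eval α (f ^ n) ≠ 0 := by
      rw [map_pow]
      exact pow_ne_zero n hf
    obtain ⟨e, he, q, hq⟩ := exists_C_eq_of_dvd_C (C_ne_zero.1 (hC0 hfn)) hn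
    rw [hq, map_mul] at hfn
    exact ⟨e, he, left_ne_zero_of_mul hfn⟩
  obtain ⟨e, he, he0⟩ := key hα₀
  refine ⟨e, g, hg, he, C_ne_zero.1 (hC0 he0), fun α hα => ?_⟩
  obtain ⟨e', he', h⟩ := key hα
  rwa [C_injective _ _ (he.symm.trans he')]

theorem torusMonomial_cocharacter (a lam : Fin k → ℤ) {s : ℂ} (hs : s ≠ 0) :
    torusMonomial a (fun l => Units.mk0 s hs ^ lam l) = s ^ ∑ l, lam l * a l := by
  rw [← prod_zpow_eq_zpow_sum hs]
  simp [torusMonomial, zpow_mul]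

theorem torusMonomial_mulSingle (a : Fin k → ℤ) {l₀ : Fin k} (ha : a l₀ = 1) (c : ℂˣ) :
    torusMonomial a (Pi.mulSingle l₀ c) = c := by
  rw [torusMonomial, Finset.prod_eq_single l₀]
  · simp [ha]
  · intro l _ hl
    simp [Pi.mulSingle_eq_of_ne hl]
  · simp

theorem exists_annihilator_eval_eq_zero {A : Fin d → Fin k → ℤ} {l₀ : Fin k}
    (hlast : ∀ i, A i l₀ = 1) {α : Fin d → ℂ} {F : Finset (Fin d)} (hF : IsFaceOf A F)
    (hα : pProj F α ∈ nabla A F) {i : Fin d} (hi : i ∈ F)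
    {g : Polynomial (MvPolynomial (Fin k) (MvPolynomial (Fin d) ℂ))}
    (hg : g.eval₂ (logDerivMap A).toRingHom (mono A i) = 0) :
    g.map (eval₂Hom (eval α) 0) = 0 := by
  obtain ⟨-, lam, hlam0, hlampos⟩ := hF
  obtain ⟨u, hu⟩ := hα
  let m : Fin d → ℤ := fun i => ∑ j, lam j * A i j
  have hm (i) : 0 ≤ m i := by
    by_cases h : i ∈ F
    · exact (hlam0 i h).ge
    · exact (hlampos i h).le
  let q : Fin k → Polynomial ℂ := fun j => ∑ i, Polynomial.C (α i * (A i j : ℂ) *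
    torusMonomial (A i) u) * Polynomial.X ^ (m i).toNat
  have hq0 (j) : (q j).eval 0 = 0 := by
    simp only [q, Polynomial.eval_finsetSum, Polynomial.eval_mul, Polynomial.eval_C,
      Polynomial.eval_pow, Polynomial.eval_X]
    refine Eq.trans ?_ ((Finset.sum_coe_sort F
      fun i => α i * (A i j : ℂ) * torusMonomial (A i) u).symm.trans (hu j))
    rw [← Finset.sum_subset (Finset.subset_univ F)]
    · refine Finset.sum_congr rfl fun i hi => ?_
      rw [show m i = 0 from hlam0 i hi, Int.toNat_zero, pow_zero, mul_one]
    · intro i _ hi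
      have : 0 < m i := hlampos i hi
      rw [zero_pow (by omega), mul_zero]
  have hpt (i) (c s : ℂ) (hc : c ≠ 0) (hs : s ≠ 0) :
      torusMonomial (A i) (u * (fun l => Units.mk0 s hs ^ lam l) *
        Pi.mulSingle l₀ (Units.mk0 c hc)) = torusMonomial (A i) u * s ^ (m i).toNat * c := by
    rw [torusMonomial_mul, torusMonomial_mul, torusMonomial_cocharacter,
      torusMonomial_mulSingle _ (hlast i), Units.val_mk0, ← zpow_natCast,
      Int.toNat_of_nonneg (hm i)]
  have hvanish (c : ℂ) (hc : c ≠ 0) : (g.eval₂ (eval₂Hom (Polynomial.C.comp (eval α))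
      fun j => Polynomial.C c * q j) (Polynomial.C (c * torusMonomial (A i) u))) = 0 := by
    refine eq_zero_of_forall_ne_zero_eval_eq_zero fun s hs => ?_
    rw [← Polynomial.coe_evalRingHom, Polynomial.hom_eval₂]
    have h1 := congrArg (laurentEval α (u * (fun l => Units.mk0 s hs ^ lam l) *
        Pi.mulSingle l₀ (Units.mk0 c hc))) hg
    rw [Polynomial.hom_eval₂, map_zero, laurentEval_mono, hpt i c s hc hs,
      show m i = 0 from hlam0 i hi, Int.toNat_zero, pow_zero, mul_one,
      mul_comm (torusMonomial (A i) u)] at h1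
    rw [Polynomial.coe_evalRingHom, Polynomial.eval_C, ← h1]
    congr 1
    refine MvPolynomial.ringHom_ext (fun r => ?_) fun j => ?_
    · have : (logDerivMap A).toRingHom (C r) = algebraMap _ _ r := (logDerivMap A).commutes r
      rw [RingHom.comp_apply, RingHom.comp_apply, this, laurentEval_algebraMap]
      simp
    · have : (logDerivMap A).toRingHom (X j) = logDeriv A j := aeval_X _ _
      rw [RingHom.comp_apply, RingHom.comp_apply, this, laurentEval_logDeriv]
      simp only [hpt _ c s hc hs, q, eval₂Hom_X', Polynomial.coe_evalRingHom,
        Polynomial.eval_finsetSum, Polynomial.eval_mul, Polynomial.eval_C, Polynomial.eval_pow,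
        Polynomial.eval_X, Finset.mul_sum]
      exact Finset.sum_congr rfl fun i _ => by ring
  refine eq_zero_of_forall_ne_zero_eval_eq_zero fun t ht => ?_
  have hw := torusMonomial_ne_zero (A i) u
  have h1 := congrArg (Polynomial.eval 0) (hvanish (t / torusMonomial (A i) u)
    (div_ne_zero ht hw))
  rw [div_mul_cancel₀ _ hw, ← Polynomial.coe_evalRingHom, Polynomial.hom_eval₂, map_zero,
    Polynomial.coe_evalRingHom, Polynomial.eval_C] at h1
  rw [Polynomial.eval_map, ← h1]
  congr 1
  refine MvPolynomial.ringHom_ext (fun r => ?_) fun j => ?_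
  · simp
  · simp [hq0]

theorem exists_equation_VA {A : Fin d → Fin k → ℤ} {l₀ : Fin k} (hlast : ∀ i, A i l₀ = 1)
    (hspan : Submodule.span ℝ (Set.range fun i => fun j => (A i j : ℝ)) = ⊤) :
    ∃ E : MvPolynomial (Fin d) ℂ, E ≠ 0 ∧ VA A = {x | eval x E = 0} := by
  choose e g hg hlead he0 he using exists_annihilator hlast hspan
  refine ⟨∏ i, e i, Finset.prod_ne_zero_iff.2 fun i _ => he0 i, Set.ext fun α => ?_⟩
  change α ∈ VA A ↔ eval α (∏ i, e i) = 0
  rw [map_prod, Finset.prod_eq_zero_iff]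
  constructor
  · intro hα
    obtain ⟨F, hF, hαF⟩ := mem_VA.1 hα
    obtain ⟨i, hi⟩ := hF.1
    refine ⟨i, Finset.mem_univ i, ?_⟩
    have h1 := congrArg (fun p => p.coeff (g i).natDegree)
      (exists_annihilator_eval_eq_zero hlast hF hαF hi (hg i))
    simpa [hlead] using h1
  · rintro ⟨i, -, hi⟩
    by_contra hα
    exact he i α hα hi

end Equation

end ADiscriminant

/-- `V(A) = closure(V(A)) = V(E_A)`. -/
theorem VA_eq_closure_eq_VEA (d n k : ℕ) (hdn : n < d) (hk : k = d - n)
    (A : Fin d → Fin k → ℤ)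
    (hspan : Submodule.span ℝ (Set.range fun i => fun j => (A i j : ℝ)) = ⊤)
    (hlast : ∀ i, A i ⟨k - 1, by omega⟩ = 1) :
    VA A = zClosure (VA A) ∧ VA A = VEA A := by
  obtain ⟨E, hE, hVA⟩ := ADiscriminant.exists_equation_VA hlast hspan
  exact ADiscriminant.VA_eq_of_hypersurface hE hVA

end
end

section
/- The set V(A) = ⋃_F p_F^{-1}(∇_F) is Zariski-closed in ℂ^A; equivalently, V(A) equals its own closure. -/
/-!
Setting: `d > n` positive integers, `k = d - n`, `A = {a_1, …, a_d} ⊂ ℤ^k` spanning `ℝ^k`,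
with each `a_i = (a_i', 1)`.  `P ⊂ ℝ^{k-1}` is the convex hull of the `a_i'`; a face `F` of `P`
is identified with `{i : a_i' ∈ F}`, equivalently `F` is cut out by an integral linear functional
`λ` with `⟨λ, a_i⟩ = 0` for `i ∈ F` and `⟨λ, a_i⟩ > 0` for `i ∉ F`.

STATEMENT 1: `V(A) = ⋃_F p_F⁻¹(∇_F)` is Zariski closed in `ℂ^A`, i.e. it equals its own
Zariski closure.
-/

open MvPolynomial

noncomputable section

theorem exists_dual_pos_or_exists_nonneg_relation {K V ι : Type*} [Field K] [LinearOrder K]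
    [IsStrictOrderedRing K] [AddCommGroup V] [Module K V] (b : ι → V) (s : Finset ι)
    (U : Submodule K V) :
    (∃ f : Module.Dual K V, U ≤ LinearMap.ker f ∧ ∀ i ∈ s, 0 < f (b i)) ∨
      ∃ c : ι → K, (∀ i ∈ s, 0 ≤ c i) ∧ (∃ i ∈ s, 0 < c i) ∧ ∑ i ∈ s, c i • b i ∈ U := by
  classical
  induction s using Finset.induction_on generalizing U with
  | empty => exact .inl ⟨0, by simp, by simp⟩
  | insert a s ha ih =>
    have extend (c : ι → K) (r : K) : ∑ i ∈ insert a s, Function.update c a r i • b i =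
        r • b a + ∑ i ∈ s, c i • b i := by
      rw [Finset.sum_insert ha, Function.update_self]
      congr 1
      refine Finset.sum_congr rfl fun i hi => ?_
      rw [Function.update_of_ne (ne_of_mem_of_not_mem hi ha)]
    have extend_nonneg (c : ι → K) (hc : ∀ i ∈ s, 0 ≤ c i) (r : K) (hr : 0 ≤ r) :
        ∀ i ∈ insert a s, 0 ≤ Function.update c a r i := by
      intro i hi
      by_cases h : i = a
      · simpa [h] using hr
      · simpa [h] using hc i (Finset.mem_of_mem_insert_of_ne hi h)
    have extend_pos (c : ι → K) (hc : ∃ i ∈ s, 0 < c i) (r : K) :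
        ∃ i ∈ insert a s, 0 < Function.update c a r i := by
      obtain ⟨i, hi, hci⟩ := hc
      exact ⟨i, Finset.mem_insert_of_mem hi,
        by rwa [Function.update_of_ne (ne_of_mem_of_not_mem hi ha)]⟩
    by_cases hU : b a ∈ U
    · refine .inr ⟨Function.update 0 a 1, extend_nonneg 0 (by simp) 1 zero_le_one,
        ⟨a, by simp, by simp⟩, ?_⟩
      rw [extend]
      simpa using hU
    rcases ih (U ⊔ K ∙ b a) with ⟨f, hfU, hf⟩ | ⟨c, hc, hpos, hmem⟩
    · obtain ⟨g, hg, hgU⟩ := Submodule.exists_le_ker_of_notMem hU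
      obtain ⟨hfU, hfa⟩ := sup_le_iff.1 hfU
      rw [Submodule.span_singleton_le_iff_mem, LinearMap.mem_ker] at hfa
      obtain ⟨C, hC⟩ : ∃ C : K, ∀ i ∈ s, -((g (b a))⁻¹ * g (b i)) / f (b i) < C :=
        ((Filter.eventually_all_finset s).2 fun i _ =>
          Filter.eventually_gt_atTop (-((g (b a))⁻¹ * g (b i)) / f (b i))).exists
      refine .inl ⟨C • f + (g (b a))⁻¹ • g, fun u hu => ?_, ?_⟩
      · have h1 := hfU hu
        have h2 := hgU hu
        rw [LinearMap.mem_ker] at h1 h2 ⊢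
        simp [h1, h2]
      · intro i hi
        rcases Finset.mem_insert.1 hi with rfl | hi
        · simp [hfa, hg]
        · have := (div_lt_iff₀ (hf i hi)).1 (hC i hi)
          simp only [LinearMap.add_apply, LinearMap.smul_apply, smul_eq_mul]
          linarith
    · obtain ⟨u, hu, v, hv, huv⟩ := Submodule.mem_sup.1 hmem
      obtain ⟨r, rfl⟩ := Submodule.mem_span_singleton.1 hv
      rcases le_or_gt r 0 with hr | hr
      · refine .inr ⟨_, extend_nonneg c hc (-r) (by linarith), extend_pos c hpos _, ?_⟩
        rw [extend, ← huv]
        convert hu using 1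
        module
      · rcases ih U with ⟨f, hfU, hf⟩ | ⟨c, hc, hpos, hmem⟩
        · refine .inl ⟨f, hfU, fun i hi => ?_⟩
          rcases Finset.mem_insert.1 hi with rfl | hi
          · have h := congrArg f huv
            rw [map_add, LinearMap.mem_ker.1 (hfU hu), map_smul, map_sum, zero_add,
              smul_eq_mul] at h
            refine pos_of_mul_pos_right (a := r) ?_ hr.le
            rw [h]
            obtain ⟨j, hj, hcj⟩ := hpos
            refine Finset.sum_pos' (fun j hj => ?_) ⟨j, hj, ?_⟩
            · simpa using mul_nonneg (hc j hj) (hf j hj).le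
            · simpa using mul_pos hcj (hf j hj)
          · exact hf i hi
        · refine .inr ⟨_, extend_nonneg c hc 0 le_rfl, extend_pos c hpos _, ?_⟩
          rw [extend]
          simpa using hmem

theorem coeff_aeval_C_mul_X {σ R : Type*} [CommSemiring R] (p : MvPolynomial σ R) (y : σ → R)
    (n : ℕ) :
    (aeval (fun i => Polynomial.C (y i) * Polynomial.X) p).coeff n =
      eval y (homogeneousComponent n p) := by
  induction p using MvPolynomial.induction_on' with
  | monomial s c =>
    have : aeval (fun i => Polynomial.C (y i) * Polynomial.X) (monomial s c) =
        Polynomial.C (eval y (monomial s c)) * Polynomial.X ^ s.degree := by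
      simp only [aeval_monomial, eval_monomial, Finsupp.prod, mul_pow, Finset.prod_mul_distrib,
        Finset.prod_pow_eq_pow_sum, Polynomial.algebraMap_eq, map_mul, map_prod, map_pow,
        Finsupp.degree_apply, mul_assoc]
    rw [this, Polynomial.coeff_C_mul_X_pow]
    split_ifs with h
    · rw [homogeneousComponent_eq_self (h ▸ isHomogeneous_monomial c rfl)]
    · rw [homogeneousComponent_of_mem (isHomogeneous_monomial c rfl)]
      simp [h]
  | add p q hp hq => simp [hp, hq]

theorem eval_homogeneousComponent_eq_zero {σ R : Type*} [CommRing R] [IsDomain R] [Infinite R]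
    {p : MvPolynomial σ R} {y : σ → R} (h : ∀ t : R, eval (t • y) p = 0) (n : ℕ) :
    eval y (homogeneousComponent n p) = 0 := by
  have : aeval (fun i => Polynomial.C (y i) * Polynomial.X) p = 0 := by
    refine Polynomial.funext fun t => ?_
    rw [Polynomial.eval_zero, ← h t]
    clear h
    induction p using MvPolynomial.induction_on with
    | C c => simp
    | add p q hp hq => simp [hp, hq]
    | mul_X p i hp => simp [hp, mul_comm (y i)]
  rw [← coeff_aeval_C_mul_X, this, Polynomial.coeff_zero]

/-- The projection to the `α`-space of the incidence variety
`{(α, y) | y ∈ X, ∑ i, α i * y i • a i = 0}` without the points with `y = 0`. -/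
def projectedIncidence {σ ι : Type*} [Fintype σ] (X : Set (σ → ℂ)) (a : σ → ι → ℂ) :
    Set (σ → ℂ) :=
  {α | ∃ y ∈ X, y ≠ 0 ∧ ∀ l, ∑ i, α i * a i l * y i = 0}

theorem eval_homogeneousComponent_eq_sum {σ R : Type*} [Fintype σ] [DecidableEq σ] [CommSemiring R]
    (p : MvPolynomial σ R) (y : σ → R) (n : ℕ) :
    eval y (homogeneousComponent n p) =
      ∑ t : (Finset.univ.finsuppAntidiag n : Finset (σ →₀ ℕ)),
        coeff t.1 p * eval y (monomial t.1 1) := by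
  rw [Finset.sum_coe_sort (Finset.univ.finsuppAntidiag n)
    fun t => coeff t p * eval y (monomial t 1), homogeneousComponent_apply, map_sum]
  simp only [eval_monomial, one_mul]
  refine Finset.sum_subset_zero_on_sdiff (fun t ht => ?_) (fun t ht => ?_) fun _ _ => rfl
  · simpa [Finset.mem_finsuppAntidiag, Finsupp.degree_eq_sum] using (Finset.mem_filter.1 ht).2
  · obtain ⟨htT, htp⟩ := Finset.mem_sdiff.1 ht
    have hdeg : t.degree = n := by
      simpa [Finset.mem_finsuppAntidiag, Finsupp.degree_eq_sum] using htT
    rw [notMem_support_iff.1 fun h => htp (Finset.mem_filter.2 ⟨h, hdeg⟩), zero_mul]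

theorem monomial_mem_of_zeroLocus_subset {σ : Type*} [Finite σ] (I : Ideal (MvPolynomial σ ℂ))
    (hI : ∀ y ∈ zeroLocus ℂ I, y = 0) :
    ∃ N : ℕ, ∀ s : σ →₀ ℕ, s.degree = N → monomial s 1 ∈ I := by
  have hle : idealOfVars σ ℂ ≤ I.radical := by
    rw [← vanishingIdeal_zeroLocus_eq_radical (K := ℂ), idealOfVars, Ideal.span_le]
    rintro _ ⟨i, rfl⟩ y hy
    simp [hI y hy]
  obtain ⟨N, hN⟩ := Ideal.exists_pow_le_of_le_radical_of_fg hle (IsNoetherian.noetherian _)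
  refine ⟨N, fun s hs => hN ?_⟩
  rw [monomial_mem_pow_idealOfVars_iff N s one_ne_zero]
  exact hs.ge

theorem zClosure_projectedIncidence_subset {σ ι : Type*} [Fintype σ] [Finite ι]
    (S : Set (MvPolynomial σ ℂ)) (a : σ → ι → ℂ)
    (hS : ∀ y, (∀ p ∈ S, eval y p = 0) → ∀ t : ℂ, ∀ p ∈ S, eval (t • y) p = 0) :
    zClosure (projectedIncidence {y | ∀ p ∈ S, eval y p = 0} a) ⊆
      projectedIncidence {y | ∀ p ∈ S, eval y p = 0} a := by
  classical
  have := Fintype.ofFinite ι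
  intro α₀ hα₀
  by_contra hnot
  let f (l : ι) : MvPolynomial σ ℂ := ∑ i, C (α₀ i * a i l) * X i
  obtain ⟨N, hN⟩ := monomial_mem_of_zeroLocus_subset (Ideal.span S ⊔ Ideal.span (Set.range f)) <| by
    intro y hy
    rw [← Ideal.span_union, zeroLocus_span] at hy
    by_contra hy0
    refine hnot ⟨y, fun p hp => hy p (.inl hp), hy0, fun l => ?_⟩
    simpa [f] using hy (f l) (.inr ⟨l, rfl⟩)
  have hg (s : σ →₀ ℕ) (hs : s.degree = N) : ∃ g : ι → MvPolynomial σ ℂ,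
      ∀ y, (∀ p ∈ S, eval y p = 0) →
        eval y (monomial s 1) = ∑ l, eval y (g l) * eval y (f l) := by
    obtain ⟨p, hp, q, hq, hpq⟩ := Submodule.mem_sup.1 (hN s hs)
    obtain ⟨g, rfl⟩ := Ideal.mem_span_range_iff_exists_fun.1 hq
    refine ⟨g, fun y hy => ?_⟩
    have hpy : eval y p = 0 :=
      (Ideal.span_le (I := RingHom.ker (eval y))).2 (fun p hp => hy p hp) hp
    rw [← hpq]
    simp [hpy]
  choose! g hg using hg
  let T : Finset (σ →₀ ℕ) := Finset.univ.finsuppAntidiag N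
  have hT (s : T) : s.1.degree = N := by
    rw [Finsupp.degree_eq_sum]
    exact (Finset.mem_finsuppAntidiag.1 s.2).1
  let q (s : T) (i : σ) : MvPolynomial σ ℂ := ∑ l, C (a i l) * g s l * X i
  let M : Matrix T T (MvPolynomial σ ℂ) :=
    .of fun s t => ∑ i, C (coeff t.1 (q s i)) * (X i - C (α₀ i))
  have hdet (α : σ → ℂ) : eval α (1 + M).det = (1 + (eval α).mapMatrix M).det := by
    rw [RingHom.map_det, map_add, map_one]
  have hone : eval α₀ (1 + M).det = 1 := by
    have : (eval α₀).mapMatrix M = 0 := by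
      ext s t
      simp [M]
    rw [hdet, this, add_zero, Matrix.det_one]
  refine one_ne_zero (hone.symm.trans (hα₀ _ ?_))
  rintro α ⟨y, hyS, hy0, hy⟩
  rw [hdet, ← Matrix.exists_mulVec_eq_zero_iff]
  refine ⟨fun t => eval y (monomial t.1 1), ?_, ?_⟩
  · obtain ⟨i, hi⟩ := Function.ne_iff.1 hy0
    refine Function.ne_iff.2 ⟨⟨Finsupp.single i N, ?_⟩, ?_⟩
    · simp [T, Finset.mem_finsuppAntidiag]
    · simpa [eval_monomial] using fun h : y i = 0 => absurd h hi
  · funext s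
    have hline (t : ℂ) :
        eval (t • y) (monomial s.1 1 + ∑ i, C (α i - α₀ i) * q s i) = 0 := by
      have hlin : ∑ l, eval (t • y) (g s l) * (∑ i, α i * a i l * (t • y) i) = 0 := by
        refine Finset.sum_eq_zero fun l _ => ?_
        have : ∑ i, α i * a i l * (t • y) i = t * ∑ i, α i * a i l * y i := by
          rw [Finset.mul_sum]
          exact Finset.sum_congr rfl fun i _ => by simp; ring
        rw [this, hy, mul_zero, mul_zero]
      rw [map_add, hg s (hT s) _ (hS y hyS t), ← hlin]
      simp only [f, q, map_sum, map_mul, eval_C, eval_X, Finset.mul_sum]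
      rw [Finset.sum_comm (γ := ι), ← Finset.sum_add_distrib]
      conv_rhs => rw [Finset.sum_comm]
      refine Finset.sum_congr rfl fun i _ => ?_
      rw [← Finset.sum_add_distrib]
      exact Finset.sum_congr rfl fun l _ => by ring
    have hcomp := eval_homogeneousComponent_eq_zero hline N
    rw [eval_homogeneousComponent_eq_sum] at hcomp
    rw [Pi.zero_apply, ← hcomp]
    refine Finset.sum_congr rfl fun t _ => congrArg (· * _) ?_
    have h1 : coeff t.1 (monomial s.1 (1 : ℂ)) = (1 : Matrix T T ℂ) s t := by
      simp only [coeff_monomial, Matrix.one_apply, Subtype.ext_iff]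
    have h2 : coeff t.1 (∑ i, C (α i - α₀ i) * q s i) = (eval α).mapMatrix M s t := by
      simp only [coeff_sum, coeff_C_mul, mul_comm (_ - _)]
      simp only [M, RingHom.mapMatrix_apply, Matrix.map_apply, Matrix.of_apply, map_sum, map_mul,
        map_sub, eval_C, eval_X]
    rw [coeff_add, h1, h2]
    rfl

/-- Factoring relations through a divisible group: a family `y` satisfying every integer relation
among the vectors `A i` is given by monomials with exponents `A i`. -/
theorem exists_sum_zsmul_eq_of_relations {ι κ Q : Type*} [Fintype ι] [Fintype κ]
    [AddCommGroup Q] [DivisibleBy Q ℤ] (A : ι → κ → ℤ) (y : ι → Q)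
    (h : ∀ z : ι → ℤ, ∑ i, z i • A i = 0 → ∑ i, z i • y i = 0) :
    ∃ u : κ → Q, ∀ i, ∑ j, A i j • u j = y i := by
  classical
  let φ : (ι → ℤ) →ₗ[ℤ] κ → ℤ := Fintype.linearCombination ℤ A
  let ψ : (ι → ℤ) →ₗ[ℤ] Q := Fintype.linearCombination ℤ y
  have hker : LinearMap.ker φ ≤ LinearMap.ker ψ := fun z hz => h z hz
  have hinj : Function.Injective ((LinearMap.ker φ).liftQ φ le_rfl) :=
    LinearMap.ker_eq_bot.1 (Submodule.ker_liftQ_eq_bot _ _ _ le_rfl)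
  obtain ⟨χ, hχ⟩ := (Module.Baer.of_divisible Q).extension_property _ hinj
    ((LinearMap.ker φ).liftQ ψ hker)
  have hχφ (z : ι → ℤ) : χ (φ z) = ψ z := by
    simpa using LinearMap.congr_fun hχ (Submodule.Quotient.mk z)
  refine ⟨fun j => χ (Pi.single j 1), fun i => ?_⟩
  have hi := hχφ (Pi.single i 1)
  simp only [φ, ψ, Fintype.linearCombination_apply_single, one_smul] at hi
  rw [← hi]
  conv_rhs => rw [pi_eq_sum_univ' (A i), map_sum]
  refine Finset.sum_congr rfl fun j _ => ?_
  rw [map_zsmul]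

theorem exists_prod_zpow_eq_of_relations {ι κ : Type*} [Fintype ι] [Fintype κ]
    (A : ι → κ → ℤ) (y : ι → ℂˣ)
    (h : ∀ z : ι → ℤ, ∑ i, z i • A i = 0 → ∏ i, y i ^ z i = 1) :
    ∃ u : κ → ℂˣ, ∀ i, ∏ j, u j ^ A i j = y i := by
  have hsurj : ∀ {n : ℕ}, n ≠ 0 → Function.Surjective (fun a : Additive ℂˣ => n • a) := by
    intro n hn x
    obtain ⟨z, hz⟩ := IsAlgClosed.exists_pow_nat_eq ((x.toMul : ℂˣ) : ℂ) (Nat.pos_of_ne_zero hn)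
    have hz0 : z ≠ 0 := by
      rintro rfl
      rw [zero_pow hn] at hz
      exact x.toMul.ne_zero hz.symm
    exact ⟨.ofMul (Units.mk0 z hz0), Additive.toMul.injective (Units.ext (by simpa using hz))⟩
  let _ : DivisibleBy (Additive ℂˣ) ℕ := divisibleByOfSMulRightSurj _ _ hsurj
  let _ : DivisibleBy (Additive ℂˣ) ℤ := AddGroup.divisibleByIntOfDivisibleByNat _
  exact exists_sum_zsmul_eq_of_relations (Q := Additive ℂˣ) A y h

theorem exists_pos_nat_mul_eq_int {ι : Type*} [Fintype ι] (z : ι → ℚ) :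
    ∃ (D : ℕ) (w : ι → ℤ), 0 < D ∧ ∀ i, (w i : ℚ) = D * z i := by
  have hdvd (i : ι) : (z i).den ∣ ∏ j, (z j).den := Finset.dvd_prod_of_mem _ (Finset.mem_univ i)
  choose m hm using hdvd
  refine ⟨∏ j, (z j).den, fun i => (z i).num * m i, Finset.prod_pos fun j _ => (z j).den_pos,
    fun i => ?_⟩
  rw [hm i]
  push_cast
  rw [← Rat.mul_den_eq_num (z i)]
  ring

/-- The binomials `x ^ u - x ^ v`, for `u` and `v` of equal `A`-degree, generating the toric
ideal of `A`. -/
def toricBinomials {σ κ : Type*} [Fintype σ] (A : σ → κ → ℤ) : Set (MvPolynomial σ ℂ) :=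
  {p | ∃ u v : σ →₀ ℕ, (∀ j, ∑ i, (u i : ℤ) * A i j = ∑ i, (v i : ℤ) * A i j) ∧
    p = monomial u 1 - monomial v 1}

/-- The affine toric variety of `A`, the common zero locus of the toric binomials. -/
def toricVariety {σ κ : Type*} [Fintype σ] (A : σ → κ → ℤ) : Set (σ → ℂ) :=
  {y | ∀ p ∈ toricBinomials A, eval y p = 0}

section toric

variable {σ κ : Type*} [Fintype σ] {A : σ → κ → ℤ} {y : σ → ℂ}

theorem mem_toricVariety : y ∈ toricVariety A ↔ ∀ u v : σ →₀ ℕ,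
    (∀ j, ∑ i, (u i : ℤ) * A i j = ∑ i, (v i : ℤ) * A i j) →
      ∏ i, y i ^ u i = ∏ i, y i ^ v i := by
  have eval_mono (u : σ →₀ ℕ) : eval y (monomial u 1) = ∏ i, y i ^ u i := by
    rw [eval_monomial, one_mul, Finsupp.prod_fintype _ _ fun i => pow_zero _]
  constructor
  · intro hy u v huv
    have := hy _ ⟨u, v, huv, rfl⟩
    rwa [map_sub, eval_mono, eval_mono, sub_eq_zero] at this
  · rintro hy _ ⟨u, v, huv, rfl⟩
    rw [map_sub, eval_mono, eval_mono, sub_eq_zero, hy u v huv]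

theorem smul_mem_toricVariety (l : κ) (hl : ∀ i, A i l = 1) (hy : y ∈ toricVariety A) (t : ℂ) :
    t • y ∈ toricVariety A := by
  rw [mem_toricVariety] at hy ⊢
  intro u v huv
  have hdeg : ∑ i, u i = ∑ i, v i := by
    have := huv l
    simp only [hl, mul_one] at this
    exact_mod_cast this
  simp only [Pi.smul_apply, smul_eq_mul, mul_pow, Finset.prod_mul_distrib,
    Finset.prod_pow_eq_pow_sum, hy u v huv, hdeg]

theorem prod_pow_toNat_eq_of_mem_toricVariety (hy : y ∈ toricVariety A) (z : σ → ℤ)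
    (hz : ∀ j, ∑ i, z i * A i j = 0) :
    ∏ i, y i ^ (z i).toNat = ∏ i, y i ^ (-z i).toNat := by
  refine mem_toricVariety.1 hy (Finsupp.equivFunOnFinite.symm fun i => (z i).toNat)
    (Finsupp.equivFunOnFinite.symm fun i => (-z i).toNat) fun j => ?_
  rw [← sub_eq_zero, ← Finset.sum_sub_distrib, ← hz j]
  refine Finset.sum_congr rfl fun i _ => ?_
  rw [← sub_mul]
  congr 1
  simp

end toric

theorem zpow_finset_sum {ι G : Type*} [CommGroup G] (g : G) (s : Finset ι) (f : ι → ℤ) :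
    g ^ ∑ i ∈ s, f i = ∏ i ∈ s, g ^ f i := by
  classical
  induction s using Finset.induction_on with
  | empty => simp
  | insert a s ha ih => rw [Finset.sum_insert ha, Finset.prod_insert ha, zpow_add, ih]

section faces

variable {d k : ℕ} {A : Fin d → Fin k → ℤ} {y : Fin d → ℂ}

theorem exists_torusMonomial_eq_of_mem_toricVariety (hy : y ∈ toricVariety A) :
    ∃ u : Fin k → ℂˣ, ∀ i, y i ≠ 0 → torusMonomial (A i) u = y i := by
  classical
  obtain ⟨u, hu⟩ := exists_prod_zpow_eq_of_relations (fun i => if y i ≠ 0 then A i else 0)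
    (fun i => if h : y i ≠ 0 then Units.mk0 (y i) h else 1) <| by
    intro z hz
    let w : Fin d → ℤ := fun i => if y i ≠ 0 then z i else 0
    have hw (j : Fin k) : ∑ i, w i * A i j = 0 := by
      rw [← Pi.zero_apply (M := fun _ => ℤ) j, ← hz, Finset.sum_apply]
      refine Finset.sum_congr rfl fun i _ => ?_
      by_cases h : y i ≠ 0 <;> simp [w, h]
    have hne (i : Fin d) : y i ^ (-w i).toNat ≠ 0 := by
      by_cases h : y i = 0 <;> simp [w, h]
    refine Units.ext ?_
    rw [Units.coe_prod, Units.val_one,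
      ← div_self (Finset.prod_ne_zero_iff.2 fun i (_ : i ∈ Finset.univ) => hne i)]
    nth_rewrite 1 [← prod_pow_toNat_eq_of_mem_toricVariety hy w hw]
    rw [← Finset.prod_div_distrib]
    refine Finset.prod_congr rfl fun i _ => ?_
    by_cases h : y i = 0
    · simp [w, h]
    · rw [dif_pos h, Units.val_zpow_eq_zpow_val, Units.val_mk0, ← zpow_natCast, ← zpow_natCast,
        ← zpow_sub₀ h, Int.toNat_sub_toNat_neg]
      simp [w, h]
  refine ⟨u, fun i hi => ?_⟩
  have := hu i
  rw [if_pos hi, dif_pos hi] at this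
  rw [torusMonomial, this, Units.val_mk0]

theorem isFaceOf_support_of_mem_toricVariety [DecidablePred (y · ≠ 0)] (hy : y ∈ toricVariety A)
    (hy0 : y ≠ 0) : IsFaceOf A (Finset.univ.filter (y · ≠ 0)) := by
  classical
  set F : Finset (Fin d) := Finset.univ.filter (y · ≠ 0)
  have hF (i : Fin d) : i ∈ F ↔ y i ≠ 0 := by simp [F]
  refine ⟨?_, ?_⟩
  · obtain ⟨i, hi⟩ := Function.ne_iff.1 hy0
    exact ⟨i, (hF i).2 hi⟩
  let b (i : Fin d) (j : Fin k) : ℚ := A i j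
  rcases exists_dual_pos_or_exists_nonneg_relation b Fᶜ (Submodule.span ℚ (b '' F)) with
    ⟨f, hfF, hf⟩ | ⟨c, hc, ⟨i₀, hi₀, hci₀⟩, hmem⟩
  · obtain ⟨D, lam, hD, hlam⟩ := exists_pos_nat_mul_eq_int fun j => f (Pi.single j 1)
    have hsum (i : Fin d) : ((∑ j, lam j * A i j : ℤ) : ℚ) = D * f (b i) := by
      rw [LinearMap.pi_apply_eq_sum_univ f (b i), Finset.mul_sum, Int.cast_sum]
      refine Finset.sum_congr rfl fun j _ => ?_
      have : (fun l => if j = l then (1 : ℚ) else 0) = Pi.single j 1 := by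
        ext l
        simp [Pi.single_apply, eq_comm]
      rw [this, Int.cast_mul, hlam, smul_eq_mul]
      ring
    refine ⟨lam, fun i hi => ?_, fun i hi => ?_⟩
    · have hfi : f (b i) = 0 := hfF (Submodule.subset_span ⟨i, hi, rfl⟩)
      have := hsum i
      rw [hfi, mul_zero] at this
      exact_mod_cast this
    · have : (0 : ℚ) < D * f (b i) := mul_pos (by exact_mod_cast hD) (hf i (by simpa using hi))
      rw [← hsum] at this
      exact_mod_cast this
  · exfalso
    obtain ⟨e, he⟩ := (Submodule.mem_span_image_finset_iff_exists_fun' ℚ).1 hmem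
    obtain ⟨D, w, hD, hw⟩ := exists_pos_nat_mul_eq_int fun i => if i ∈ F then -e i else c i
    have hD' : (0 : ℚ) < D := by exact_mod_cast hD
    have hrel (j : Fin k) : ∑ i, w i * A i j = 0 := by
      have h1 : ∑ i, (if i ∈ F then -e i else c i) • b i = 0 := by
        rw [← Finset.sum_add_sum_compl F, Finset.sum_congr rfl fun i hi => by rw [if_pos hi],
          Finset.sum_congr (s₁ := Fᶜ) rfl fun i hi => by rw [if_neg (Finset.mem_compl.1 hi)], ← he,
          ← Finset.sum_add_distrib]
        simp
      have h2 := congrFun h1 j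
      rw [Finset.sum_apply] at h2
      have h3 : ((∑ i, w i * A i j : ℤ) : ℚ) = 0 := by
        rw [← mul_zero (D : ℚ), ← Pi.zero_apply (M := fun _ => ℚ) j, ← h2, Finset.mul_sum,
          Int.cast_sum]
        exact Finset.sum_congr rfl fun i _ => by simp [hw, b, mul_assoc]
      exact_mod_cast h3
    have hw_pos : 0 < w i₀ := by
      have : (0 : ℚ) < w i₀ := by
        rw [hw, if_neg (Finset.mem_compl.1 hi₀)]
        exact mul_pos hD' hci₀
      exact_mod_cast this
    have hw_nonneg (i : Fin d) (hi : i ∉ F) : 0 ≤ w i := by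
      have : (0 : ℚ) ≤ w i := by
        rw [hw, if_neg hi]
        exact mul_nonneg hD'.le (hc i (Finset.mem_compl.2 hi))
      exact_mod_cast this
    have hy_zero (i : Fin d) (hi : i ∉ F) : y i = 0 := by simpa [hF] using hi
    have hprod := prod_pow_toNat_eq_of_mem_toricVariety hy w hrel
    rw [Finset.prod_eq_zero (Finset.mem_univ i₀)
      (by rw [hy_zero i₀ (Finset.mem_compl.1 hi₀), zero_pow (by omega)])] at hprod
    refine Finset.prod_ne_zero_iff.2 (fun i _ => ?_) hprod.symm
    by_cases hi : i ∈ F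
    · exact pow_ne_zero _ ((hF i).1 hi)
    · rw [Int.toNat_of_nonpos (by linarith [hw_nonneg i hi]), pow_zero]
      exact one_ne_zero

theorem IsFaceOf.mem_toricVariety {F : Finset (Fin d)} (hF : IsFaceOf A F) (u : Fin k → ℂˣ) :
    (fun i => if i ∈ F then torusMonomial (A i) u else 0) ∈ toricVariety A := by
  obtain ⟨-, lam, hlam, hlam_pos⟩ := hF
  have mem_iff (m : Fin d →₀ ℕ) :
      (∀ i, m i ≠ 0 → i ∈ F) ↔ ∑ j, lam j * ∑ i, (m i : ℤ) * A i j = 0 := by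
    have hnonneg (i : Fin d) : 0 ≤ ∑ j, lam j * A i j := by
      by_cases hi : i ∈ F
      exacts [(hlam i hi).ge, (hlam_pos i hi).le]
    have hswap : ∑ j, lam j * ∑ i, (m i : ℤ) * A i j = ∑ i, (m i : ℤ) * ∑ j, lam j * A i j := by
      simp only [Finset.mul_sum]
      rw [Finset.sum_comm]
      exact Finset.sum_congr rfl fun i _ => Finset.sum_congr rfl fun j _ => by ring
    rw [hswap, Finset.sum_eq_zero_iff_of_nonneg fun i _ => mul_nonneg (by positivity) (hnonneg i)]
    refine ⟨fun h i _ => ?_, fun h i hi => ?_⟩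
    · by_cases hi : m i = 0
      · simp [hi]
      · rw [hlam i (h i hi), mul_zero]
    · by_contra hiF
      exact mul_ne_zero (by exact_mod_cast hi) (hlam_pos i hiF).ne' (h i (Finset.mem_univ i))
  have eval_eq (m : Fin d →₀ ℕ) (hm : ∀ i, m i ≠ 0 → i ∈ F) :
      ∏ i, (if i ∈ F then torusMonomial (A i) u else 0) ^ m i =
        torusMonomial (fun j => ∑ i, (m i : ℤ) * A i j) u := by
    have h1 (i : Fin d) : (if i ∈ F then torusMonomial (A i) u else 0) ^ m i =
        torusMonomial (A i) u ^ m i := by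
      by_cases hi : m i = 0
      · simp [hi]
      · rw [if_pos (hm i hi)]
    have h2 : ∏ i, (∏ j, u j ^ A i j) ^ m i = ∏ j, u j ^ ∑ i, (m i : ℤ) * A i j := by
      rw [Finset.prod_congr rfl fun i _ => (Finset.prod_pow _ (m i) _).symm, Finset.prod_comm]
      refine Finset.prod_congr rfl fun j _ => ?_
      rw [zpow_finset_sum]
      refine Finset.prod_congr rfl fun i _ => ?_
      rw [mul_comm, zpow_mul, zpow_natCast]
    rw [Finset.prod_congr rfl fun i _ => h1 i, torusMonomial, ← h2, Units.coe_prod]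
    exact Finset.prod_congr rfl fun i _ => (Units.val_pow_eq_pow_val _ _).symm
  have eval_zero (m : Fin d →₀ ℕ) (hm : ¬ ∀ i, m i ≠ 0 → i ∈ F) :
      ∏ i, (if i ∈ F then torusMonomial (A i) u else 0) ^ m i = 0 := by
    push Not at hm
    obtain ⟨i, hi, hiF⟩ := hm
    exact Finset.prod_eq_zero (Finset.mem_univ i) (by rw [if_neg hiF, zero_pow hi])
  rw [_root_.mem_toricVariety]
  intro v w hvw
  have hiff : (∀ i, v i ≠ 0 → i ∈ F) ↔ ∀ i, w i ≠ 0 → i ∈ F := by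
    simp only [mem_iff, hvw]
  by_cases hv : ∀ i, v i ≠ 0 → i ∈ F
  · simp only [eval_eq v hv, eval_eq w (hiff.1 hv), hvw]
  · rw [eval_zero v hv, eval_zero w (hiff.not.1 hv)]

theorem VA_eq_projectedIncidence (A : Fin d → Fin k → ℤ) :
    VA A = projectedIncidence (toricVariety A) (fun i l => (A i l : ℂ)) := by
  classical
  ext α
  simp only [VA, Set.mem_iUnion, Set.mem_ofPred_eq, Set.mem_preimage, exists_prop]
  constructor
  · rintro ⟨F, hF, u, hu⟩
    refine ⟨_, hF.mem_toricVariety u, ?_, fun l => ?_⟩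
    · obtain ⟨i, hi⟩ := hF.1
      exact Function.ne_iff.2 ⟨i, by simp only [if_pos hi]; exact Units.ne_zero _⟩
    · refine Eq.trans ?_ (hu l)
      refine Eq.trans ?_
        (Finset.sum_coe_sort F fun i => α i * (A i l : ℂ) * torusMonomial (A i) u).symm
      simp
  · rintro ⟨y, hy, hy0, hα⟩
    obtain ⟨u, hu⟩ := exists_torusMonomial_eq_of_mem_toricVariety hy
    refine ⟨_, isFaceOf_support_of_mem_toricVariety hy hy0, u, fun l => ?_⟩
    refine Eq.trans ?_ (hα l)
    refine (Finset.sum_coe_sort (Finset.univ.filter (y · ≠ 0))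
      fun i => α i * (A i l : ℂ) * torusMonomial (A i) u).trans ?_
    rw [Finset.sum_filter]
    refine Finset.sum_congr rfl fun i _ => ?_
    by_cases hi : y i = 0
    · simp [hi]
    · rw [if_pos hi, hu i hi]

end faces

/-- `V(A)` is Zariski closed, i.e. equals its own Zariski closure. -/
theorem VA_eq_zClosure (d n k : ℕ) (hdn : n < d) (hk : k = d - n)
    (A : Fin d → Fin k → ℤ)
    (hspan : Submodule.span ℝ (Set.range fun i => fun j => (A i j : ℝ)) = ⊤)
    (hlast : ∀ i, A i ⟨k - 1, by omega⟩ = 1) :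
    VA A = zClosure (VA A) := by
  refine Set.Subset.antisymm (fun α hα p hp => hp α hα) ?_
  rw [VA_eq_projectedIncidence]
  exact zClosure_projectedIncidence_subset (toricBinomials A) _ fun y hy t =>
    smul_mem_toricVariety _ hlast hy t

end
end

section
/- For α = (α_1,…,α_d) ∈ ℂ^d, set f = Σ_{i=1}^d α_i x^{a_i} and let R = ℂ[x^{a_1},…,x^{a_d}] ⊂ ℂ[x_1^{±1},…,x_k^{±1}] (a subring of the Laurent polynomial ring, polynomial since each a_i has last coordinate 1; graded by the x_k-degree). Then α ∉ V(A) if and only if the ℂ-algebra homomorphism γ : ℂ[y_1,…,y_k] → R sending y_i to x_i ∂f/∂x_i is a finite ring map (i.e. R is a finitely generated module over the image of ℂ[y_1,…,y_k]). -/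
/-!
Setting: `d > n` positive integers, `k = d - n`, `A = {a_1, …, a_d} ⊂ ℤ^k` spanning `ℝ^k`,
with each `a_i = (a_i', 1)`.  `P ⊂ ℝ^{k-1}` is the convex hull of the `a_i'`; a face `F` of `P`
is identified with `{i : a_i' ∈ F}`, equivalently `F` is cut out by an integral linear functional
`λ` with `⟨λ, a_i⟩ = 0` for `i ∈ F` and `⟨λ, a_i⟩ > 0` for `i ∉ F`.

STATEMENT 2: for `α ∈ ℂ^d`, with `f = ∑ α_i x^{a_i}` and
`R = ℂ[x^{a_1},…,x^{a_d}]` inside the Laurent polynomial ring `ℂ[x_1^{±1},…,x_k^{±1}]`,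
one has `α ∉ V(A)` if and only if the ℂ-algebra map `γ : ℂ[y_1,…,y_k] → R`,
`y_l ↦ x_l ∂f/∂x_l`, is a finite ring map.
-/

open MvPolynomial

noncomputable section

/-- The subring `R = ℂ[x^{a_1},…,x^{a_d}]` of the Laurent polynomial ring
`ℂ[x_1^{±1},…,x_k^{±1}] = ℂ[ℤ^k]`, generated by the monomials `x^{a_i}`. -/
def Rring {d k : ℕ} (A : Fin d → Fin k → ℤ) :
    Subalgebra ℂ (AddMonoidAlgebra ℂ (Fin k → ℤ)) :=
  Algebra.adjoin ℂ (Set.range fun i => AddMonoidAlgebra.of' ℂ (Fin k → ℤ) (A i))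

/-- The element `x_l ∂f/∂x_l = ∑_i α_i (a_i)_l x^{a_i}` of `R`, where
`f = ∑_i α_i x^{a_i}`. -/
def gElem {d k : ℕ} (A : Fin d → Fin k → ℤ) (α : Fin d → ℂ) (l : Fin k) : ↥(Rring A) :=
  ⟨∑ i, (α i * (A i l : ℂ)) • AddMonoidAlgebra.of' ℂ (Fin k → ℤ) (A i),
    Subalgebra.sum_mem _ fun i _ =>
      Subalgebra.smul_mem _ (Algebra.subset_adjoin (Set.mem_range_self i)) _⟩

/-- **Gordan's theorem** over an ordered field. -/
theorem gordan_alternative {K ι : Type*} [Field K] [LinearOrder K] [IsStrictOrderedRing K]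
    (s : Finset ι) {V : Type*} [AddCommGroup V] [Module K V] (b : ι → V) :
    (∃ f : V →ₗ[K] K, ∀ i ∈ s, 0 < f (b i)) ∨
      ∃ w : ι → K, (∀ i ∈ s, 0 ≤ w i) ∧ (∃ i ∈ s, 0 < w i) ∧ ∑ i ∈ s, w i • b i = 0 := by
  classical
  induction s using Finset.induction_on generalizing V with
  | empty => exact Or.inl ⟨0, by simp⟩
  | insert m s hm ih =>
    by_contra! hcon
    obtain ⟨hf, hw⟩ := hcon
    have key : ∀ (w : ι → K) (μ : K), (∀ i ∈ s, 0 ≤ w i) → 0 ≤ μ →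
        ((∃ i ∈ s, 0 < w i) ∨ 0 < μ) → ∑ i ∈ s, w i • b i + μ • b m ≠ 0 := by
      intro w μ h0 hμ hpos hsum
      have hne : ∀ i ∈ s, i ≠ m := fun i hi h => hm (h ▸ hi)
      refine hw (Function.update w m μ) ?_ ?_ ?_
      · intro i hi
        rcases Finset.mem_insert.1 hi with rfl | hi
        · simpa
        · simpa [Function.update_of_ne (hne i hi)] using h0 i hi
      · rcases hpos with ⟨i, hi, hp⟩ | hp
        · exact ⟨i, Finset.mem_insert_of_mem hi, by simpa [Function.update_of_ne (hne i hi)]⟩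
        · exact ⟨m, Finset.mem_insert_self _ _, by simpa⟩
      · rw [Finset.sum_insert hm, Function.update_self, add_comm, ← hsum]
        congr 1
        exact Finset.sum_congr rfl fun i hi => by rw [Function.update_of_ne (hne i hi)]
    have hbm : b m ≠ 0 := fun h =>
      key 0 1 (by simp) zero_le_one (Or.inr zero_lt_one) (by simp [h])
    obtain ⟨f, hfpos⟩ : ∃ f : V →ₗ[K] K, ∀ i ∈ s, 0 < f (b i) := by
      refine (ih b).resolve_right ?_
      rintro ⟨w, h0, hpos, hsum⟩
      exact key w 0 h0 le_rfl (Or.inl hpos) (by simp [hsum])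
    have hfm : f (b m) ≤ 0 := by
      obtain ⟨i, hi, hle⟩ := hf f
      rcases Finset.mem_insert.1 hi with rfl | hi
      · exact hle
      · exact absurd (hfpos i hi) (not_lt.2 hle)
    obtain ⟨h, hh⟩ : ∃ h : V →ₗ[K] K, h (b m) = 1 := by
      obtain ⟨h, hh⟩ := Module.Projective.exists_dual_ne_zero K hbm
      exact ⟨(h (b m))⁻¹ • h, by simp [hh]⟩
    obtain ⟨g, hg⟩ : ∃ g : (V ⧸ Submodule.span K {b m}) →ₗ[K] K,
        ∀ i ∈ s, 0 < g (Submodule.Quotient.mk (b i)) := by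
      refine (ih fun i => (Submodule.Quotient.mk (b i) : V ⧸ Submodule.span K {b m})).resolve_right
        ?_
      rintro ⟨w, h0, ⟨i, hi, hpos⟩, hsum⟩
      have hmem : ∑ i ∈ s, w i • b i ∈ Submodule.span K {b m} := by
        rw [← Submodule.Quotient.mk_eq_zero, ← hsum]
        exact map_sum (Submodule.mkQ (Submodule.span K {b m})) _ _
      obtain ⟨μ, hμ⟩ := Submodule.mem_span_singleton.1 hmem
      have hfp : 0 < f (∑ i ∈ s, w i • b i) := by
        simp only [map_sum, map_smul, smul_eq_mul]
        exact Finset.sum_pos' (fun j hj => mul_nonneg (h0 j hj) (hfpos j hj).le)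
          ⟨i, hi, mul_pos hpos (hfpos i hi)⟩
      rw [← hμ, map_smul, smul_eq_mul] at hfp
      have hμ0 : μ ≤ 0 := by
        by_contra! hlt
        exact absurd hfp (not_lt.2 (mul_nonpos_of_nonneg_of_nonpos hlt.le hfm))
      exact key w (-μ) h0 (by linarith) (Or.inl ⟨i, hi, hpos⟩) (by simp [← hμ])
    obtain ⟨N, hN⟩ : ∃ N : K, ∀ i ∈ s, 0 < h (b i) + N * g (Submodule.Quotient.mk (b i)) := by
      obtain ⟨N, hN⟩ := (s.image fun i =>
        (1 - h (b i)) / g (Submodule.Quotient.mk (b i))).bddAbove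
      refine ⟨N, fun i hi => ?_⟩
      have := hN (Finset.mem_coe.2 (Finset.mem_image_of_mem _ hi))
      rw [div_le_iff₀ (hg i hi)] at this
      linarith
    obtain ⟨i, hi, hle⟩ := hf (h + N • g.comp (Submodule.mkQ _))
    rcases Finset.mem_insert.1 hi with rfl | hi
    · have : (Submodule.Quotient.mk (b i) : V ⧸ Submodule.span K {b i}) = 0 :=
        (Submodule.Quotient.mk_eq_zero _).2 (Submodule.mem_span_singleton_self _)
      simp [hh, this] at hle
      linarith
    · have := hN i hi
      simp at hle
      linarith

/-- Clearing denominators in a finite family of rationals. -/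
theorem exists_int_scaling {ι : Type*} [Fintype ι] (q : ι → ℚ) :
    ∃ (N : ℤ) (z : ι → ℤ), 0 < N ∧ ∀ i, (z i : ℚ) = N * q i := by
  classical
  refine ⟨∏ i, ((q i).den : ℤ), fun i => (∏ j ∈ Finset.univ.erase i, ((q j).den : ℤ)) * (q i).num,
    Finset.prod_pos fun i _ => by exact_mod_cast (q i).pos, fun i => ?_⟩
  rw [← Finset.prod_erase_mul _ _ (Finset.mem_univ i)]
  push_cast
  rw [mul_assoc, mul_comm ((q i).den : ℚ), Rat.mul_den_eq_num]

/-- An integral functional vanishing on the `a_i`, `i ∈ F`, and positive on the other `a_i` exists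
as soon as there is no integral relation among the `a_i` with nonnegative, not all zero,
coefficients outside `F`. -/
theorem exists_functional_of_no_relation {d k : ℕ} (A : Fin d → Fin k → ℤ) (F : Finset (Fin d))
    (h : ∀ w : Fin d → ℤ, (∀ i ∉ F, 0 ≤ w i) → ∑ i, w i • A i = 0 → ∀ i ∉ F, w i = 0) :
    ∃ lam : Fin k → ℤ,
      (∀ i ∈ F, ∑ j, lam j * A i j = 0) ∧ ∀ i ∉ F, 0 < ∑ j, lam j * A i j := by
  classical
  let a : Fin d → Fin k → ℚ := fun i j => A i j
  let W : Submodule ℚ (Fin k → ℚ) := Submodule.span ℚ (a '' (F : Set (Fin d)))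
  obtain ⟨g, hg⟩ : ∃ g : ((Fin k → ℚ) ⧸ W) →ₗ[ℚ] ℚ, ∀ i ∈ Fᶜ, 0 < g (W.mkQ (a i)) := by
    refine (gordan_alternative Fᶜ fun i => W.mkQ (a i)).resolve_right ?_
    rintro ⟨w, h0, ⟨i, hi, hpos⟩, hsum⟩
    have hmem : ∑ i ∈ Fᶜ, w i • a i ∈ W := by
      rw [← Submodule.Quotient.mk_eq_zero, ← hsum]
      exact (map_sum W.mkQ (fun i => w i • a i) Fᶜ).trans
        (Finset.sum_congr rfl fun i _ => map_smul _ _ _)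
    obtain ⟨v, hv⟩ : ∃ v : Fin d → ℚ, ∑ i ∈ F, v i • a i = ∑ i ∈ Fᶜ, w i • a i := by
      obtain ⟨v, hv⟩ := (Submodule.mem_span_image_finset_iff_exists_fun ℚ).1 hmem
      refine ⟨fun i => if hi : i ∈ F then v ⟨i, hi⟩ else 0, ?_⟩
      rw [← hv, ← Finset.sum_coe_sort]
      simp
    obtain ⟨N, z, hN, hz⟩ := exists_int_scaling fun i => if i ∈ F then - v i else w i
    have hN' : (0 : ℚ) < N := by exact_mod_cast hN
    have hiF : i ∉ F := by simpa using hi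
    refine absurd (h z ?_ ?_ i hiF) ?_
    · intro j hj
      have := hz j
      rw [if_neg hj] at this
      have h1 := mul_nonneg hN'.le (h0 j (by simpa using hj))
      rw [← this] at h1
      exact_mod_cast h1
    · have hq : ∑ i, (z i : ℚ) • a i = 0 := by
        simp_rw [hz, mul_smul, ← Finset.smul_sum]
        rw [← Finset.sum_add_sum_compl F]
        rw [Finset.sum_congr rfl (g := fun i => - (v i • a i))
          fun i hi => by rw [if_pos hi, neg_smul],
          Finset.sum_congr (s₁ := Fᶜ) rfl (g := fun i => w i • a i)
          fun i hi => by rw [if_neg (by simpa using hi)], Finset.sum_neg_distrib, hv]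
        simp
      ext j
      have := congrFun hq j
      simp only [Finset.sum_apply, Pi.smul_apply, smul_eq_mul, a, Pi.zero_apply] at this ⊢
      exact_mod_cast this
    · intro h0
      have := hz i
      rw [if_neg hiF, h0] at this
      have := mul_pos hN' hpos
      rw [← ‹_ = (N : ℚ) * w i›] at this
      simp at this
  let G : (Fin k → ℚ) →ₗ[ℚ] ℚ := g.comp W.mkQ
  obtain ⟨N, lam, hN, hlam⟩ := exists_int_scaling fun j => G (Pi.single j 1)
  have hN' : (0 : ℚ) < N := by exact_mod_cast hN
  have hG : ∀ i, ((∑ j, lam j * A i j : ℤ) : ℚ) = N * G (a i) := by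
    intro i
    rw [LinearMap.pi_apply_eq_sum_univ G (a i)]
    push_cast
    rw [Finset.mul_sum]
    refine Finset.sum_congr rfl fun j _ => ?_
    have : (fun l => if j = l then (1 : ℚ) else 0) = Pi.single j 1 := by
      ext l; simp [Pi.single_apply, eq_comm]
    simp only [hlam, this, smul_eq_mul, a]
    ring
  refine ⟨lam, fun i hi => ?_, fun i hi => ?_⟩
  · have h0 : W.mkQ (a i) = 0 :=
      (Submodule.Quotient.mk_eq_zero _).2 (Submodule.subset_span ⟨i, hi, rfl⟩)
    have := hG i
    simp only [G, LinearMap.comp_apply, h0, map_zero, mul_zero] at this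
    exact_mod_cast this
  · have := mul_pos hN' (hg i (by simpa using hi))
    have h1 := hG i
    simp only [G, LinearMap.comp_apply] at h1
    rw [← h1] at this
    exact_mod_cast this

/-- Integral relations among the vectors `a i` are the only obstruction to solving
`u ^ (a i) = v i` in the torus over an algebraically closed field. -/
theorem exists_torus_point {L ι κ : Type*} [Field L] [IsAlgClosed L]
    [Fintype ι] [Fintype κ] (a : ι → κ → ℤ) (v : ι → Lˣ)
    (h : ∀ w : ι → ℤ, ∑ i, w i • a i = 0 → ∏ i, v i ^ w i = 1) :
    ∃ u : κ → Lˣ, ∀ i, ∏ j, u j ^ a i j = v i := by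
  classical
  have hroot : ∀ {n : ℤ}, n ≠ 0 → Function.Surjective fun x : Lˣ => x ^ n := by
    intro n hn x
    have key : ∀ m : ℕ, m ≠ 0 → ∀ y : Lˣ, ∃ z : Lˣ, z ^ m = y := by
      intro m hm y
      obtain ⟨z, hz⟩ := IsAlgClosed.exists_pow_nat_eq (y : L) (Nat.pos_of_ne_zero hm)
      have hz0 : z ≠ 0 := by
        rintro rfl
        rw [zero_pow hm] at hz
        exact y.ne_zero hz.symm
      exact ⟨Units.mk0 z hz0, Units.ext (by simpa using hz)⟩
    obtain ⟨m, rfl | rfl⟩ := n.eq_nat_or_neg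
    · obtain ⟨z, hz⟩ := key m (by simpa using hn) x
      exact ⟨z, by simpa using hz⟩
    · obtain ⟨z, hz⟩ := key m (by simpa using hn) x⁻¹
      exact ⟨z, by simp [hz]⟩
  let _ : DivisibleBy (Additive Lˣ) ℤ := divisibleByOfSMulRightSurj (Additive Lˣ) ℤ hroot
  let f : (ι → ℤ) →ₗ[ℤ] (κ → ℤ) := Fintype.linearCombination ℤ a
  let g : (ι → ℤ) →ₗ[ℤ] Additive Lˣ :=
    Fintype.linearCombination ℤ fun i => Additive.ofMul (v i)
  have hker : LinearMap.ker f ≤ LinearMap.ker g := by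
    intro w hw
    have := h w (by simpa [f, Fintype.linearCombination_apply] using hw)
    rw [LinearMap.mem_ker]
    simp only [g, Fintype.linearCombination_apply]
    simpa [← ofMul_zpow, ← ofMul_prod] using this
  obtain ⟨e, he⟩ := (Module.Baer.of_divisible (Additive Lˣ)).extension_property
    ((LinearMap.ker f).liftQ f le_rfl) (by
      rw [← LinearMap.ker_eq_bot, Submodule.ker_liftQ_eq_bot _ _ _ le_rfl])
    ((LinearMap.ker f).liftQ g hker)
  refine ⟨fun j => (e (Pi.single j 1)).toMul, fun i => ?_⟩
  have h1 : e (a i) = Additive.ofMul (v i) := by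
    have := LinearMap.congr_fun he (Submodule.Quotient.mk (Pi.single i 1))
    simpa [f, g] using this
  have h2 := LinearMap.pi_apply_eq_sum_univ e (a i)
  rw [h1] at h2
  apply Additive.ofMul.injective
  rw [h2, ofMul_prod]
  refine Finset.sum_congr rfl fun j _ => ?_
  have : (fun l => if j = l then (1 : ℤ) else 0) = Pi.single j 1 := by
    ext l; simp [Pi.single_apply, eq_comm]
  rw [ofMul_zpow, this]
  rfl

theorem MvPolynomial.IsHomogeneous.homogeneousComponent_mul {σ K : Type*} [CommSemiring K]
    {p : MvPolynomial σ K} {m : ℕ} (hp : p.IsHomogeneous m) (n : ℕ) (q : MvPolynomial σ K) :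
    homogeneousComponent (m + n) (p * q) = p * homogeneousComponent n q := by
  let _ := MvPolynomial.gradedAlgebra (σ := σ) (R := K)
  have := DirectSum.coe_decompose_mul_add_of_left_mem (homogeneousSubmodule σ K)
    (i := m) (j := n) (a := p) (b := q) hp
  rw [← decomposition.decompose'_apply, ← decomposition.decompose'_apply]
  exact this

/-- Graded Nakayama: if a power of each variable maps into the ideal generated by the `g l`, with
homogeneous coefficients of smaller degree, then the target of a surjection from a polynomial ring
is finite over the subalgebra generated by the `g l`. -/
theorem finite_aeval_of_pow_eq_sum {σ τ K R : Type*} [Finite σ] [Fintype τ] [Field K]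
    [CommRing R] [Algebra K R] (π : MvPolynomial σ K →ₐ[K] R) (hπ : Function.Surjective π)
    (g : τ → R)
    (hX : ∀ i, ∃ (N : ℕ) (s : τ → MvPolynomial σ K), (∀ l, (s l).IsHomogeneous N) ∧
      π (X i ^ (N + 1)) = ∑ l, g l * π (s l)) :
    RingHom.Finite (MvPolynomial.aeval g : MvPolynomial τ K →ₐ[K] R).toRingHom := by
  classical
  choose N s hs hN using hX
  let γ : MvPolynomial τ K →ₐ[K] R := MvPolynomial.aeval g
  let _ : Algebra (MvPolynomial τ K) R := γ.toRingHom.toAlgebra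
  have hsmul : ∀ (b : MvPolynomial τ K) (r : R), b • r = γ b * r := fun _ _ => rfl
  let M : σ →₀ ℕ := Finsupp.equivFunOnFinite.symm N
  let Q : Submodule (MvPolynomial τ K) R :=
    Submodule.span (MvPolynomial τ K) ((fun m => π (monomial m 1)) '' Set.Iic M)
  have hpoly : ∀ p : MvPolynomial σ K, (∀ m ∈ p.support, π (monomial m 1) ∈ Q) → π p ∈ Q := by
    intro p hp
    rw [p.as_sum, map_sum]
    refine Q.sum_mem fun m hm => ?_
    have : π (monomial m (coeff m p)) = (C (coeff m p) : MvPolynomial τ K) • π (monomial m 1) := by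
      rw [hsmul, ← mul_one (coeff m p), ← smul_eq_mul, ← smul_monomial, map_smul]
      simp [γ, Algebra.smul_def]
    rw [this]
    exact Q.smul_mem _ (hp m hm)
  have hmon : ∀ (n : ℕ) (m : σ →₀ ℕ), m.degree = n → π (monomial m 1) ∈ Q := by
    intro n
    induction n using Nat.strong_induction_on with
    | _ n ih =>
      intro m hm
      by_cases hle : m ≤ M
      · exact Submodule.subset_span ⟨m, hle, rfl⟩
      · obtain ⟨i, hi⟩ : ∃ i, N i + 1 ≤ m i := by
          by_contra! hcon
          exact hle fun i => Nat.lt_succ_iff.1 (hcon i)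
        obtain ⟨m', rfl⟩ := exists_add_of_le (Finsupp.single_le_iff.2 hi)
        have hdeg : N i + 1 + m'.degree = n := by
          rw [← hm, map_add, Finsupp.degree_single]
        have : π (monomial (Finsupp.single i (N i + 1) + m') 1) =
            ∑ l, (X l : MvPolynomial τ K) • π (s i l * monomial m' 1) := by
          rw [monomial_single_add, map_mul, hN, Finset.sum_mul]
          refine Finset.sum_congr rfl fun l _ => ?_
          rw [hsmul, map_mul]
          simp [γ, mul_assoc]
        rw [this]
        refine Q.sum_mem fun l _ => Q.smul_mem _ (hpoly _ fun e he => ?_)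
        have hhom := (hs i l).mul (isHomogeneous_monomial (R := K) 1 (rfl : m'.degree = m'.degree))
        have he' : e.degree = N i + m'.degree := by
          exact (DFunLike.congr_fun (Finsupp.degree_eq_weight_one (R := ℕ)) e).trans
            (hhom (mem_support_iff.1 he))
        exact ih e.degree (by omega) e rfl
  refine ⟨⟨(((Set.finite_Iic M).image fun m => π (monomial m 1)).toFinset), ?_⟩⟩
  rw [Set.Finite.coe_toFinset, eq_top_iff]
  intro r _
  obtain ⟨p, rfl⟩ := hπ r
  exact hpoly p fun m _ => hmon _ m rfl

/-- The presentation `ℂ[z_1,…,z_d] → ℂ[ℤ^k]`, `z_i ↦ x^{a_i}`. -/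
def toricMap {d k : ℕ} (A : Fin d → Fin k → ℤ) :
    MvPolynomial (Fin d) ℂ →ₐ[ℂ] AddMonoidAlgebra ℂ (Fin k → ℤ) :=
  aeval fun i => AddMonoidAlgebra.of' ℂ (Fin k → ℤ) (A i)

theorem toricMap_monomial {d k : ℕ} (A : Fin d → Fin k → ℤ) (m : Fin d →₀ ℕ) (c : ℂ) :
    toricMap A (monomial m c) = AddMonoidAlgebra.single (∑ i, m i • A i) c := by
  classical
  have key : ∀ s : Finset (Fin d), ∏ i ∈ s, AddMonoidAlgebra.of' ℂ (Fin k → ℤ) (A i) ^ m i =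
      AddMonoidAlgebra.single (∑ i ∈ s, m i • A i) 1 := by
    intro s
    induction s using Finset.induction_on with
    | empty => simp [AddMonoidAlgebra.one_def]
    | insert i s hi ih =>
      rw [Finset.prod_insert hi, Finset.sum_insert hi, ih, AddMonoidAlgebra.of',
        AddMonoidAlgebra.single_pow, AddMonoidAlgebra.single_mul_single]
      simp
  rw [toricMap, aeval_monomial, Finsupp.prod_fintype _ _ (by simp), key,
    AddMonoidAlgebra.coe_algebraMap]
  simp [AddMonoidAlgebra.single_mul_single]

theorem toricMap_homogeneousComponent {d k : ℕ} (A : Fin d → Fin k → ℤ) (e : Fin k)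
    (he : ∀ i, A i e = 1) (n : ℕ) (p : MvPolynomial (Fin d) ℂ) (a : Fin k → ℤ) :
    (toricMap A (homogeneousComponent n p)).coeff a =
      if a e = n then (toricMap A p).coeff a else 0 := by
  classical
  induction p using MvPolynomial.induction_on' with
  | add p q hp hq =>
    simp only [map_add, AddMonoidAlgebra.coeff_add, Finsupp.add_apply, hp, hq]
    split_ifs <;> simp
  | monomial m c =>
    have hdeg : (∑ i, m i • A i) e = m.degree := by
      rw [Finsupp.degree_eq_sum]
      simp [Finset.sum_apply, he]
    rw [homogeneousComponent_of_mem
      (n := m.degree) ((mem_homogeneousSubmodule _ _).2 (isHomogeneous_monomial c rfl))]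
    by_cases ha : a = ∑ i, m i • A i
    · subst ha
      rw [hdeg]
      by_cases h : n = m.degree <;> simp [h, eq_comm]
    · have : (toricMap A (monomial m c)).coeff a = 0 := by
        rw [toricMap_monomial, AddMonoidAlgebra.coeff_single, Finsupp.single_eq_of_ne ha]
      split_ifs <;> simp [this]

theorem toricMap_homogeneousComponent_eq_zero {d k : ℕ} {A : Fin d → Fin k → ℤ} {e : Fin k}
    (he : ∀ i, A i e = 1) (n : ℕ) {p : MvPolynomial (Fin d) ℂ} (hp : toricMap A p = 0) :
    toricMap A (homogeneousComponent n p) = 0 := by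
  ext a
  rw [toricMap_homogeneousComponent A e he, hp]
  simp

/-- A nonzero point of `ℂ^d` satisfying all binomial relations coming from `A` has a face as its
support, and its coordinates there are the monomials `u ^ a_i` of a torus point `u`. -/
theorem exists_face_and_torus_point {d k : ℕ} (A : Fin d → Fin k → ℤ) (c : Fin d → ℂ)
    (hc : c ≠ 0)
    (h : ∀ m m' : Fin d → ℕ, ∑ i, m i • A i = ∑ i, m' i • A i →
      ∏ i, c i ^ m i = ∏ i, c i ^ m' i) :
    ∃ F, IsFaceOf A F ∧ (∀ i, i ∈ F ↔ c i ≠ 0) ∧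
      ∃ u : Fin k → ℂˣ, ∀ i ∈ F, torusMonomial (A i) u = c i := by
  classical
  let F : Finset (Fin d) := Finset.univ.filter fun i => c i ≠ 0
  have hF : ∀ i, i ∈ F ↔ c i ≠ 0 := by simp [F]
  have hsplit : ∀ w : Fin d → ℤ, ∑ i, w i • A i = 0 →
      ∏ i, c i ^ (w i).toNat = ∏ i, c i ^ (-w i).toNat := by
    intro w hw
    refine h _ _ ?_
    rw [← sub_eq_zero, ← Finset.sum_sub_distrib, ← hw]
    refine Finset.sum_congr rfl fun i _ => ?_
    rw [← natCast_zsmul, ← natCast_zsmul, ← sub_smul, Int.toNat_sub_toNat_neg]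
  refine ⟨F, ⟨?_, exists_functional_of_no_relation A F ?_⟩, hF, ?_⟩
  · obtain ⟨i, hi⟩ := Function.ne_iff.1 hc
    exact ⟨i, (hF i).2 hi⟩
  · intro w h0 hw i hi
    by_contra hne
    have h1 := hsplit w hw
    have hpos : 0 < w i := lt_of_le_of_ne (h0 i hi) (Ne.symm hne)
    rw [Finset.prod_eq_zero (Finset.mem_univ i)] at h1
    · obtain ⟨j, -, hj⟩ := Finset.prod_eq_zero_iff.1 h1.symm
      obtain ⟨hj, hj'⟩ := pow_eq_zero_iff'.1 hj
      have := h0 j fun hjF => (hF j).1 hjF hj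
      omega
    · have : c i = 0 := by simpa [hF] using hi
      rw [this, zero_pow (by omega)]
  · obtain ⟨u, hu⟩ := exists_torus_point (L := ℂ) (fun i : F => A i)
      (fun i => Units.mk0 (c i) ((hF i).1 i.2)) (by
        intro w hw
        let W : Fin d → ℤ := fun i => if hi : i ∈ F then w ⟨i, hi⟩ else 0
        have hWF : ∀ i : F, W i = w i := fun i => by simp [W]
        have hW0 : ∀ i ∉ F, W i = 0 := fun i hi => by simp [W, hi]
        have h1 := hsplit W (by
          rw [← hw, ← Finset.sum_subset (Finset.subset_univ F)
            (fun i _ hi => by rw [hW0 i hi, zero_smul]), ← Finset.sum_coe_sort]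
          exact Finset.sum_congr rfl fun i _ => by rw [hWF])
        rw [← Finset.prod_subset (Finset.subset_univ F)
            (fun i _ hi => by rw [hW0 i hi]; simp),
          ← Finset.prod_subset (Finset.subset_univ F)
            (fun i _ hi => by rw [hW0 i hi]; simp),
          ← Finset.prod_coe_sort F, ← Finset.prod_coe_sort F, ← div_eq_one_iff_eq
            (Finset.prod_ne_zero_iff.2 fun i _ => pow_ne_zero _ ((hF _).1 i.2)),
          ← Finset.prod_div_distrib] at h1
        ext
        rw [Units.coe_prod, Units.val_one, ← h1]
        refine Finset.prod_congr rfl fun i _ => ?_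
        have hci := (hF i).1 i.2
        rw [hWF, Units.val_zpow_eq_zpow_val, Units.val_mk0, ← zpow_natCast, ← zpow_natCast,
          ← zpow_sub₀ hci, Int.toNat_sub_toNat_neg])
    refine ⟨u, fun i hi => ?_⟩
    rw [torusMonomial, hu ⟨i, hi⟩]
    rfl

/-- The linear form `∑_i α_i (a_i)_l z_i` lifting `x_l ∂f/∂x_l`. -/
def gForm {d k : ℕ} (A : Fin d → Fin k → ℤ) (α : Fin d → ℂ) (l : Fin k) :
    MvPolynomial (Fin d) ℂ :=
  ∑ i, (α i * (A i l : ℂ)) • X i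

theorem gForm_isHomogeneous {d k : ℕ} (A : Fin d → Fin k → ℤ) (α : Fin d → ℂ) (l : Fin k) :
    (gForm A α l).IsHomogeneous 1 :=
  IsHomogeneous.sum _ _ _ fun i _ => by
    rw [smul_eq_C_mul]
    exact (isHomogeneous_X ℂ i).C_mul _

theorem toricMap_gForm {d k : ℕ} (A : Fin d → Fin k → ℤ) (α : Fin d → ℂ) (l : Fin k) :
    toricMap A (gForm A α l) = gElem A α l := by
  simp [toricMap, gForm, gElem]

theorem mem_VA_iff {d k : ℕ} {A : Fin d → Fin k → ℤ} {α : Fin d → ℂ} :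
    α ∈ VA A ↔ ∃ F, IsFaceOf A F ∧ ∃ u : Fin k → ℂˣ, ∀ l,
      ∑ i ∈ F, α i * (A i l : ℂ) * torusMonomial (A i) u = 0 := by
  simp only [VA, nabla, pProj, Set.mem_iUnion, Set.mem_preimage, Set.mem_ofPred_eq, exists_prop]
  refine exists_congr fun F => and_congr_right fun _ => exists_congr fun u =>
    forall_congr' fun l => ?_
  rw [← Finset.sum_coe_sort F]

/-- Outside `V(A)` the linear forms `gForm` have no common zero but `0` on the affine toric
variety of `A`. -/
theorem eq_zero_of_not_mem_VA {d k : ℕ} {A : Fin d → Fin k → ℤ} {α : Fin d → ℂ}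
    (hα : α ∉ VA A) (c : Fin d → ℂ) (hker : ∀ p, toricMap A p = 0 → aeval c p = 0)
    (hg : ∀ l, aeval c (gForm A α l) = 0) : c = 0 := by
  by_contra hc
  obtain ⟨F, hF, hcF, u, hu⟩ := exists_face_and_torus_point A c hc fun m m' hmm => by
    have := hker (monomial (Finsupp.equivFunOnFinite.symm m) 1 -
      monomial (Finsupp.equivFunOnFinite.symm m') 1) (by
        rw [map_sub, toricMap_monomial, toricMap_monomial, sub_eq_zero]
        exact congrArg (AddMonoidAlgebra.single · 1) hmm)
    rw [map_sub, aeval_monomial, aeval_monomial, Finsupp.prod_fintype _ _ (by simp),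
      Finsupp.prod_fintype _ _ (by simp)] at this
    simpa [sub_eq_zero] using this
  refine hα (mem_VA_iff.2 ⟨F, hF, u, fun l => ?_⟩)
  have h1 := hg l
  simp only [gForm, map_sum, map_smul, aeval_X, smul_eq_mul] at h1
  rw [← h1, ← Finset.sum_subset (Finset.subset_univ F)
    (fun i _ hi => by rw [show c i = 0 by simpa [hcF] using hi, mul_zero])]
  exact Finset.sum_congr rfl fun i hi => by rw [hu i hi]

theorem finite_of_not_mem_VA {d k : ℕ} {A : Fin d → Fin k → ℤ} {e : Fin k}
    (he : ∀ i, A i e = 1) {α : Fin d → ℂ} (hα : α ∉ VA A) :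
    RingHom.Finite
        (MvPolynomial.aeval (gElem A α) :
          MvPolynomial (Fin k) ℂ →ₐ[ℂ] ↥(Rring A)).toRingHom := by
  classical
  have hrange : (toricMap A).range = Rring A :=
    (Algebra.adjoin_range_eq_range_aeval ℂ _).symm
  let π : MvPolynomial (Fin d) ℂ →ₐ[ℂ] ↥(Rring A) :=
    (toricMap A).codRestrict (Rring A) fun p => hrange ▸ AlgHom.mem_range_self (toricMap A) p
  have hπ : ∀ p, (π p : AddMonoidAlgebra ℂ (Fin k → ℤ)) = toricMap A p := fun _ => rfl
  refine finite_aeval_of_pow_eq_sum π ?_ _ fun i => ?_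
  · rintro ⟨r, hr⟩
    obtain ⟨p, hp⟩ : r ∈ (toricMap A).range := hrange ▸ hr
    exact ⟨p, Subtype.ext hp⟩
  · let I : Ideal (MvPolynomial (Fin d) ℂ) :=
      RingHom.ker (toricMap A) ⊔ Ideal.span (Set.range (gForm A α))
    have hrad : X i ∈ I.radical := by
      rw [← vanishingIdeal_zeroLocus_eq_radical (K := ℂ), mem_vanishingIdeal_iff]
      intro c hc
      have hc0 : c = 0 := eq_zero_of_not_mem_VA hα c
        (fun p hp => hc p (Ideal.mem_sup_left hp))
        (fun l => hc _ (Ideal.mem_sup_right (Ideal.subset_span ⟨l, rfl⟩)))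
      simp [hc0]
    obtain ⟨n, hn⟩ := hrad
    have hn1 : X i ^ (n + 1) ∈ I := by
      rw [pow_succ]
      exact I.mul_mem_right _ hn
    obtain ⟨p, hp, q, hq, hpq⟩ := Submodule.mem_sup.1 hn1
    obtain ⟨t, ht⟩ := (Ideal.mem_span_range_iff_exists_fun).1 hq
    refine ⟨n, fun l => homogeneousComponent n (t l),
      fun l => homogeneousComponent_isHomogeneous _ _, Subtype.ext ?_⟩
    have hX : homogeneousComponent (n + 1) (X i ^ (n + 1) : MvPolynomial (Fin d) ℂ) =
        X i ^ (n + 1) := by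
      refine homogeneousComponent_eq_self ?_
      simpa using (isHomogeneous_X ℂ i).pow (n + 1)
    have h1 : toricMap A (X i ^ (n + 1)) =
        ∑ l, toricMap A (gForm A α l) * toricMap A (homogeneousComponent n (t l)) := by
      rw [← hX, ← hpq, map_add, map_add,
        toricMap_homogeneousComponent_eq_zero he _ hp, zero_add, ← ht, map_sum, map_sum]
      refine Finset.sum_congr rfl fun l _ => ?_
      rw [mul_comm, add_comm n 1, (gForm_isHomogeneous A α l).homogeneousComponent_mul, map_mul]
    rw [hπ, h1]
    simp [hπ, toricMap_gForm]

/-- Evaluation of Laurent polynomials at a point of the torus. -/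
def torusEval {k : ℕ} (u : Fin k → ℂˣ) : AddMonoidAlgebra ℂ (Fin k → ℤ) →ₐ[ℂ] ℂ :=
  AddMonoidAlgebra.lift ℂ ℂ (Fin k → ℤ)
    { toFun := fun a => torusMonomial a.toAdd u
      map_one' := by simp [torusMonomial]
      map_mul' := fun a b => by simp [torusMonomial, zpow_add, Finset.prod_mul_distrib] }

theorem torusEval_of' {k : ℕ} (u : Fin k → ℂˣ) (a : Fin k → ℤ) :
    torusEval u (AddMonoidAlgebra.of' ℂ (Fin k → ℤ) a) = torusMonomial a u := by
  simp [torusEval, AddMonoidAlgebra.of']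

theorem torusMonomial_mul {k : ℕ} (a : Fin k → ℤ) (u v : Fin k → ℂˣ) :
    torusMonomial a (u * v) = torusMonomial a u * torusMonomial a v := by
  simp [torusMonomial, mul_zpow, Finset.prod_mul_distrib]

theorem torusMonomial_zpow {k : ℕ} (a lam : Fin k → ℤ) (s : ℂˣ) :
    torusMonomial a (fun j => s ^ lam j) = ((s ^ (∑ j, lam j * a j) : ℂˣ) : ℂ) := by
  rw [torusMonomial]
  congr 1
  simp_rw [← zpow_mul]
  exact (map_sum (zmultiplesHom (Additive ℂˣ) (Additive.ofMul s)) _ _).symm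

theorem not_finite_of_mem_VA {d k : ℕ} {A : Fin d → Fin k → ℤ} {e : Fin k}
    (he : ∀ i, A i e = 1) {α : Fin d → ℂ} (hα : α ∈ VA A) :
    ¬ RingHom.Finite
        (MvPolynomial.aeval (gElem A α) :
          MvPolynomial (Fin k) ℂ →ₐ[ℂ] ↥(Rring A)).toRingHom := by
  classical
  intro hfin
  obtain ⟨F, ⟨⟨i, hi⟩, lam, hlam0, hlam⟩, u, hu⟩ := mem_VA_iff.1 hα
  have hnonneg : ∀ i, 0 ≤ ∑ j, lam j * A i j := fun i => by
    by_cases h : i ∈ F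
    · exact (hlam0 i h).ge
    · exact (hlam i h).le
  let x : Rring A := ⟨AddMonoidAlgebra.of' ℂ (Fin k → ℤ) (A i),
    Algebra.subset_adjoin (Set.mem_range_self i)⟩
  obtain ⟨P, hP, hPx⟩ := hfin.to_isIntegral x
  -- The value of `x_l ∂f/∂x_l` along the one-parameter family `t s^lam u` of torus points
  let G : ℂ → ℂ → Fin k → ℂ := fun t s l =>
    ∑ i, α i * (A i l : ℂ) * (t * (s ^ (∑ j, lam j * A i j).toNat * torusMonomial (A i) u))
  have hG0 : ∀ t, G t 0 = 0 := by
    intro t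
    ext l
    have hl := congrArg (t * ·) (hu l)
    simp only [Finset.mul_sum, mul_zero] at hl
    refine Eq.trans ?_ hl
    simp only [G]
    rw [← Finset.sum_subset (Finset.subset_univ F)]
    · refine Finset.sum_congr rfl fun j hj => ?_
      rw [hlam0 j hj]
      simp
      ring
    · intro j _ hj
      rw [zero_pow (by have := hlam j hj; omega)]
      simp
  let c : ℂ := torusMonomial (A i) u
  have hc : c ≠ 0 := Units.ne_zero _
  have hroot : ∀ (t s : ℂ), t ≠ 0 → s ≠ 0 →
      (P.map (MvPolynomial.aeval (G t s) : MvPolynomial (Fin k) ℂ →ₐ[ℂ] ℂ).toRingHom).eval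
        (t * c) = 0 := by
    intro t s ht hs
    let v : Fin k → ℂˣ := (fun j => Units.mk0 s hs ^ lam j) * u
    let w : Fin k → ℂˣ := (fun j => Units.mk0 t ht ^ (Pi.single e 1 : Fin k → ℤ) j) * v
    have hw : ∀ i, torusMonomial (A i) w =
        t * (s ^ (∑ j, lam j * A i j).toNat * torusMonomial (A i) u) := by
      intro i
      obtain ⟨n, hn⟩ := Int.eq_ofNat_of_zero_le (hnonneg i)
      rw [torusMonomial_mul, torusMonomial_mul, torusMonomial_zpow, torusMonomial_zpow, hn]
      simp [Pi.single_apply, he]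
    have hcomp : ((torusEval w).comp (Rring A).val).comp (MvPolynomial.aeval (gElem A α)) =
        MvPolynomial.aeval (G t s) := by
      refine MvPolynomial.algHom_ext fun l => ?_
      simp only [AlgHom.comp_apply, aeval_X, gElem, Subalgebra.coe_val, map_sum, map_smul,
        torusEval_of', hw, smul_eq_mul, G]
    have hx : torusEval w x = t * c := by
      simp only [x, torusEval_of', hw, hlam0 i hi]
      simp [c]
    have h1 := congrArg ((torusEval w).comp (Rring A).val) hPx
    rw [map_zero, ← AlgHom.coe_toRingHom, Polynomial.hom_eval₂] at h1
    rw [Polynomial.eval_map, ← hcomp, ← hx]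
    exact h1
  have hroot0 : ∀ t : ℂ, t ≠ 0 →
      (P.map (MvPolynomial.aeval (0 : Fin k → ℂ) :
        MvPolynomial (Fin k) ℂ →ₐ[ℂ] ℂ).toRingHom).eval (t * c) = 0 := by
    intro t ht
    have hcont : Continuous fun s : ℂ =>
        (P.map (MvPolynomial.aeval (G t s) : MvPolynomial (Fin k) ℂ →ₐ[ℂ] ℂ).toRingHom).eval
          (t * c) := by
      simp only [Polynomial.eval_map, Polynomial.eval₂_eq_sum_range]
      refine continuous_finsetSum _ fun n _ => Continuous.mul ?_ continuous_const
      have hGc : Continuous fun s => G t s := by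
        refine continuous_pi fun l => ?_
        simp only [G]
        fun_prop
      simpa [MvPolynomial.aeval_eq_eval, Function.comp_def] using
        (MvPolynomial.continuous_eval (P.coeff n)).comp hGc
    have := (continuous_const (y := (0 : ℂ))).ext_on (dense_compl_singleton (0 : ℂ)) hcont
      (fun s hs => (hroot t s ht hs).symm)
    have := congrFun this 0
    simp only [hG0] at this
    exact this.symm
  have hmonic := hP.map (MvPolynomial.aeval (0 : Fin k → ℂ) :
        MvPolynomial (Fin k) ℂ →ₐ[ℂ] ℂ).toRingHom
  refine hmonic.ne_zero (Polynomial.eq_zero_of_infinite_isRoot _ ?_)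
  refine (Set.Infinite.mono ?_ (Set.finite_singleton (0 : ℂ)).infinite_compl)
  intro y hy
  have := hroot0 (y / c) (div_ne_zero hy hc)
  rwa [div_mul_cancel₀ _ hc] at this

/-- `α ∉ V(A)` iff the map `γ : ℂ[y_1,…,y_k] → R`, `y_l ↦ x_l ∂f/∂x_l`,
is a finite ring map (`R` is a finitely generated module over (the image of) `ℂ[y_1,…,y_k]`). -/
theorem not_mem_VA_iff_finite (d n k : ℕ) (hdn : n < d) (hk : k = d - n)
    (A : Fin d → Fin k → ℤ)
    (hspan : Submodule.span ℝ (Set.range fun i => fun j => (A i j : ℝ)) = ⊤)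
    (hlast : ∀ i, A i ⟨k - 1, by omega⟩ = 1) (α : Fin d → ℂ) :
    α ∉ VA A ↔
      RingHom.Finite
        (MvPolynomial.aeval (gElem A α) :
          MvPolynomial (Fin k) ℂ →ₐ[ℂ] ↥(Rring A)).toRingHom :=
  ⟨finite_of_not_mem_VA hlast, fun hfin hα => not_finite_of_mem_VA hlast hα hfin⟩

end
end

section
/- For every face F of P and every u ∈ (ℂ^*)^k, the point z ∈ ℙ^{d-1} with homogeneous coordinates z_i = u^{a_i} for i ∈ F and z_i = 0 for i ∉ F lies in the projective toric variety X_A, i.e. in the Zariski closure of { (x^{a_1} : ⋯ : x^{a_d}) : x ∈ (ℂ^*)^k } in ℙ^{d-1}. -/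
/-!
Setting: `d > n` positive integers, `k = d - n`, `A = {a_1, …, a_d} ⊂ ℤ^k` spanning `ℝ^k`,
with each `a_i = (a_i', 1)`.  `P ⊂ ℝ^{k-1}` is the convex hull of the `a_i'`; a face `F` of `P`
is identified with `{i : a_i' ∈ F}`, equivalently `F` is cut out by an integral linear functional
`λ` with `⟨λ, a_i⟩ = 0` for `i ∈ F` and `⟨λ, a_i⟩ > 0` for `i ∉ F`.

STATEMENT 3: for every face `F` of `P` and every `u ∈ (ℂ*)^k`, the point `z ∈ ℙ^{d-1}` with
homogeneous coordinates `z_i = u^{a_i}` for `i ∈ F` and `z_i = 0` for `i ∉ F` lies in the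
projective toric variety `X_A`, the Zariski closure in `ℙ^{d-1}` of
`{(x^{a_1} : ⋯ : x^{a_d}) : x ∈ (ℂ*)^k}`.  Membership of a point (given by homogeneous
coordinates) in the projective Zariski closure of a set is expressed as: every homogeneous
polynomial vanishing identically on (the cone over) the set also vanishes on the given
homogeneous coordinate vector.
-/

open MvPolynomial

noncomputable section

theorem torusMonomial_zpow_mul {k : ℕ} (a lam : Fin k → ℤ) (t : ℂˣ) (u : Fin k → ℂˣ) :
    torusMonomial a (fun j => t ^ lam j * u j) =
      (t : ℂ) ^ (∑ j, lam j * a j) * torusMonomial a u := by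
  have hsum : ∀ s : Finset (Fin k),
      ∏ j ∈ s, t ^ (lam j * a j) = t ^ (∑ j ∈ s, lam j * a j) := by
    intro s
    induction s using Finset.cons_induction with
    | empty => simp
    | cons j s hj ih => rw [Finset.prod_cons, Finset.sum_cons, zpow_add, ih]
  simp only [torusMonomial, mul_zpow, ← zpow_mul, Finset.prod_mul_distrib, hsum]
  rw [Units.val_mul, Units.val_zpow_eq_zpow_val]

open Classical in
/-- the point `z` with homogeneous coordinates `z_i = u^{a_i}` (`i ∈ F`),
`z_i = 0` (`i ∉ F`) lies in the Zariski closure `X_A ⊆ ℙ^{d-1}` of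
`{(x^{a_1} : ⋯ : x^{a_d}) : x ∈ (ℂ*)^k}`: every homogeneous polynomial `p` vanishing at all the
points `(x^{a_1}, …, x^{a_d})`, `x ∈ (ℂ*)^k`, vanishes at `z`. -/
theorem face_point_mem_XA (d n k : ℕ) (hdn : n < d) (hk : k = d - n)
    (A : Fin d → Fin k → ℤ)
    (hspan : Submodule.span ℝ (Set.range fun i => fun j => (A i j : ℝ)) = ⊤)
    (hlast : ∀ i, A i ⟨k - 1, by omega⟩ = 1)
    (F : Finset (Fin d)) (hF : IsFaceOf A F) (u : Fin k → ℂˣ)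
    (m : ℕ) (p : MvPolynomial (Fin d) ℂ) (hp : p.IsHomogeneous m)
    (hvan : ∀ x : Fin k → ℂˣ, eval (fun i => torusMonomial (A i) x) p = 0) :
    eval (fun i => if i ∈ F then torusMonomial (A i) u else 0) p = 0 := by
  obtain ⟨-, lam, hzero, hpos⟩ := hF
  have hnonneg : ∀ i, 0 ≤ ∑ j, lam j * A i j := fun i => by
    by_cases hi : i ∈ F
    · exact (hzero i hi).ge
    · exact (hpos i hi).le
  set f : ℂ → ℂ := fun t =>
    eval (fun i => t ^ (∑ j, lam j * A i j).toNat * torusMonomial (A i) u) p with hf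
  have hcont : Continuous f :=
    (MvPolynomial.continuous_eval p).comp (by fun_prop)
  have hvanish : Set.EqOn f (fun _ => 0) {0}ᶜ := fun t ht => by
    have ht0 : t ≠ 0 := ht
    rw [← hvan fun j => Units.mk0 t ht0 ^ lam j * u j]
    simp only [hf, torusMonomial_zpow_mul]
    congr 2
    funext i
    rw [← zpow_natCast, Int.toNat_of_nonneg (hnonneg i), Units.val_mk0]
  have hzero_eval : f 0 = 0 :=
    congrFun (hcont.ext_on (dense_compl_singleton 0) continuous_const hvanish) 0
  refine Eq.trans ?_ hzero_eval
  simp only [hf]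
  congr 2
  funext i
  by_cases hi : i ∈ F
  · simp [hi, hzero i hi]
  · have hne : (∑ j, lam j * A i j).toNat ≠ 0 := by
      have := hpos i hi
      omega
    simp [hi, zero_pow hne]

end
end

section
/- Let γ : S → T be a homomorphism of ℕ-graded commutative rings, where T is a finitely generated T_0-algebra and T_0 is a finitely generated S_0-module. Then Spec S_0 contains an open subset U such that for any S_0-scheme φ : W → Spec S_0, the base-changed morphism W ×_{Spec S_0} Spec T → W ×_{Spec S_0} Spec S is finite if and only if the image of φ is contained in U. -/
/-!
Setting: `γ : S → T` a homomorphism of ℕ-graded commutative rings, realized as: `S`, `T`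
commutative rings with `T` an `S`-algebra (`γ = algebraMap S T`), `R` a commutative ring
mapping isomorphically onto the degree-zero part `S_0` of `S` (hypotheses `h0S`, `hinjS`),
gradings `𝒮 : ℕ → Submodule R S`, `𝒯 : ℕ → Submodule R T` respected by `γ` (`hγ`); `T` is a
finitely generated `T_0`-algebra (`hTfgalg`) and `T_0` is a finitely generated `S_0`-module
(`hT0fg`).

STATEMENT 5: `Spec S_0` contains an open subset `U` such that for every `S_0`-scheme
`φ : W → Spec S_0`, the base-changed morphism
`W ×_{Spec S_0} Spec T → W ×_{Spec S_0} Spec S` is finite if and only if the image of `φ` is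
contained in `U`.
-/

open AlgebraicGeometry CategoryTheory CategoryTheory.Limits

noncomputable section

universe u

open TensorProduct DirectSum

section Field

variable {S K M : Type*} [CommRing S] [Field K] [Algebra S K] [AddCommGroup M] [Module S M]
  [Module.Finite S M]

theorem exists_smul_eq_zero_of_subsingleton_tensorProduct [Subsingleton (K ⊗[S] M)] :
    ∃ s : S, algebraMap S K s ≠ 0 ∧ ∀ m : M, s • m = 0 := by
  obtain ⟨q, hq⟩ : ∃ q : PrimeSpectrum S, q.asIdeal = RingHom.ker (algebraMap S K) :=
    ⟨⟨_, RingHom.ker_isPrime _⟩, rfl⟩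
  have hmem (x : S) : x ∈ q.asIdeal ↔ algebraMap S K x = 0 := by rw [hq, RingHom.mem_ker]
  let φ : q.asIdeal.ResidueField →+* K := Ideal.ResidueField.lift q.asIdeal (algebraMap S K)
    hq.le (fun x hx ↦ isUnit_iff_ne_zero.mpr fun h ↦ hx ((hmem x).mpr h))
  let _ := φ.toAlgebra
  have : IsScalarTower S q.asIdeal.ResidueField K := .of_algebraMap_eq fun x ↦ by
    rw [RingHom.algebraMap_toAlgebra]
    exact (Ideal.ResidueField.lift_algebraMap ..).symm
  have h1 : Subsingleton (q.asIdeal.ResidueField ⊗[S] M) := by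
    have := (AlgebraTensorModule.cancelBaseChange S q.asIdeal.ResidueField K K M).toEquiv.subsingleton
    exact Module.FaithfullyFlat.lTensor_reflects_triviality q.asIdeal.ResidueField K _
  have h2 : q ∉ Module.support S M := by
    rw [Module.mem_support_iff_nontrivial_residueField_tensorProduct]
    exact not_nontrivial_iff_subsingleton.mpr h1
  rw [Module.mem_support_iff_of_finite, SetLike.not_le_iff_exists] at h2
  obtain ⟨s, hs, hs'⟩ := h2
  exact ⟨s, fun h ↦ hs' ((hmem s).mpr h), Module.mem_annihilator.mp hs⟩

end Field

section FiniteType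

variable {R T : Type*} [CommRing R] [CommRing T] [Algebra R T]
  (𝒯 : ℕ → Submodule R T) [GradedAlgebra 𝒯]

theorem exists_finset_forall_sub_mem_span
    (hT : ∃ s : Finset T, Subring.closure ((𝒯 0 : Set T) ∪ ↑s) = ⊤) :
    ∃ s : Finset T, (∀ t ∈ s, ∃ i, i ≠ 0 ∧ t ∈ 𝒯 i) ∧
      ∀ x : T, x - decompose 𝒯 x 0 ∈ Ideal.span (s : Set T) := by
  obtain ⟨s, hs⟩ := hT
  have : Algebra.FiniteType (𝒯 0) T := by
    refine ⟨s, ?_⟩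
    rw [← top_le_iff]
    intro x _
    have hx : x ∈ Subring.closure ((𝒯 0 : Set T) ∪ ↑s) := hs ▸ Subring.mem_top x
    refine (Subring.closure_le (t := (Algebra.adjoin (𝒯 0) (s : Set T)).toSubring)).mpr ?_ hx
    rintro y (hy | hy)
    · exact Subalgebra.algebraMap_mem (Algebra.adjoin (𝒯 0) (s : Set T)) ⟨y, hy⟩
    · exact Algebra.subset_adjoin hy
  obtain ⟨s, hs, hs'⟩ := GradedAlgebra.exists_finset_adjoin_eq_top_and_homogeneous_ne_zero 𝒯
  refine ⟨s, hs', fun x ↦ ?_⟩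
  have hx : x ∈ Algebra.adjoin (𝒯 0) (s : Set T) := hs ▸ Algebra.mem_top
  induction hx using Algebra.adjoin_induction with
  | mem x hx =>
    obtain ⟨i, hi, hxi⟩ := hs' x hx
    rw [decompose_of_mem_ne 𝒯 hxi hi, sub_zero]
    exact Ideal.subset_span hx
  | algebraMap r =>
    have : algebraMap (𝒯 0) T r - decompose 𝒯 (algebraMap (𝒯 0) T r) 0 = 0 :=
      sub_eq_zero.mpr (decompose_of_mem_same 𝒯 r.2).symm
    rw [this]
    exact zero_mem _
  | add x y _ _ hx hy =>
    convert add_mem hx hy using 1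
    simp only [decompose_add, DirectSum.add_apply, Submodule.coe_add]
    ring
  | mul x y _ _ hx hy =>
    convert add_mem (Ideal.mul_mem_left _ x hy)
      (Ideal.mul_mem_right (decompose 𝒯 y 0 : T) _ hx) using 1
    have := map_mul (GradedRing.projZeroRingHom 𝒯) x y
    simp only [GradedRing.projZeroRingHom_apply] at this
    rw [this]
    ring

theorem exists_finset_forall_eq_iSup_map_mulLeft
    (hT : ∃ s : Finset T, Subring.closure ((𝒯 0 : Set T) ∪ ↑s) = ⊤) :
    ∃ (s : Finset T) (deg : T → ℕ), (∀ t ∈ s, deg t ≠ 0) ∧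
      ∀ n ≠ 0, 𝒯 n = ⨆ t : {t : s // deg t ≤ n},
        (𝒯 (n - deg t)).map (LinearMap.mulLeft R (t : T)) := by
  obtain ⟨s, hs, hsT⟩ := exists_finset_forall_sub_mem_span 𝒯 hT
  choose! deg hdeg hmem using hs
  refine ⟨s, deg, hdeg, fun n hn ↦ le_antisymm (fun x hx ↦ ?_) (iSup_le ?_)⟩
  rotate_left
  · rintro ⟨⟨t, ht⟩, htn⟩ _ ⟨y, hy, rfl⟩
    simpa [Nat.add_sub_cancel' htn] using SetLike.mul_mem_graded (hmem t ht) hy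
  have key (z : T) (hz : z ∈ Ideal.span (s : Set T)) :
      (decompose 𝒯 z n : T) ∈ ⨆ t : {t : s // deg t ≤ n},
        (𝒯 (n - deg t)).map (LinearMap.mulLeft R (t : T)) := by
    induction hz using Submodule.closure_induction with
    | zero => simp
    | add y z _ _ hy hz => simpa using add_mem hy hz
    | smul_mem r t ht =>
      rw [smul_eq_mul, mul_comm, coe_decompose_mul_of_left_mem 𝒯 n (hmem t ht)]
      split_ifs with h
      · exact Submodule.mem_iSup_of_mem (⟨⟨t, ht⟩, h⟩ : {t : s // deg t ≤ n})
          ⟨_, (decompose 𝒯 r (n - deg t)).2, rfl⟩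
      · exact zero_mem _
  have := key x (by simpa [decompose_of_mem_ne 𝒯 hx hn] using hsT x)
  rwa [decompose_of_mem_same 𝒯 hx] at this

theorem fg_of_finite_zero (hT : ∃ s : Finset T, Subring.closure ((𝒯 0 : Set T) ∪ ↑s) = ⊤)
    [h0 : Module.Finite R (𝒯 0)] (n : ℕ) : (𝒯 n).FG := by
  obtain ⟨s, deg, hdeg, hs⟩ := exists_finset_forall_eq_iSup_map_mulLeft 𝒯 hT
  induction n using Nat.strong_induction_on with
  | _ n ih =>
    obtain rfl | hn := eq_or_ne n 0
    · exact Module.Finite.iff_fg.mp h0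
    rw [hs n hn]
    refine Submodule.fg_iSup _ fun ⟨⟨t, ht⟩, htn⟩ ↦ (ih _ ?_).map _
    have := hdeg t ht
    lia

end FiniteType

section Graded

variable {R S T : Type*} [CommRing R] [CommRing S] [CommRing T] [Algebra R S]
  [Algebra S T] {𝒮 : ℕ → Submodule R S}

variable (T 𝒮) in
/-- The extension to `T` of the irrelevant ideal of `S`. -/
def irrelevantExtension : Ideal T :=
  Ideal.span (algebraMap S T '' {s | ∃ i ≠ 0, s ∈ 𝒮 i})

theorem smul_mem_irrelevantExtension {i : ℕ} (hi : i ≠ 0) {s : S} (hs : s ∈ 𝒮 i) (x : T) :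
    s • x ∈ irrelevantExtension T 𝒮 := by
  rw [Algebra.smul_def]
  exact Ideal.mul_mem_right _ _ (Ideal.subset_span ⟨s, ⟨i, hi, hs⟩, rfl⟩)

variable [Algebra R T] (𝒯 : ℕ → Submodule R T) [GradedAlgebra 𝒯]

theorem decompose_smul_of_mem (hγ : ∀ (n : ℕ), ∀ s ∈ 𝒮 n, algebraMap S T s ∈ 𝒯 n)
    {i : ℕ} {s : S} (hs : s ∈ 𝒮 i) (x : T) (n : ℕ) :
    (decompose 𝒯 (s • x) n : T) = if i ≤ n then s • (decompose 𝒯 x (n - i) : T) else 0 := by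
  simp only [Algebra.smul_def]
  exact coe_decompose_mul_of_left_mem 𝒯 n (hγ i s hs)

theorem isHomogeneous_irrelevantExtension
    (hγ : ∀ (n : ℕ), ∀ s ∈ 𝒮 n, algebraMap S T s ∈ 𝒯 n) :
    (irrelevantExtension T 𝒮).IsHomogeneous 𝒯 := by
  refine Ideal.homogeneous_span 𝒯 _ ?_
  rintro _ ⟨s, ⟨i, -, hs⟩, rfl⟩
  exact ⟨i, hγ i s hs⟩

theorem decompose_mem_span_of_mem_irrelevantExtension
    (hγ : ∀ (n : ℕ), ∀ s ∈ 𝒮 n, algebraMap S T s ∈ 𝒯 n)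
    {z : T} (hz : z ∈ irrelevantExtension T 𝒮) (n : ℕ) :
    (decompose 𝒯 z n : T) ∈ Submodule.span S {y | ∃ m < n, y ∈ 𝒯 m} := by
  induction hz using Submodule.closure_induction with
  | zero => simp
  | add y z _ _ hy hz => simpa using add_mem hy hz
  | smul_mem r t ht =>
    obtain ⟨s, ⟨i, hi, hs⟩, rfl⟩ := ht
    rw [smul_eq_mul, mul_comm, ← Algebra.smul_def, decompose_smul_of_mem 𝒯 hγ hs]
    split_ifs with h
    · exact Submodule.smul_mem _ _ (Submodule.subset_span ⟨n - i, by lia, SetLike.coe_mem _⟩)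
    · exact zero_mem _

theorem exists_forall_smul_mem_irrelevantExtension_of_le
    (hT : ∃ s : Finset T, Subring.closure ((𝒯 0 : Set T) ∪ ↑s) = ⊤) :
    ∃ d : ℕ, ∀ (f : R) (D : ℕ),
      (∀ n, D < n → n ≤ D + d → ∀ x ∈ 𝒯 n, f • x ∈ irrelevantExtension T 𝒮) →
      ∀ n, D < n → ∀ x ∈ 𝒯 n, f • x ∈ irrelevantExtension T 𝒮 := by
  obtain ⟨s, deg, hdeg, hs⟩ := exists_finset_forall_eq_iSup_map_mulLeft 𝒯 hT
  refine ⟨s.sup deg, fun f D H n ↦ ?_⟩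
  induction n using Nat.strong_induction_on with
  | _ n ih =>
    intro hn x hx
    by_cases h : n ≤ D + s.sup deg
    · exact H n hn h x hx
    refine (?_ : _ ≤ ((irrelevantExtension T 𝒮).restrictScalars R).comap (f • LinearMap.id))
      ((hs n (by lia)).le hx)
    refine iSup_le ?_
    rintro ⟨⟨t, ht⟩, htn⟩ _ ⟨y, hy, rfl⟩
    have h1 : deg t ≤ s.sup deg := Finset.le_sup ht
    have h2 := hdeg t ht
    have := ih (n - deg t) (by lia) (by lia) y hy
    simpa using Ideal.mul_mem_left _ t this

variable [IsScalarTower R S T]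

variable (S) in
theorem exists_forall_pow_smul_mem_span
    (hγ : ∀ (n : ℕ), ∀ s ∈ 𝒮 n, algebraMap S T s ∈ 𝒯 n) {f : R} {D : ℕ}
    (hf : ∀ n, D < n → ∀ x ∈ 𝒯 n, f • x ∈ irrelevantExtension T 𝒮) (x : T) :
    ∃ k, f ^ k • x ∈ Submodule.span S {y | ∃ m ≤ D, y ∈ 𝒯 m} := by
  set N := Submodule.span S {y | ∃ m ≤ D, y ∈ 𝒯 m}
  have mono {k l : ℕ} (h : k ≤ l) {x : T} (hx : f ^ k • x ∈ N) : f ^ l • x ∈ N := by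
    rw [← Nat.sub_add_cancel h, pow_add, mul_smul]
    exact N.smul_of_tower_mem _ hx
  let Q : Submodule S T :=
    { carrier := {x | ∃ k, f ^ k • x ∈ N}
      zero_mem' := ⟨0, by simp⟩
      add_mem' := by
        rintro x y ⟨k, hk⟩ ⟨l, hl⟩
        exact ⟨max k l, by
          rw [smul_add]
          exact add_mem (mono (le_max_left _ _) hk) (mono (le_max_right _ _) hl)⟩
      smul_mem' := by
        rintro s x ⟨k, hk⟩
        exact ⟨k, by rw [smul_comm]; exact N.smul_mem s hk⟩ }
  have key (n : ℕ) : ∀ x ∈ 𝒯 n, x ∈ Q := by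
    induction n using Nat.strong_induction_on with
    | _ n ih =>
      intro x hx
      by_cases hn : n ≤ D
      · exact ⟨0, by rw [pow_zero, one_smul]; exact Submodule.subset_span ⟨n, hn, hx⟩⟩
      have h1 := decompose_mem_span_of_mem_irrelevantExtension 𝒯 hγ (hf n (by lia) x hx) n
      rw [decompose_of_mem_same 𝒯 ((𝒯 n).smul_mem f hx)] at h1
      have h2 : Submodule.span S {y | ∃ m < n, y ∈ 𝒯 m} ≤ Q := by
        rw [Submodule.span_le]
        rintro y ⟨m, hm, hy⟩
        exact ih m hm y hy
      obtain ⟨k, hk⟩ := h2 h1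
      exact ⟨k + 1, by rwa [pow_succ, mul_smul]⟩
  classical
  suffices x ∈ Q from this
  rw [← sum_support_decompose 𝒯 x]
  exact sum_mem fun n _ ↦ key n _ (SetLike.coe_mem _)

theorem finite_tensorProduct_away
    (hγ : ∀ (n : ℕ), ∀ s ∈ 𝒮 n, algebraMap S T s ∈ 𝒯 n) (hfg : ∀ n, (𝒯 n).FG) {f : R} {D : ℕ}
    (hf : ∀ n, D < n → ∀ x ∈ 𝒯 n, f • x ∈ irrelevantExtension T 𝒮) :
    Module.Finite (Localization.Away (algebraMap R S f))
      (Localization.Away (algebraMap R S f) ⊗[S] T) := by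
  set A := Localization.Away (algebraMap R S f)
  choose G hG using hfg
  let F : Set T := ⋃ n ∈ Set.Iic D, G n
  have hF : F.Finite := (Set.finite_Iic D).biUnion fun n _ ↦ (G n).finite_toSet
  have hspan : Submodule.span S {y | ∃ m ≤ D, y ∈ 𝒯 m} ≤ Submodule.span S F := by
    rw [Submodule.span_le]
    rintro y ⟨m, hm, hy⟩
    rw [← hG m] at hy
    refine Submodule.span_le_restrictScalars R S F (Submodule.span_mono ?_ hy)
    exact Set.subset_biUnion_of_mem (u := fun n ↦ (G n : Set T)) (Set.mem_Iic.mpr hm)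
  let N : Submodule A (A ⊗[S] T) := Submodule.span A ((fun y ↦ (1 : A) ⊗ₜ[S] y) '' F)
  have hN (x : T) (hx : x ∈ Submodule.span S F) : (1 : A) ⊗ₜ[S] x ∈ N := by
    refine (?_ : _ ≤ (N.restrictScalars S).comap (TensorProduct.mk S A T 1)) hx
    rw [Submodule.span_le]
    exact fun y hy ↦ Submodule.subset_span ⟨y, hy, rfl⟩
  refine ⟨?_⟩
  convert Submodule.fg_span (R := A) (hF.image fun y ↦ (1 : A) ⊗ₜ[S] y)
  refine (eq_top_iff.mpr fun z _ ↦ ?_ : N = ⊤).symm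
  induction z using TensorProduct.induction_on with
  | zero => exact zero_mem _
  | add x y hx hy => exact add_mem (hx trivial) (hy trivial)
  | tmul a x =>
    obtain ⟨k, hk⟩ := exists_forall_pow_smul_mem_span S 𝒯 hγ hf x
    have h1 := hN _ (hspan hk)
    rw [← algebraMap_smul S, map_pow, TensorProduct.tmul_smul, ← algebraMap_smul A, map_pow] at h1
    have hu := (IsLocalization.Away.algebraMap_isUnit (S := A) (algebraMap R S f)).pow k
    have h2 := (Submodule.smul_mem_iff_of_isUnit N hu).mp h1
    simpa [TensorProduct.smul_tmul'] using N.smul_mem a h2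

variable (S) in
/-- Taking degree `n` components, as an `S`-linear map modulo the extension of the irrelevant
ideal of `S`. -/
def componentModIrrelevant [GradedAlgebra 𝒮] (h0S : ∀ s ∈ 𝒮 0, ∃ r : R, algebraMap R S r = s)
    (hγ : ∀ (n : ℕ), ∀ s ∈ 𝒮 n, algebraMap S T s ∈ 𝒯 n) (n : ℕ) :
    T →ₗ[S] T ⧸ irrelevantExtension T 𝒮 where
  toFun x := Ideal.Quotient.mk _ (decompose 𝒯 x n : T)
  map_add' x y := by simp
  map_smul' s x := by
    induction s using Decomposition.inductionOn 𝒮 with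
    | zero => simp
    | add s t hs ht =>
      simp only [add_smul, decompose_add, DirectSum.add_apply, Submodule.coe_add, map_add, hs, ht]
    | @homogeneous i s =>
      obtain rfl | hi := eq_or_ne i 0
      · obtain ⟨r, hr⟩ := h0S s s.2
        have h1 (y : T) : (s : S) • y = r • y := by rw [← hr, algebraMap_smul]
        have h2 (y : T ⧸ irrelevantExtension T 𝒮) : (s : S) • y = r • y := by
          rw [← hr, algebraMap_smul]
        rw [RingHom.id_apply, h1, h2, decompose_smul]
        rfl
      · have h1 (y : T) := smul_mem_irrelevantExtension hi s.2 y
        have h2 := isHomogeneous_irrelevantExtension 𝒯 hγ n (h1 x)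
        rw [Ideal.Quotient.eq_zero_iff_mem.mpr h2]
        exact (Ideal.Quotient.eq_zero_iff_mem.mpr (h1 _)).symm

theorem componentModIrrelevant_apply [GradedAlgebra 𝒮]
    (h0S : ∀ s ∈ 𝒮 0, ∃ r : R, algebraMap R S r = s)
    (hγ : ∀ (n : ℕ), ∀ s ∈ 𝒮 n, algebraMap S T s ∈ 𝒯 n) (n : ℕ) (x : T) :
    componentModIrrelevant S 𝒯 h0S hγ n x =
      Ideal.Quotient.mk (irrelevantExtension T 𝒮) (decompose 𝒯 x n : T) := rfl

variable {K : Type*} [Field K] [Algebra S K]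

theorem exists_forall_exists_smul_mem_irrelevantExtension [GradedAlgebra 𝒮]
    (h0S : ∀ s ∈ 𝒮 0, ∃ r : R, algebraMap R S r = s)
    (hγ : ∀ (n : ℕ), ∀ s ∈ 𝒮 n, algebraMap S T s ∈ 𝒯 n) (hfg : ∀ n, (𝒯 n).FG)
    (hK : ∀ i ≠ 0, ∀ s ∈ 𝒮 i, algebraMap S K s = 0) [Module.Finite K (K ⊗[S] T)] :
    ∃ D : ℕ, ∀ n, D < n → ∃ r : R, algebraMap S K (algebraMap R S r) ≠ 0 ∧
      ∀ x ∈ 𝒯 n, r • x ∈ irrelevantExtension T 𝒮 := by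
  classical
  let π (n : ℕ) := (componentModIrrelevant S 𝒯 h0S hγ n).rangeRestrict
  have hz (z : K ⊗[S] T) : ∃ D, ∀ n, D < n → (π n).baseChange K z = 0 := by
    induction z using TensorProduct.induction_on with
    | zero => exact ⟨0, by simp⟩
    | add x y hx hy =>
      obtain ⟨D, hD⟩ := hx
      obtain ⟨E, hE⟩ := hy
      exact ⟨max D E, fun n hn ↦ by rw [map_add, hD n (by lia), hE n (by lia), add_zero]⟩
    | tmul a x =>
      refine ⟨(decompose 𝒯 x).support.sup id, fun n hn ↦ ?_⟩
      have h1 : decompose 𝒯 x n = 0 := by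
        by_contra h
        exact hn.not_ge (Finset.le_sup (f := id) (DFinsupp.mem_support_iff.mpr h))
      have h2 : π n x = 0 := Subtype.ext <| by
        simp [π, componentModIrrelevant_apply, h1]
      rw [LinearMap.baseChange_tmul, h2, TensorProduct.tmul_zero]
  obtain ⟨G, hG⟩ := Module.Finite.fg_top (R := K) (M := K ⊗[S] T)
  choose E hE using hz
  refine ⟨G.sup E, fun n hn ↦ ?_⟩
  have h1 : (π n).baseChange K = 0 := LinearMap.ext_on hG fun z hz ↦
    hE z n ((Finset.le_sup hz).trans_lt hn)
  have : Subsingleton (K ⊗[S] (componentModIrrelevant S 𝒯 h0S hγ n).range) := by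
    have hs : Function.Surjective ((π n).baseChange K) :=
      LinearMap.lTensor_surjective K (LinearMap.surjective_rangeRestrict _)
    refine subsingleton_of_forall_eq 0 fun z ↦ ?_
    obtain ⟨y, rfl⟩ := hs z
    simp [h1]
  have : Module.Finite S (componentModIrrelevant S 𝒯 h0S hγ n).range := by
    obtain ⟨F, hF⟩ := hfg n
    have hF' : (componentModIrrelevant S 𝒯 h0S hγ n).range =
        Submodule.span S (componentModIrrelevant S 𝒯 h0S hγ n '' F) := by
      refine le_antisymm ?_ (Submodule.span_le.mpr (Set.image_subset_range _ _))
      rintro _ ⟨x, rfl⟩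
      have h2 : (decompose 𝒯 x n : T) ∈ Submodule.span S (F : Set T) :=
        Submodule.span_le_restrictScalars R S _ (hF.ge (SetLike.coe_mem _))
      rw [← Submodule.map_span]
      exact ⟨_, h2, by simp [componentModIrrelevant_apply]⟩
    exact Module.Finite.of_fg (hF' ▸ Submodule.fg_span (F.finite_toSet.image _))
  obtain ⟨s, hs, hs'⟩ := exists_smul_eq_zero_of_subsingleton_tensorProduct (S := S) (K := K)
    (M := (componentModIrrelevant S 𝒯 h0S hγ n).range)
  obtain ⟨r, hr⟩ := h0S _ (SetLike.coe_mem (decompose 𝒮 s 0))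
  have hpos {i : ℕ} (hi : i ∈ (decompose 𝒮 s).support.erase 0) : i ≠ 0 := Finset.ne_of_mem_erase hi
  have hsum : s = algebraMap R S r +
      ∑ i ∈ (decompose 𝒮 s).support.erase 0, (decompose 𝒮 s i : S) := by
    rw [hr]
    conv_lhs => rw [← sum_support_decompose 𝒮 s]
    by_cases h0 : 0 ∈ (decompose 𝒮 s).support
    · exact (Finset.add_sum_erase _ _ h0).symm
    · rw [Finset.erase_eq_of_notMem h0, DFinsupp.notMem_support_iff.mp h0]
      simp
  refine ⟨r, ?_, fun x hx ↦ ?_⟩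
  · rwa [hsum, map_add, map_sum, Finset.sum_eq_zero fun i hi ↦
      hK i (hpos hi) _ (SetLike.coe_mem _), add_zero] at hs
  · have h1 := congrArg Subtype.val (hs' ⟨_, x, rfl⟩)
    have h2 : s • x ∈ irrelevantExtension T 𝒮 := by
      simp only [Submodule.coe_smul, componentModIrrelevant_apply, decompose_of_mem_same 𝒯 hx] at h1
      exact Ideal.Quotient.eq_zero_iff_mem.mp h1
    rw [hsum, add_smul, algebraMap_smul, Finset.sum_smul] at h2
    exact (add_mem_cancel_right (sum_mem fun i hi ↦
      smul_mem_irrelevantExtension (hpos hi) (SetLike.coe_mem _) x)).mp h2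

theorem exists_finite_tensorProduct_away [GradedAlgebra 𝒮]
    (h0S : ∀ s ∈ 𝒮 0, ∃ r : R, algebraMap R S r = s)
    (hγ : ∀ (n : ℕ), ∀ s ∈ 𝒮 n, algebraMap S T s ∈ 𝒯 n)
    (hT : ∃ s : Finset T, Subring.closure ((𝒯 0 : Set T) ∪ ↑s) = ⊤)
    [Module.Finite R (𝒯 0)]
    (hK : ∀ i ≠ 0, ∀ s ∈ 𝒮 i, algebraMap S K s = 0) [Module.Finite K (K ⊗[S] T)] :
    ∃ f : R, algebraMap S K (algebraMap R S f) ≠ 0 ∧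
      Module.Finite (Localization.Away (algebraMap R S f))
        (Localization.Away (algebraMap R S f) ⊗[S] T) := by
  have hfg := fg_of_finite_zero 𝒯 hT
  obtain ⟨D, hD⟩ := exists_forall_exists_smul_mem_irrelevantExtension 𝒯 h0S hγ hfg hK
  obtain ⟨d, hd⟩ := exists_forall_smul_mem_irrelevantExtension_of_le (𝒮 := 𝒮) 𝒯 hT
  choose! r hr hrJ using hD
  refine ⟨∏ n ∈ Finset.Ioc D (D + d), r n, ?_, finite_tensorProduct_away 𝒯 hγ hfg
    (hd _ D fun n hn hnd x hx ↦ ?_)⟩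
  · simp only [map_prod]
    exact Finset.prod_ne_zero_iff.mpr fun n hn ↦ hr n (Finset.mem_Ioc.mp hn).1
  · rw [← Finset.prod_erase_mul _ _ (Finset.mem_Ioc.mpr ⟨hn, hnd⟩), mul_smul]
    exact Submodule.smul_of_tower_mem _ _ (hrJ n hn x hx)

end Graded
theorem exists_ringHom_of_grading {R S : Type*} [CommRing R] [CommRing S] [Algebra R S]
    (𝒮 : ℕ → Submodule R S) [GradedAlgebra 𝒮]
    (h0S : ∀ s ∈ 𝒮 0, ∃ r : R, algebraMap R S r = s)
    (hinjS : Function.Injective (algebraMap R S)) :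
    ∃ ε : S →+* R, (∀ r, ε (algebraMap R S r) = r) ∧ ∀ i ≠ 0, ∀ s ∈ 𝒮 i, ε s = 0 := by
  let e : R ≃+* 𝒮 0 := RingEquiv.ofBijective (algebraMap R (𝒮 0))
    ⟨fun x y h ↦ hinjS (congrArg Subtype.val h), fun s ↦
      (h0S s s.2).imp fun r hr ↦ Subtype.ext hr⟩
  refine ⟨(e.symm : 𝒮 0 →+* R).comp (GradedRing.projZeroRingHom' 𝒮), fun r ↦ ?_,
    fun i hi s hs ↦ ?_⟩
  · exact e.symm_apply_eq.mpr (GradedRing.projZeroRingHom'_apply_coe 𝒮 (e r))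
  · refine e.symm_apply_eq.mpr (Subtype.ext ?_)
    simpa using decompose_of_mem_ne 𝒮 hs hi

section Scheme

theorem morphismProperty_of_isPullback_of_isPullback {C : Type*} [Category C]
    {P : MorphismProperty C} [P.IsStableUnderBaseChange] {X Y M N M' N' : C} {g : X ⟶ Y}
    {t : M ⟶ X} {m : M ⟶ N} {k : N ⟶ Y} (H : IsPullback t m g k)
    {t' : M' ⟶ X} {m' : M' ⟶ N'} {k' : N' ⟶ Y} (H' : IsPullback t' m' g k')
    (h : N' ⟶ N) (w : h ≫ k = k') (hm : P m) : P m' := by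
  have hl : t' ≫ g = (m' ≫ h) ≫ k := by rw [H'.w, Category.assoc, w]
  refine MorphismProperty.of_isPullback (f' := H.lift t' (m' ≫ h) hl) (g := m) (f := h) ?_ hm
  refine IsPullback.of_right (h₁₂ := t) (h₂₂ := k) (v₁₃ := g) ?_ (H.lift_snd _ _ _) H
  rw [H.lift_fst, w]
  exact H'

theorem isFinite_SpecMap_includeLeft_iff (S A T : Type u) [CommRing S] [CommRing A] [CommRing T]
    [Algebra S A] [Algebra S T] :
    IsFinite (Spec.map (CommRingCat.ofHom
      (Algebra.TensorProduct.includeLeftRingHom : A →+* A ⊗[S] T))) ↔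
      Module.Finite A (A ⊗[S] T) := by
  rw [IsFinite.SpecMap_iff]
  exact RingHom.finite_algebraMap

theorem isPullback_SpecMap_tensorProduct (S A T : Type u) [CommRing S] [CommRing A] [CommRing T]
    [Algebra S A] [Algebra S T] :
    IsPullback (Spec.map (CommRingCat.ofHom
        (Algebra.TensorProduct.includeRight (R := S) (A := A) (B := T)).toRingHom))
      (Spec.map (CommRingCat.ofHom
        (Algebra.TensorProduct.includeLeftRingHom : A →+* A ⊗[S] T)))
      (Spec.map (CommRingCat.ofHom (algebraMap S T)))
      (Spec.map (CommRingCat.ofHom (algebraMap S A))) :=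
  (isPullback_SpecMap_of_isPushout _ _ _ _ (CommRingCat.isPushout_tensorProduct S A T)).flip

theorem isPullback_pullback_map {C : Type*} [Category C] [HasPullbacks C] {W X Y Z : C}
    (φ : W ⟶ Z) (g : X ⟶ Y) (p : Y ⟶ Z) :
    IsPullback (pullback.snd φ (g ≫ p))
      (pullback.map φ (g ≫ p) φ p (𝟙 W) g (𝟙 Z) (by simp) (by simp))
      g (pullback.snd φ p) := by
  refine IsPullback.of_bot (v₂₁ := pullback.fst φ p) (h₃₁ := φ) (v₂₂ := p) ?_ (pullback.lift_snd ..).symm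
    (IsPullback.of_hasPullback φ p).flip
  rw [show pullback.map φ (g ≫ p) φ p (𝟙 W) g (𝟙 Z) (by simp) (by simp) ≫ pullback.fst φ p =
    pullback.fst φ (g ≫ p) from (pullback.lift_fst ..).trans (Category.comp_id _)]
  exact (IsPullback.of_hasPullback φ (g ≫ p)).flip

theorem isZariskiLocalAtTarget_isFinite : IsZariskiLocalAtTarget @IsFinite.{u} :=
  (HasAffineProperty.iff.mp
    IsFinite.instHasAffinePropertyAndIsAffineFiniteCarrierObjOppositeOpensCarrierCarrierCommRingCatPresheafOpOpensTopHomAppTop).1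

end Scheme

/-- there is an open `U ⊆ Spec S_0` such that for every `S_0`-scheme
`φ : W → Spec S_0`, the base change `W ×_{Spec S_0} Spec T → W ×_{Spec S_0} Spec S` of
`Spec γ : Spec T → Spec S` along `φ` is a finite morphism iff `im φ ⊆ U`. -/
theorem exists_open_finite_iff_range_subset {R S T : Type u} [CommRing R] [CommRing S]
    [CommRing T] [Algebra R S] [Algebra R T] [Algebra S T] [IsScalarTower R S T]
    (𝒮 : ℕ → Submodule R S) [GradedAlgebra 𝒮]
    (𝒯 : ℕ → Submodule R T) [GradedAlgebra 𝒯]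
    (h0S : ∀ s ∈ 𝒮 0, ∃ r : R, algebraMap R S r = s)
    (hinjS : Function.Injective (algebraMap R S))
    (hγ : ∀ (n : ℕ), ∀ s ∈ 𝒮 n, algebraMap S T s ∈ 𝒯 n)
    (hTfgalg : ∃ s : Finset T, Subring.closure ((𝒯 0 : Set T) ∪ ↑s) = ⊤)
    (hT0fg : Module.Finite R ↥(𝒯 0)) :
    ∃ U : TopologicalSpace.Opens (Spec (CommRingCat.of R)),
      ∀ (W : Scheme.{u}) (φ : W ⟶ Spec (CommRingCat.of R)),
        IsFinite (pullback.map φ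
            (Spec.map (CommRingCat.ofHom (algebraMap S T)) ≫
              Spec.map (CommRingCat.ofHom (algebraMap R S)))
            φ (Spec.map (CommRingCat.ofHom (algebraMap R S)))
            (𝟙 W) (Spec.map (CommRingCat.ofHom (algebraMap S T))) (𝟙 _)
            (by simp) (by simp)) ↔
          Set.range φ.base ⊆ (U : Set (Spec (CommRingCat.of R))) := by
  let g := Spec.map (CommRingCat.ofHom (algebraMap S T))
  let p := Spec.map (CommRingCat.ofHom (algebraMap R S))
  let ι := {f : R // Module.Finite (Localization.Away (algebraMap R S f))
    (Localization.Away (algebraMap R S f) ⊗[S] T)}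
  let V (f : ι) : (Spec (CommRingCat.of R)).Opens := PrimeSpectrum.basicOpen f.1
  refine ⟨⨆ f, V f, fun W φ ↦ ⟨fun H ↦ ?_, fun H ↦ ?_⟩⟩
  · rintro _ ⟨w, rfl⟩
    obtain ⟨ε, hε, hε0⟩ := exists_ringHom_of_grading 𝒮 h0S hinjS
    obtain ⟨ψ, hψ⟩ := Spec.map_surjective (W.fromSpecResidueField w ≫ φ)
    let _ : Algebra S (W.residueField w) := (ψ.hom.comp ε).toAlgebra
    have hcomp : W.fromSpecResidueField w ≫ φ =
        Spec.map (CommRingCat.ofHom (algebraMap S (W.residueField w))) ≫ p := by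
      rw [← hψ, ← Spec.map_comp, ← CommRingCat.ofHom_comp]
      congr 1
      ext r
      simp [RingHom.algebraMap_toAlgebra, hε]
    have : Module.Finite (W.residueField w) (W.residueField w ⊗[S] T) :=
      (isFinite_SpecMap_includeLeft_iff S (W.residueField w) T).mp <|
        morphismProperty_of_isPullback_of_isPullback (P := @IsFinite)
          (isPullback_pullback_map φ g p) (isPullback_SpecMap_tensorProduct _ _ _)
          (pullback.lift _ _ hcomp) (pullback.lift_snd _ _ _) H
    obtain ⟨f, hf, hfin⟩ := exists_finite_tensorProduct_away (K := W.residueField w) 𝒯 h0S hγ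
      hTfgalg fun i hi s hs ↦ by simp [RingHom.algebraMap_toAlgebra, hε0 i hi s hs]
    refine TopologicalSpace.Opens.mem_iSup.mpr ⟨⟨f, hfin⟩, ?_⟩
    let x : Spec (W.residueField w) := IsLocalRing.closedPoint (W.residueField w)
    have hw : φ w = Spec.map ψ x := by
      rw [hψ, Scheme.Hom.comp_apply, Scheme.fromSpecResidueField_apply]
    have hψf : algebraMap S (W.residueField w) (algebraMap R S f) = ψ.hom f := by
      rw [RingHom.algebraMap_toAlgebra, RingHom.comp_apply, hε]
    rw [hw]
    change ψ.hom f ∉ IsLocalRing.maximalIdeal (W.residueField w)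
    rwa [IsLocalRing.maximalIdeal_eq_bot, Ideal.mem_bot, ← hψf]
  · have := isZariskiLocalAtTarget_isFinite.{u}
    refine IsZariskiLocalAtTarget.of_iSup_eq_top (P := @IsFinite)
      (fun f ↦ (pullback.snd φ p ≫ p) ⁻¹ᵁ (V f)) ?_ fun f ↦ ?_
    · rw [← Scheme.Hom.preimage_iSup, ← pullback.condition]
      exact top_le_iff.mp fun x _ ↦ H ⟨pullback.fst φ p x, rfl⟩
    · let A := Localization.Away (algebraMap R S f.1)
      let j := Spec.map (CommRingCat.ofHom (algebraMap S A))
      set N := (pullback.snd φ p ≫ p) ⁻¹ᵁ (V f)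
      have hfin := (isFinite_SpecMap_includeLeft_iff S A T).mpr f.2
      have : IsOpenImmersion j := inferInstance
      have hr : Set.range (N.ι ≫ pullback.snd φ p) ⊆ Set.range j := by
        rintro _ ⟨x, rfl⟩
        have hx : p (pullback.snd φ p x.1) ∈ V f := x.2
        refine (PrimeSpectrum.localization_away_comap_range A (algebraMap R S f.1)).ge ?_
        exact hx
      refine morphismProperty_of_isPullback_of_isPullback (P := @IsFinite)
        (isPullback_SpecMap_tensorProduct S A T)
        ((isPullback_morphismRestrict _ N).flip.paste_horiz (isPullback_pullback_map φ g p))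
        (IsOpenImmersion.lift j _ hr) (IsOpenImmersion.lift_fac _ _ _) hfin

end
end
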